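/- Consider the delayed van der Pol oscillator ẍ(t) + a(x²(t) − 1)ẋ(t) + x(t) = f(x(t − τ0(a))) + ε g(ω't, x(t), x(t − τ0(a)), ε), where f(0) = f''(0) = 0, f'(0) = 1, f'''(0) = 6b1 with b1 ≠ 0, ω' satisfies the Diophantine condition, and hypothesis (H4)'' holds. Then for most parameter values a in Π0 = [1/4, 5/4] and for all sufficiently small ε > 0, the equation possesses a quasi-periodic solution x(t) with frequency ω' satisfying x = O(ε^{1/3}); precisely, for every η > 0 there exist ε* > 0 and a measurable subset Π ⊆ [1/4, 5/4] with Meas(Π) ≥ Meas([1/4,5/4]) − η such that for every a ∈ Π and every 0 < ε ≤ ε* there is a real analytic function X : 𝕋^{n0} → ℝ with sup|X| ≤ C ε^{1/3} such that x(t) = X(ω' t) solves the equation for all t ∈ ℝ. -/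

import Mathlib

open Real MeasureTheory

/-- `ω0(a) = √(2 - a²)`. -/
noncomputable def omega0 (a : ℝ) : ℝ := Real.sqrt (2 - a ^ 2)

/-- The critical delay `τ0(a)`. -/
noncomputable def tau0 (a : ℝ) : ℝ :=
  if 1 < a then Real.arcsin (a * omega0 a) / omega0 a
  else (Real.pi - Real.arcsin (a * omega0 a)) / omega0 a

/-- The torus average `(2π)^{−n0} ∫_{𝕋^{n0}} h(φ) dφ` over the fundamental domain. -/
noncomputable def torusAvg (n0 : ℕ) (h : (Fin n0 → ℝ) → ℝ) : ℝ :=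
  ((2 * Real.pi) ^ n0)⁻¹ *
    ∫ φ in Set.pi Set.univ (fun _ : Fin n0 => Set.Icc (0 : ℝ) (2 * Real.pi)), h φ

set_option linter.unusedSectionVars false
set_option linter.style.longLine false

namespace VdP
open scoped NNReal ENNReal
noncomputable section

/-- Fourier index lattice. -/
abbrev Idx (d : ℕ) := Fin d → ℤ

/-- The `ℓ¹` length of an index. -/
def nrm {d : ℕ} (k : Idx d) : ℝ := ∑ i, |(k i : ℝ)|

lemma nrm_nonneg {d : ℕ} (k : Idx d) : 0 ≤ nrm k := Finset.sum_nonneg fun _ _ => abs_nonneg _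

lemma nrm_add_le {d : ℕ} (k l : Idx d) : nrm (k + l) ≤ nrm k + nrm l := by
  unfold nrm
  rw [← Finset.sum_add_distrib]
  refine Finset.sum_le_sum fun i _ => ?_
  push_cast [Pi.add_apply]
  exact abs_add_le _ _

lemma nrm_neg {d : ℕ} (k : Idx d) : nrm (-k) = nrm k := by
  unfold nrm; simp

lemma nrm_zero {d : ℕ} : nrm (0 : Idx d) = 0 := by
  unfold nrm; simp

/-- Structure constants. -/
def theta {d : ℕ} (ρ : ℝ≥0) (k l : Idx d) : ℝ := Real.exp (-(ρ * (nrm k + nrm l - nrm (k + l))))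

lemma theta_pos {d : ℕ} (ρ : ℝ≥0) (k l : Idx d) : 0 < theta ρ k l := Real.exp_pos _

lemma theta_le_one {d : ℕ} (ρ : ℝ≥0) (k l : Idx d) : theta ρ k l ≤ 1 := by
  unfold theta
  rw [Real.exp_le_one_iff, neg_nonpos]
  have := nrm_add_le k l
  exact mul_nonneg ρ.2 (by linarith)

lemma theta_comm {d : ℕ} (ρ : ℝ≥0) (k l : Idx d) : theta ρ k l = theta ρ l k := by
  unfold theta; rw [add_comm (nrm k), add_comm k]

lemma theta_assoc {d : ℕ} (ρ : ℝ≥0) (k l m : Idx d) :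
    theta ρ (k + l) m * theta ρ k l = theta ρ k (l + m) * theta ρ l m := by
  unfold theta; rw [← Real.exp_add, ← Real.exp_add, add_assoc k l m]; congr 1; ring

lemma theta_zero_left {d : ℕ} (ρ : ℝ≥0) (k : Idx d) : theta ρ 0 k = 1 := by
  unfold theta; simp [nrm_zero]

lemma theta_neg {d : ℕ} (ρ : ℝ≥0) (k l : Idx d) : theta ρ (-k) (-l) = theta ρ k l := by
  unfold theta; rw [← neg_add, nrm_neg, nrm_neg, nrm_neg]

/-- The weighted Wiener algebra with coefficients in `B` (weights are absorbed in the product). -/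
def Wal (d : ℕ) (_ρ : ℝ≥0) (B : Type) [NormedCommRing B] : Type := lp (fun _ : Idx d => B) 1

variable {d : ℕ} {ρ : ℝ≥0} {B : Type} [NormedCommRing B]

instance : NormedAddCommGroup (Wal d ρ B) := inferInstanceAs (NormedAddCommGroup (lp (fun _ : Idx d => B) 1))
instance [NormedAlgebra ℝ B] : NormedSpace ℝ (Wal d ρ B) :=
  inferInstanceAs (NormedSpace ℝ (lp (fun _ : Idx d => B) 1))
instance [CompleteSpace B] : CompleteSpace (Wal d ρ B) :=
  inferInstanceAs (CompleteSpace (lp (fun _ : Idx d => B) 1))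

/-- Coefficients. -/
def cf (u : Wal d ρ B) (k : Idx d) : B := (show lp (fun _ : Idx d => B) 1 from u) k

/-- Basis elements. -/
def bs (k : Idx d) (z : B) : Wal d ρ B := (lp.single 1 k z : lp (fun _ : Idx d => B) 1)

lemma cf_add (u v : Wal d ρ B) (k : Idx d) : cf (u + v) k = cf u k + cf v k := rfl
lemma cf_sub (u v : Wal d ρ B) (k : Idx d) : cf (u - v) k = cf u k - cf v k := rfl
lemma cf_zero (k : Idx d) : cf (0 : Wal d ρ B) k = 0 := rfl
lemma cf_smul [NormedAlgebra ℝ B] (c : ℝ) (u : Wal d ρ B) (k : Idx d) : cf (c • u) k = c • cf u k := rfl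

lemma cf_ext {u v : Wal d ρ B} (h : ∀ k, cf u k = cf v k) : u = v := by
  apply lp.ext; funext k; exact h k

lemma cf_bs_self (k : Idx d) (z : B) : cf (bs k z : Wal d ρ B) k = z := lp.single_apply_self _ _ _
lemma cf_bs_ne {k l : Idx d} (h : l ≠ k) (z : B) : cf (bs k z : Wal d ρ B) l = 0 :=
  lp.single_apply_ne _ _ _ h

lemma norm_bs (k : Idx d) (z : B) : ‖(bs k z : Wal d ρ B)‖ = ‖z‖ := by
  have h : ‖(lp.single 1 k z : lp (fun _ : Idx d => B) 1)‖ = ‖z‖ :=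
    lp.norm_single (E := fun _ : Idx d => B) one_pos k z
  exact h

lemma hasSum_norm_cf (u : Wal d ρ B) : HasSum (fun k => ‖cf u k‖) ‖u‖ := by
  have h : HasSum (fun k => ‖cf u k‖ ^ (1 : ℝ≥0∞).toReal) (‖u‖ ^ (1 : ℝ≥0∞).toReal) :=
    lp.hasSum_norm (E := fun _ : Idx d => B) (p := 1) (by norm_num) u
  simpa only [ENNReal.toReal_one, Real.rpow_one] using h

lemma summable_norm_cf (u : Wal d ρ B) : Summable (fun k => ‖cf u k‖) := (hasSum_norm_cf u).summable

lemma norm_cf_le (u : Wal d ρ B) (k : Idx d) : ‖cf u k‖ ≤ ‖u‖ := by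
  rw [← (hasSum_norm_cf u).tsum_eq]
  exact (summable_norm_cf u).le_tsum k fun _ _ => norm_nonneg _

lemma hasSum_bs (u : Wal d ρ B) : HasSum (fun k => (bs k (cf u k) : Wal d ρ B)) u :=
  lp.hasSum_single (E := fun _ : Idx d => B) (p := 1) (by norm_num) u

lemma bs_add (k : Idx d) (z w : B) : (bs k (z + w) : Wal d ρ B) = bs k z + bs k w :=
  lp.single_add _ _ _ _

lemma bs_zero (k : Idx d) : (bs k 0 : Wal d ρ B) = 0 := lp.single_zero _ _

/-- Build an element from a summable family. -/
def mkW (c : Idx d → B) (h : Summable fun k => ‖c k‖) : Wal d ρ B :=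
  (⟨c, memℓp_gen (by simpa using h)⟩ : lp (fun _ : Idx d => B) 1)

lemma cf_mkW (c : Idx d → B) (h : Summable fun k => ‖c k‖) (k : Idx d) :
    cf (mkW c h : Wal d ρ B) k = c k := rfl

lemma norm_eq_tsum (u : Wal d ρ B) : ‖u‖ = ∑' k, ‖cf u k‖ := (hasSum_norm_cf u).tsum_eq.symm

/-- Density induction. -/
lemma wal_induction {P : Wal d ρ B → Prop} (hbs : ∀ k z, P (bs k z))
    (hadd : ∀ u v, P u → P v → P (u + v)) (hc : IsClosed {u | P u}) (u : Wal d ρ B) : P u := by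
  have h0 : P 0 := by simpa [bs_zero] using hbs 0 0
  have hs : ∀ s : Finset (Idx d), P (∑ k ∈ s, bs k (cf u k)) := by
    intro s
    induction s using Finset.induction_on with
    | empty => simpa using h0
    | insert a s ha ih => rw [Finset.sum_insert ha]; exact hadd _ _ (hbs _ _) ih
  exact hc.mem_of_tendsto (hasSum_bs u) (Filter.Eventually.of_forall hs)

section alg
variable [NormedAlgebra ℝ B]

lemma bs_smul (k : Idx d) (c : ℝ) (z : B) : (bs k (c • z) : Wal d ρ B) = c • bs k z :=
  lp.single_smul _ _ _ _

/-- `bs k` as a continuous linear map. -/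
def bsL (k : Idx d) : B →L[ℝ] Wal d ρ B :=
  LinearMap.mkContinuous { toFun := bs k, map_add' := bs_add k, map_smul' := fun c z => bs_smul k c z } 1
    (fun z => by simp [norm_bs])

@[simp] lemma bsL_apply (k : Idx d) (z : B) : (bsL k z : Wal d ρ B) = bs k z := rfl

lemma norm_bsL_le (k : Idx d) : ‖(bsL k : B →L[ℝ] Wal d ρ B)‖ ≤ 1 :=
  LinearMap.mkContinuous_norm_le _ zero_le_one _

/-- `cf · k` as a continuous linear map. -/
def cfL (k : Idx d) : Wal d ρ B →L[ℝ] B :=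
  LinearMap.mkContinuous { toFun := fun u => cf u k, map_add' := fun u v => cf_add u v k, map_smul' := fun c z => cf_smul c z k } 1
    (fun z => by simpa using norm_cf_le z k)

@[simp] lemma cfL_apply (k : Idx d) (u : Wal d ρ B) : cfL k u = cf u k := rfl

variable {E : Type*} [NormedAddCommGroup E] [NormedSpace ℝ E] [CompleteSpace E]

lemma clm_ext {f g : Wal d ρ B →L[ℝ] E} (h : ∀ k z, f (bs k z) = g (bs k z)) : f = g := by
  ext u
  refine wal_induction (P := fun u => f u = g u) h ?_ ?_ u
  · intro u v hu hv; simp [hu, hv]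
  · exact isClosed_eq f.continuous g.continuous

open Classical in
/-- Universal property of `ℓ¹`. -/
def lift (b : Idx d → B →L[ℝ] E) : Wal d ρ B →L[ℝ] E :=
  if h : ∃ C, ∀ k, ‖b k‖ ≤ C then
    LinearMap.mkContinuous
      { toFun := fun u => ∑' k, b k (cf u k)
        map_add' := by
          obtain ⟨C, hC⟩ := h
          have hs : ∀ u : Wal d ρ B, Summable fun k => b k (cf u k) := fun u =>
            Summable.of_norm_bounded ((summable_norm_cf u).mul_left C)
              fun k => (b k).le_of_opNorm_le (hC k) _
          intro u v
          simp only [cf_add, map_add]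
          exact (hs u).tsum_add (hs v)
        map_smul' := by
          obtain ⟨C, hC⟩ := h
          intro c u
          simp only [cf_smul, map_smul, RingHom.id_apply]
          exact tsum_const_smul'' c }
      h.choose (by
          intro u
          have hC := h.choose_spec
          simp only [LinearMap.coe_mk, AddHom.coe_mk]
          rw [norm_eq_tsum u, ← tsum_mul_left]
          exact tsum_of_norm_bounded ((summable_norm_cf u).mul_left _).hasSum
              fun k => (b k).le_of_opNorm_le (hC k) _)
  else 0

lemma lift_apply {b : Idx d → B →L[ℝ] E} {C : ℝ} (h : ∀ k, ‖b k‖ ≤ C) (u : Wal d ρ B) :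
    lift b u = ∑' k, b k (cf u k) := by
  unfold lift; rw [dif_pos ⟨C, h⟩]; rfl

lemma lift_hasSum {b : Idx d → B →L[ℝ] E} {C : ℝ} (h : ∀ k, ‖b k‖ ≤ C) (u : Wal d ρ B) :
    HasSum (fun k => b k (cf u k)) (lift b u) := by
  rw [lift_apply h]
  exact (Summable.of_norm_bounded ((summable_norm_cf u).mul_left C)
              fun k => (b k).le_of_opNorm_le (h k) _).hasSum

lemma lift_bs {b : Idx d → B →L[ℝ] E} {C : ℝ} (h : ∀ k, ‖b k‖ ≤ C) (k : Idx d) (z : B) :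
    lift b (bs k z : Wal d ρ B) = b k z := by
  rw [lift_apply h, tsum_eq_single k, cf_bs_self]
  intro l hl; rw [cf_bs_ne hl, map_zero]

lemma norm_le_of_bs {f : Wal d ρ B →L[ℝ] E} {C : ℝ} (hC : 0 ≤ C) (h : ∀ k z, ‖f (bs k z)‖ ≤ C * ‖z‖) :
    ‖f‖ ≤ C := by
  refine f.opNorm_le_bound hC fun u => ?_
  have h1 := (hasSum_bs u).mapL f
  rw [← h1.tsum_eq, norm_eq_tsum u, ← tsum_mul_left]
  exact tsum_of_norm_bounded ((summable_norm_cf u).mul_left _).hasSum fun k => h _ _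

lemma norm_lift_le {b : Idx d → B →L[ℝ] E} {C : ℝ} (hC : 0 ≤ C) (h : ∀ k, ‖b k‖ ≤ C) :
    ‖(lift b : Wal d ρ B →L[ℝ] E)‖ ≤ C :=
  norm_le_of_bs hC fun k z => by rw [lift_bs h]; exact (b k).le_of_opNorm_le (h k) _

end alg
end
end VdP

set_option linter.unusedSectionVars false
set_option linter.style.longLine false

namespace VdP
open scoped NNReal ENNReal
noncomputable section

section mulsec
variable {d : ℕ} {ρ : ℝ≥0} {B : Type} [NormedCommRing B] [NormedAlgebra ℝ B] [CompleteSpace B]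

lemma summable_mulFun (u v : Wal d ρ B) : Summable (fun p : Idx d × Idx d =>
    (bs (p.1 + p.2) (theta ρ p.1 p.2 • (cf u p.1 * cf v p.2)) : Wal d ρ B)) ∧
    ‖∑' p : Idx d × Idx d, (bs (p.1 + p.2) (theta ρ p.1 p.2 • (cf u p.1 * cf v p.2)) : Wal d ρ B)‖
      ≤ ‖u‖ * ‖v‖ := by
  have h1 : HasSum (fun p : Idx d × Idx d => ‖cf u p.1‖ * ‖cf v p.2‖) (‖u‖ * ‖v‖) :=
    (hasSum_norm_cf u).mul (hasSum_norm_cf v)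
      ((summable_norm_cf u).mul_of_nonneg (summable_norm_cf v) (fun _ => norm_nonneg _) (fun _ => norm_nonneg _))
  have hb : ∀ p : Idx d × Idx d,
      ‖(bs (p.1 + p.2) (theta ρ p.1 p.2 • (cf u p.1 * cf v p.2)) : Wal d ρ B)‖ ≤ ‖cf u p.1‖ * ‖cf v p.2‖ := by
    intro p
    rw [norm_bs, norm_smul, Real.norm_of_nonneg (theta_pos _ _ _).le]
    calc _ ≤ 1 * (‖cf u p.1‖ * ‖cf v p.2‖) := by
          gcongr
          · exact theta_le_one _ _ _
          · exact norm_mul_le _ _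
      _ = _ := one_mul _
  exact ⟨Summable.of_norm_bounded h1.summable hb, tsum_of_norm_bounded h1 hb⟩

/-- The convolution product as a continuous bilinear map. -/
def mulL : Wal d ρ B →L[ℝ] Wal d ρ B →L[ℝ] Wal d ρ B :=
  LinearMap.mkContinuous₂
    (LinearMap.mk₂ ℝ
      (fun u v => ∑' p : Idx d × Idx d, (bs (p.1 + p.2) (theta ρ p.1 p.2 • (cf u p.1 * cf v p.2)) : Wal d ρ B))
      (by
        intro u v w
        rw [← (summable_mulFun u w).1.tsum_add (summable_mulFun v w).1]
        simp only [cf_add, add_mul, smul_add, bs_add])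
      (by
        intro c u v
        rw [← tsum_const_smul'' c]
        simp only [cf_smul, smul_mul_assoc, ← bs_smul, smul_comm c])
      (by
        intro u v w
        rw [← (summable_mulFun u v).1.tsum_add (summable_mulFun u w).1]
        simp only [cf_add, mul_add, smul_add, bs_add])
      (by
        intro c u v
        rw [← tsum_const_smul'' c]
        simp only [cf_smul, mul_smul_comm, ← bs_smul, smul_comm c]))
    1 (by intro u v; simpa using (summable_mulFun u v).2)

lemma norm_mulL_apply_le (u v : Wal d ρ B) : ‖mulL u v‖ ≤ ‖u‖ * ‖v‖ := (summable_mulFun u v).2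

lemma mulL_bs (k l : Idx d) (z w : B) :
    (mulL (bs k z) (bs l w) : Wal d ρ B) = bs (k + l) (theta ρ k l • (z * w)) := by
  change ∑' p : Idx d × Idx d, (bs (p.1 + p.2) (theta ρ p.1 p.2 • (cf (bs k z : Wal d ρ B) p.1 * cf (bs l w : Wal d ρ B) p.2)) : Wal d ρ B) = _
  rw [tsum_eq_single (k, l), cf_bs_self, cf_bs_self]
  intro p hp
  by_cases h1 : p.1 = k
  · have h2 : p.2 ≠ l := fun h2 => hp (Prod.ext h1 h2)
    rw [cf_bs_ne h2, mul_zero, smul_zero, bs_zero]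
  · rw [cf_bs_ne h1, zero_mul, smul_zero, bs_zero]

lemma mulL_comm (u v : Wal d ρ B) : mulL u v = mulL v u := by
  have h : (mulL : Wal d ρ B →L[ℝ] _) = mulL.flip := by
    refine clm_ext fun k z => clm_ext fun l w => ?_
    simp only [ContinuousLinearMap.flip_apply, mulL_bs]
    rw [theta_comm, mul_comm z, add_comm k]
  conv_lhs => rw [h]
  rfl

lemma mulL_assoc (u v w : Wal d ρ B) : mulL (mulL u v) w = mulL u (mulL v w) := by
  refine wal_induction (P := fun u => ∀ v w, mulL (mulL u v) w = mulL u (mulL v w)) ?_ ?_ ?_ u v w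
  · intro k x v w
    refine wal_induction (P := fun v => ∀ w, mulL (mulL (bs k x) v) w = mulL (bs k x) (mulL v w)) ?_ ?_ ?_ v w
    · intro l y w
      refine wal_induction (P := fun w => mulL (mulL (bs k x) (bs l y)) w = mulL (bs k x) (mulL (bs l y) w)) ?_ ?_ ?_ w
      · intro m z
        simp only [mulL_bs]
        rw [smul_mul_assoc, smul_smul, theta_assoc, mul_smul_comm, smul_smul, add_assoc, mul_assoc]
      · intro a b ha hb; simp only [map_add, ha, hb]
      · exact isClosed_eq (by fun_prop) (by fun_prop)
    · intro a b ha hb w; simp only [map_add, add_apply, ha, hb]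
    · simp only [Set.ofPred_forall]
      refine isClosed_iInter fun w => isClosed_eq (by fun_prop) (by fun_prop)
  · intro a b ha hb w; simp only [map_add, add_apply, ha, hb]; simp
  · simp only [Set.ofPred_forall]
    refine isClosed_iInter fun v => isClosed_iInter fun w => isClosed_eq (by fun_prop) (by fun_prop)

lemma one_mulL (u : Wal d ρ B) : mulL (bs 0 1) u = u := by
  have h : (mulL (bs 0 1) : Wal d ρ B →L[ℝ] _) = ContinuousLinearMap.id ℝ _ := by
    refine clm_ext fun k z => ?_
    rw [mulL_bs, theta_zero_left]; simp
  rw [h]; rfl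

instance instWalRing : NormedCommRing (Wal d ρ B) :=
  { (inferInstance : NormedAddCommGroup (Wal d ρ B)) with
    mul := fun u v => mulL u v
    one := bs 0 1
    mul_assoc := mulL_assoc
    mul_comm := mulL_comm
    one_mul := one_mulL
    mul_one := fun u => (mulL_comm u _).trans (one_mulL u)
    zero_mul := fun u => by change mulL 0 u = 0; simp
    mul_zero := fun u => by change mulL u 0 = 0; simp
    left_distrib := fun u v w => by change mulL u (v + w) = mulL u v + mulL u w; simp
    right_distrib := fun u v w => by change mulL (u + v) w = mulL u w + mulL v w; simp
    norm_mul_le := norm_mulL_apply_le }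

lemma mul_def (u v : Wal d ρ B) : u * v = mulL u v := rfl
lemma one_def : (1 : Wal d ρ B) = bs 0 1 := rfl

lemma bs_mul_bs (k l : Idx d) (z w : B) :
    (bs k z * bs l w : Wal d ρ B) = bs (k + l) (theta ρ k l • (z * w)) := mulL_bs k l z w

instance instWalAlg : NormedAlgebra ℝ (Wal d ρ B) :=
  { Algebra.ofModule (fun c u v => by simp [mul_def]) (fun c u v => by simp [mul_def]) with
    norm_smul_le := fun c u => norm_smul_le c u }

instance [NormOneClass B] : NormOneClass (Wal d ρ B) := ⟨by rw [one_def, norm_bs, norm_one]⟩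

/-- Constants. -/
def cst (z : B) : Wal d ρ B := bs 0 z
lemma cst_mul_bs (z : B) (l : Idx d) (w : B) : (cst z * bs l w : Wal d ρ B) = bs l (z * w) := by
  unfold cst; rw [bs_mul_bs, theta_zero_left]; simp

/-- The Fourier multiplier with symbol `m`. -/
def mult (m : Idx d → B) : Wal d ρ B →L[ℝ] Wal d ρ B :=
  lift fun k => (bsL k).comp (ContinuousLinearMap.mul ℝ B (m k))

lemma mult_aux {m : Idx d → B} {C : ℝ} (h : ∀ k, ‖m k‖ ≤ C) (k : Idx d) :
    ‖(bsL k : B →L[ℝ] Wal d ρ B).comp (ContinuousLinearMap.mul ℝ B (m k))‖ ≤ C := by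
  refine ContinuousLinearMap.opNorm_le_bound _ ((norm_nonneg _).trans (h k)) fun z => ?_
  simp only [ContinuousLinearMap.comp_apply, bsL_apply, norm_bs, ContinuousLinearMap.mul_apply']
  exact (norm_mul_le _ _).trans (mul_le_mul_of_nonneg_right (h k) (norm_nonneg _))

lemma mult_bs {m : Idx d → B} {C : ℝ} (h : ∀ k, ‖m k‖ ≤ C) (k : Idx d) (z : B) :
    mult m (bs k z : Wal d ρ B) = bs k (m k * z) := by
  unfold mult; rw [lift_bs (mult_aux h)]; rfl

lemma norm_mult_le {m : Idx d → B} {C : ℝ} (hC : 0 ≤ C) (h : ∀ k, ‖m k‖ ≤ C) :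
    ‖(mult m : Wal d ρ B →L[ℝ] Wal d ρ B)‖ ≤ C := norm_lift_le hC (mult_aux h)

lemma norm_mult_apply_le {m : Idx d → B} {C : ℝ} (hC : 0 ≤ C) (h : ∀ k, ‖m k‖ ≤ C) (u : Wal d ρ B) :
    ‖mult m u‖ ≤ C * ‖u‖ := (mult m).le_of_opNorm_le (norm_mult_le hC h) u

lemma cf_mult {m : Idx d → B} {C : ℝ} (h : ∀ k, ‖m k‖ ≤ C) (u : Wal d ρ B) (k : Idx d) :
    cf (mult m u) k = m k * cf u k := by
  have : (cfL k).comp (mult m) = (ContinuousLinearMap.mul ℝ B (m k)).comp (cfL k : Wal d ρ B →L[ℝ] B) := by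
    refine clm_ext fun l z => ?_
    simp only [ContinuousLinearMap.comp_apply, cfL_apply, mult_bs h, ContinuousLinearMap.mul_apply']
    by_cases hl : k = l
    · subst hl; rw [cf_bs_self, cf_bs_self]
    · rw [cf_bs_ne hl, cf_bs_ne hl, mul_zero]
  exact DFunLike.congr_fun this u

lemma mult_mult {m n : Idx d → B} {C D : ℝ} (h : ∀ k, ‖m k‖ ≤ C) (h' : ∀ k, ‖n k‖ ≤ D) (u : Wal d ρ B) :
    mult m (mult n u) = mult (fun k => m k * n k) u := by
  have h2 : ∀ k, ‖m k * n k‖ ≤ C * D := fun k => (norm_mul_le _ _).trans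
    (mul_le_mul (h k) (h' k) (norm_nonneg _) ((norm_nonneg _).trans (h k)))
  refine cf_ext fun k => ?_
  rw [cf_mult h, cf_mult h', cf_mult h2, mul_assoc]

lemma mult_cst {m : Idx d → B} {C : ℝ} (h : ∀ k, ‖m k‖ ≤ C) (z : B) :
    mult m (cst z : Wal d ρ B) = cst (m 0 * z) := mult_bs h 0 z

section star
variable [StarRing B] [NormedStarGroup B] [StarModule ℝ B]

/-- Conjugation. -/
def sg : Wal d ρ B →L[ℝ] Wal d ρ B :=
  lift fun k => (bsL (-k)).comp (starL' ℝ : B ≃L[ℝ] B).toContinuousLinearMap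

lemma sg_aux (k : Idx d) :
    ‖(bsL (-k) : B →L[ℝ] Wal d ρ B).comp (starL' ℝ : B ≃L[ℝ] B).toContinuousLinearMap‖ ≤ 1 := by
  refine ContinuousLinearMap.opNorm_le_bound _ zero_le_one fun z => ?_
  simp [norm_bs]

lemma sg_bs (k : Idx d) (z : B) : sg (bs k z : Wal d ρ B) = bs (-k) (star z) := by
  unfold sg; rw [lift_bs sg_aux]; rfl

lemma norm_sg_le (u : Wal d ρ B) : ‖sg u‖ ≤ ‖u‖ := by
  simpa using (sg : Wal d ρ B →L[ℝ] Wal d ρ B).le_of_opNorm_le (norm_lift_le zero_le_one sg_aux) u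

lemma sg_mul (u v : Wal d ρ B) : sg (u * v) = sg u * sg v := by
  refine wal_induction (P := fun u => ∀ v, sg (u * v) = sg u * sg v) ?_ ?_ ?_ u v
  · intro k x v
    refine wal_induction (P := fun v => sg (bs k x * v) = sg (bs k x) * sg v) ?_ ?_ ?_ v
    · intro l y
      simp only [bs_mul_bs, sg_bs, theta_neg, star_smul, star_mul', star_trivial]
      rw [neg_add]
    · intro a b ha hb; simp only [mul_add, map_add, ha, hb]
    · exact isClosed_eq (by fun_prop) (by fun_prop)
  · intro a b ha hb w; simp only [map_add, add_mul, ha, hb]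
  · simp only [Set.ofPred_forall]
    exact isClosed_iInter fun v => isClosed_eq (by fun_prop) (by fun_prop)

lemma sg_one : sg (1 : Wal d ρ B) = 1 := by rw [one_def, sg_bs]; simp

lemma sg_cst (z : B) : sg (cst z : Wal d ρ B) = cst (star z) := by
  unfold cst; rw [sg_bs]; simp

lemma cf_sg (u : Wal d ρ B) (k : Idx d) : cf (sg u) k = star (cf u (-k)) := by
  have : (cfL k).comp (sg : Wal d ρ B →L[ℝ] Wal d ρ B) = (starL' ℝ : B ≃L[ℝ] B).toContinuousLinearMap.comp (cfL (-k) : Wal d ρ B →L[ℝ] B) := by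
    refine clm_ext fun l z => ?_
    simp only [ContinuousLinearMap.comp_apply, cfL_apply, sg_bs]
    by_cases hl : -k = l
    · subst hl; rw [neg_neg, cf_bs_self, cf_bs_self]; rfl
    · rw [cf_bs_ne hl, cf_bs_ne (fun h => hl (by rw [h, neg_neg])), map_zero]
  exact DFunLike.congr_fun this u

lemma sg_mult {m : Idx d → B} {C : ℝ} (h : ∀ k, ‖m k‖ ≤ C) (hs : ∀ k, m (-k) = star (m k)) (u : Wal d ρ B) :
    sg (mult m u) = mult m (sg u) := by
  refine cf_ext fun k => ?_
  rw [cf_sg, cf_mult h, cf_mult h, cf_sg, star_mul', hs, star_star]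

end star

/-- Character `k ↦ e^{i k φ}` with weight. -/
def chr (ρ : ℝ≥0) (φ : Fin d → ℝ) (k : Idx d) : ℂ :=
  (Real.exp (-(ρ * nrm k)) : ℝ) * Complex.exp (Complex.I * (∑ i, (k i : ℝ) * φ i : ℝ))

lemma norm_chr (φ : Fin d → ℝ) (k : Idx d) : ‖chr ρ φ k‖ = Real.exp (-(ρ * nrm k)) := by
  unfold chr
  rw [norm_mul, mul_comm Complex.I, Complex.norm_exp_ofReal_mul_I, mul_one, Complex.norm_real,
    Real.norm_of_nonneg (Real.exp_pos _).le]

lemma norm_chr_le (φ : Fin d → ℝ) (k : Idx d) : ‖chr ρ φ k‖ ≤ 1 := by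
  rw [norm_chr, Real.exp_le_one_iff, neg_nonpos]
  exact mul_nonneg ρ.2 (nrm_nonneg _)

lemma chr_mul (φ : Fin d → ℝ) (k l : Idx d) :
    chr ρ φ k * chr ρ φ l = theta ρ k l * chr ρ φ (k + l) := by
  unfold chr theta
  have : ∑ i, (((k + l) i : ℤ) : ℝ) * φ i = (∑ i, (k i : ℝ) * φ i) + ∑ i, (l i : ℝ) * φ i := by
    rw [← Finset.sum_add_distrib]; refine Finset.sum_congr rfl fun i _ => ?_
    push_cast [Pi.add_apply]; ring
  rw [this]
  push_cast
  simp only [← Complex.exp_add]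
  congr 1
  ring

lemma chr_neg (φ : Fin d → ℝ) (k : Idx d) : chr ρ φ (-k) = (starRingEnd ℂ) (chr ρ φ k) := by
  unfold chr
  rw [map_mul, Complex.conj_ofReal, nrm_neg, ← Complex.exp_conj, map_mul, Complex.conj_I, Complex.conj_ofReal]
  simp

/-- Evaluation at the angle `φ`, composed with a character `χ` of `B`. -/
def ev (χ : B →L[ℝ] ℂ) (φ : Fin d → ℝ) : Wal d ρ B →L[ℝ] ℂ :=
  lift fun k => chr ρ φ k • χ

lemma ev_aux (χ : B →L[ℝ] ℂ) (φ : Fin d → ℝ) (k : Idx d) : ‖chr ρ φ k • χ‖ ≤ ‖χ‖ := by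
  rw [norm_smul]
  exact mul_le_of_le_one_left (norm_nonneg _) (norm_chr_le _ _)

lemma ev_bs (χ : B →L[ℝ] ℂ) (φ : Fin d → ℝ) (k : Idx d) (z : B) :
    ev χ φ (bs k z : Wal d ρ B) = chr ρ φ k * χ z := by
  unfold ev; rw [lift_bs (ev_aux χ φ)]; rfl

lemma ev_hasSum (χ : B →L[ℝ] ℂ) (φ : Fin d → ℝ) (u : Wal d ρ B) :
    HasSum (fun k => chr ρ φ k * χ (cf u k)) (ev χ φ u) := lift_hasSum (ev_aux χ φ) u

lemma ev_mul (χ : B →L[ℝ] ℂ) (hχ : ∀ x y, χ (x * y) = χ x * χ y) (φ : Fin d → ℝ) (u v : Wal d ρ B) :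
    ev χ φ (u * v) = ev χ φ u * ev χ φ v := by
  refine wal_induction (P := fun u => ∀ v, ev χ φ (u * v) = ev χ φ u * ev χ φ v) ?_ ?_ ?_ u v
  · intro k x v
    refine wal_induction (P := fun v => ev χ φ (bs k x * v) = ev χ φ (bs k x) * ev χ φ v) ?_ ?_ ?_ v
    · intro l y
      simp only [bs_mul_bs, ev_bs, map_smul, hχ]
      rw [Complex.real_smul]
      linear_combination (-(χ x * χ y)) * chr_mul (ρ := ρ) φ k l
    · intro a b ha hb; simp only [mul_add, map_add, ha, hb]
    · exact isClosed_eq (by fun_prop) (by fun_prop)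
  · intro a b ha hb w; simp only [map_add, add_mul, ha, hb]
  · simp only [Set.ofPred_forall]
    exact isClosed_iInter fun v => isClosed_eq (by fun_prop) (by fun_prop)

lemma ev_cst (χ : B →L[ℝ] ℂ) (φ : Fin d → ℝ) (z : B) :
    ev χ φ (cst z : Wal d ρ B) = χ z := by
  unfold cst; rw [ev_bs]; simp [chr, nrm_zero]

lemma ev_one (χ : B →L[ℝ] ℂ) (h1 : χ 1 = 1) (φ : Fin d → ℝ) : ev χ φ (1 : Wal d ρ B) = 1 := by
  rw [one_def]; exact (ev_cst χ φ 1).trans h1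

lemma ev_sg [StarRing B] [NormedStarGroup B] [StarModule ℝ B] (χ : B →L[ℝ] ℂ) (hχ : ∀ x, χ (star x) = (starRingEnd ℂ) (χ x))
    (φ : Fin d → ℝ) (u : Wal d ρ B) : ev χ φ (sg u) = (starRingEnd ℂ) (ev χ φ u) := by
  refine wal_induction (P := fun u => ev χ φ (sg u) = (starRingEnd ℂ) (ev χ φ u)) ?_ ?_ ?_ u
  · intro k z
    rw [sg_bs, ev_bs, ev_bs, hχ, chr_neg, map_mul]
  · intro a b ha hb; simp only [map_add, ha, hb]
  · exact isClosed_eq (by fun_prop) (Complex.continuous_conj.comp (by fun_prop))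

end mulsec
end
end VdP

set_option linter.unusedSectionVars false
set_option linter.style.longLine false

namespace VdP
open scoped NNReal ENNReal
noncomputable section

open Filter Topology

section lin
variable {d : ℕ} {ρ : ℝ≥0} {B : Type} [NormedCommRing B] [NormedAlgebra ℝ B] [CompleteSpace B]
  [StarRing B] [NormedStarGroup B] [StarModule ℝ B]

lemma clm_mul_apply (f g : Wal d ρ B →L[ℝ] Wal d ρ B) (u : Wal d ρ B) : (f * g) u = f (g u) := rfl

/-- The oscillating part of the linearised operator. -/
def Gt (h1 h2 : Wal d ρ B) (B1 B2 : Idx d → B) : Wal d ρ B →L[ℝ] Wal d ρ B :=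
  (mulL h1).comp (mult B1) + (mulL h2).comp (mult B2)

lemma Gt_apply (h1 h2 : Wal d ρ B) (B1 B2 : Idx d → B) (y : Wal d ρ B) :
    Gt h1 h2 B1 B2 y = h1 * mult B1 y + h2 * mult B2 y := rfl

lemma norm_Gt_le (h1 h2 : Wal d ρ B) {B1 B2 : Idx d → B} (hB1 : ∀ k, ‖B1 k‖ ≤ 1) (hB2 : ∀ k, ‖B2 k‖ ≤ 1) :
    ‖Gt h1 h2 B1 B2‖ ≤ ‖h1‖ + ‖h2‖ := by
  refine ContinuousLinearMap.opNorm_le_bound _ (by positivity) fun y => ?_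
  rw [Gt_apply, add_mul]
  refine (norm_add_le _ _).trans (add_le_add ?_ ?_)
  · refine (norm_mul_le _ _).trans ?_
    gcongr
    simpa using norm_mult_apply_le zero_le_one hB1 y
  · refine (norm_mul_le _ _).trans ?_
    gcongr
    simpa using norm_mult_apply_le zero_le_one hB2 y

lemma sandwich_bs (h : Wal d ρ B) {B1 E : Idx d → B} (hB1 : ∀ k, ‖B1 k‖ ≤ 1) {C0 : ℝ} (hE : ∀ k, ‖E k‖ ≤ C0)
    (h0 : cf h 0 = 0) {e : Idx d → ℝ} (he0 : ∀ l, 0 ≤ e l)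
    (he : ∀ l, l ≠ 0 → ∀ k, ‖E (l + k) * E k‖ ≤ e l) (hs : Summable fun l => ‖cf h l‖ * e l) (k : Idx d) (z : B) :
    ‖mult E (h * mult B1 (mult E (bs k z)))‖ ≤ (∑' l, ‖cf h l‖ * e l) * ‖z‖ := by
  rw [mult_bs hE, mult_bs hB1]
  set w := B1 k * (E k * z)
  let F : Wal d ρ B →L[ℝ] Wal d ρ B := (mult E).comp ((mulL : Wal d ρ B →L[ℝ] _).flip (bs k w))
  have hF : ∀ u, F u = mult E (u * bs k w) := fun u => rfl
  rw [← hF, ← ((hasSum_bs h).mapL F).tsum_eq, ← tsum_mul_right]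
  refine tsum_of_norm_bounded (hs.mul_right _).hasSum fun l => ?_
  rw [hF, bs_mul_bs, mult_bs hE, norm_bs, mul_smul_comm, norm_smul, Real.norm_of_nonneg (theta_pos _ _ _).le]
  by_cases hl : l = 0
  · subst hl; simp [h0]
  have : E (l + k) * (cf h l * w) = (E (l + k) * E k) * (cf h l * (B1 k * z)) := by
    simp only [w]; ring
  rw [this]
  calc theta ρ l k * ‖(E (l + k) * E k) * (cf h l * (B1 k * z))‖
      ≤ 1 * (e l * (‖cf h l‖ * (1 * ‖z‖))) := by
        gcongr
        · exact theta_le_one _ _ _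
        · refine (norm_mul_le _ _).trans ?_
          gcongr
          · exact he0 l
          · exact he l hl k
          · refine (norm_mul_le _ _).trans ?_
            gcongr
            refine (norm_mul_le _ _).trans ?_
            gcongr
            exact hB1 k
    _ = _ := by ring

lemma ring_inv {A : Type*} [NormedRing A] [CompleteSpace A] (h1A : ‖(1 : A)‖ ≤ 1) (E G : A) {C0 g T : ℝ}
    (hC0 : 0 ≤ C0) (hg0 : 0 ≤ g) (hEn : ‖E‖ ≤ C0) (hGn : ‖G‖ ≤ g) (hSn : ‖E * G * E‖ ≤ T) (hgT : g * T ≤ 1 / 2) :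
    ∃ W Z : A, W = E * Z ∧ Z = 1 + G * W ∧ ‖W‖ ≤ C0 * ((1 + g * C0) * 2) ∧
      (∀ σ : A, σ * E = E * σ → σ * G = G * σ → σ * W = W * σ) ∧
      ∃ Y : A, W = E + E * G * E + Y ∧ ‖Y‖ ≤ C0 * ((1 + g * C0) * ((g * T) * 2)) := by
  obtain ⟨K, hK⟩ : ∃ K, K = G * E := ⟨_, rfl⟩
  have hKn : ‖K‖ ≤ g * C0 := by
    rw [hK]; exact (norm_mul_le _ _).trans (mul_le_mul hGn hEn (norm_nonneg _) hg0)
  have hK2 : K * K = G * (E * G * E) := by simp only [hK, mul_assoc]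
  have hK2n : ‖K * K‖ ≤ g * T := by
    rw [hK2]; exact (norm_mul_le _ _).trans (mul_le_mul hGn hSn (norm_nonneg _) hg0)
  have hK2h : ‖K * K‖ ≤ 1 / 2 := hK2n.trans hgT
  have hK2l : ‖K * K‖ < 1 := by linarith
  obtain ⟨V, hV⟩ : ∃ V, V = ∑' n : ℕ, (K * K) ^ n := ⟨_, rfl⟩
  have hV1 : V * (1 - K * K) = 1 := by rw [hV]; exact geom_series_mul_neg _ hK2l
  have hV2 : (1 - K * K) * V = 1 := by rw [hV]; exact mul_neg_geom_series _ hK2l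
  have hVn : ‖V‖ ≤ 2 := by
    rw [hV]
    refine (tsum_geometric_le_of_norm_lt_one _ hK2l).trans ?_
    have h2 : (1 - ‖K * K‖)⁻¹ ≤ 2 := by
      rw [inv_le_comm₀ (by linarith) (by norm_num)]; linarith
    linarith
  have h1Kn : ‖1 + K‖ ≤ 1 + g * C0 := (norm_add_le _ _).trans (add_le_add h1A hKn)
  refine ⟨E * ((1 + K) * V), (1 + K) * V, rfl, ?_, ?_, ?_, E * ((1 + K) * ((K * K) * V)), ?_, ?_⟩
  · have : (1 - K) * ((1 + K) * V) = 1 := by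
      rw [← mul_assoc, show (1 - K) * (1 + K) = 1 - K * K by noncomm_ring]; exact hV2
    rw [sub_mul, one_mul, sub_eq_iff_eq_add] at this
    rw [← mul_assoc G, ← hK]; exact this
  · refine (norm_mul_le _ _).trans (mul_le_mul hEn ?_ (norm_nonneg _) hC0)
    exact (norm_mul_le _ _).trans (mul_le_mul h1Kn hVn (norm_nonneg _) (by positivity))
  · intro σ hσE hσG
    have hc : σ * K = K * σ := by rw [hK, ← mul_assoc, hσG, mul_assoc, hσE, mul_assoc]
    have hVc : σ * V = V * σ := by
      calc σ * V = (V * (1 - K * K)) * (σ * V) := by rw [hV1, one_mul]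
        _ = V * (σ - K * (K * σ)) * V := by noncomm_ring
        _ = V * (σ - σ * K * K) * V := by rw [← hc, ← mul_assoc, ← hc]
        _ = V * σ * ((1 - K * K) * V) := by noncomm_ring
        _ = V * σ := by rw [hV2, mul_one]
    rw [← mul_assoc σ, hσE, mul_assoc, ← mul_assoc σ, mul_add, mul_one, hc, mul_assoc, mul_assoc, ← hVc, ← mul_assoc (1 + K), add_mul (1 : A), one_mul]
  · have hVV : V = 1 + K * K * V := by
      have := hV2; rw [sub_mul, one_mul, sub_eq_iff_eq_add] at this; exact this
    calc E * ((1 + K) * V) = E * ((1 + K) * (1 + K * K * V)) := by rw [← hVV]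
      _ = E + E * K + E * ((1 + K) * ((K * K) * V)) := by noncomm_ring
      _ = _ := by rw [hK, ← mul_assoc E]
  · refine (norm_mul_le _ _).trans (mul_le_mul hEn ?_ (norm_nonneg _) hC0)
    refine (norm_mul_le _ _).trans (mul_le_mul h1Kn ?_ (norm_nonneg _) (by positivity))
    exact (norm_mul_le _ _).trans (mul_le_mul hK2n hVn (norm_nonneg _) (by nlinarith [norm_nonneg (K*K)]))

lemma Gt_sandwich (h1 h2 : Wal d ρ B) (h10 : cf h1 0 = 0) (h20 : cf h2 0 = 0)
    {B1 B2 E : Idx d → B} (hB1 : ∀ k, ‖B1 k‖ ≤ 1) (hB2 : ∀ k, ‖B2 k‖ ≤ 1) {C0 : ℝ} (hE : ∀ k, ‖E k‖ ≤ C0)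
    {e : Idx d → ℝ} (he0 : ∀ l, 0 ≤ e l) (he : ∀ l, l ≠ 0 → ∀ k, ‖E (l + k) * E k‖ ≤ e l)
    (hs1 : Summable fun l => ‖cf h1 l‖ * e l) (hs2 : Summable fun l => ‖cf h2 l‖ * e l) :
    ‖(mult E : Wal d ρ B →L[ℝ] Wal d ρ B) * Gt h1 h2 B1 B2 * mult E‖ ≤ (∑' l, ‖cf h1 l‖ * e l) + ∑' l, ‖cf h2 l‖ * e l := by
  have hn : ∀ h : Wal d ρ B, 0 ≤ ∑' l, ‖cf h l‖ * e l := fun h => tsum_nonneg fun l => mul_nonneg (norm_nonneg _) (he0 l)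
  refine norm_le_of_bs (add_nonneg (hn _) (hn _)) fun k z => ?_
  rw [clm_mul_apply, clm_mul_apply, Gt_apply, map_add, add_mul]
  exact (norm_add_le _ _).trans (add_le_add (sandwich_bs h1 hB1 hE h10 he0 he hs1 k z)
    (sandwich_bs h2 hB2 hE h20 he0 he hs2 k z))

lemma sg_Gt (h1 h2 : Wal d ρ B) (h1s : sg h1 = h1) (h2s : sg h2 = h2)
    {B1 B2 : Idx d → B} (hB1 : ∀ k, ‖B1 k‖ ≤ 1) (hB2 : ∀ k, ‖B2 k‖ ≤ 1)
    (hB1s : ∀ k, B1 (-k) = star (B1 k)) (hB2s : ∀ k, B2 (-k) = star (B2 k)) :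
    (sg : Wal d ρ B →L[ℝ] Wal d ρ B) * Gt h1 h2 B1 B2 = Gt h1 h2 B1 B2 * sg := by
  ext1 u
  rw [clm_mul_apply, clm_mul_apply, Gt_apply, Gt_apply, map_add, sg_mul, sg_mul, h1s, h2s, sg_mult hB1 hB1s, sg_mult hB2 hB2s]

lemma lin_inv (h1 h2 r : Wal d ρ B) (h10 : cf h1 0 = 0) (h20 : cf h2 0 = 0) (r0 : cf r 0 = 0)
    (h1s : sg h1 = h1) (h2s : sg h2 = h2)
    {B1 B2 : Idx d → B} (hB1 : ∀ k, ‖B1 k‖ ≤ 1) (hB2 : ∀ k, ‖B2 k‖ ≤ 1)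
    (hB1s : ∀ k, B1 (-k) = star (B1 k)) (hB2s : ∀ k, B2 (-k) = star (B2 k))
    (Em : ℝ → Idx d → B) {C0 μ1 : ℝ} (hC0 : 0 ≤ C0) (hμ1 : 0 < μ1)
    (hE : ∀ μ, 0 < μ → μ ≤ μ1 → ∀ k, ‖Em μ k‖ ≤ C0)
    (hEs : ∀ μ, 0 < μ → μ ≤ μ1 → ∀ k, Em μ (-k) = star (Em μ k))
    (e : Idx d → ℝ → ℝ) {Ce : ℝ} (he0 : ∀ l μ, 0 < μ → μ ≤ μ1 → 0 ≤ e l μ) (heC : ∀ l μ, 0 < μ → μ ≤ μ1 → e l μ ≤ Ce)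
    (het : ∀ l, l ≠ 0 → Tendsto (e l) (𝓝[>] 0) (𝓝 0))
    (heE : ∀ l, l ≠ 0 → ∀ μ, 0 < μ → μ ≤ μ1 → ‖Em μ l‖ ≤ e l μ)
    (heE2 : ∀ l, l ≠ 0 → ∀ μ, 0 < μ → μ ≤ μ1 → ∀ k, ‖Em μ (l + k) * Em μ k‖ ≤ e l μ) :
    ∃ C : ℝ, 0 < C ∧ ∀ η : ℝ, 0 < η → ∃ μ2 : ℝ, 0 < μ2 ∧ μ2 ≤ μ1 ∧ ∀ μ, 0 < μ → μ ≤ μ2 →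
      ∃ W : Wal d ρ B →L[ℝ] Wal d ρ B, ‖W‖ ≤ C ∧ ‖W r‖ ≤ η ∧ (∀ u, sg (W u) = W (sg u)) ∧
        ∀ R, ∃ z, W R = mult (Em μ) z ∧ z = R + Gt h1 h2 B1 B2 (W R) := by
  set g := ‖h1‖ + ‖h2‖ with hg
  have hg0 : 0 ≤ g := by positivity
  set a : Idx d → ℝ := fun l => ‖cf h1 l‖ + ‖cf h2 l‖ + ‖cf r l‖ with ha
  have hasum : Summable a := ((summable_norm_cf h1).add (summable_norm_cf h2)).add (summable_norm_cf r)
  set Tm : ℝ → ℝ := fun μ => ∑' l, a l * e l μ with hTm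
  have hev : ∀ᶠ μ in 𝓝[>] (0:ℝ), 0 < μ ∧ μ ≤ μ1 :=
    Filter.eventually_of_mem (Ioc_mem_nhdsGT hμ1) fun x hx => hx
  have hTt : Tendsto Tm (𝓝[>] 0) (𝓝 0) := by
    have : Tendsto Tm (𝓝[>] 0) (𝓝 (∑' l : Idx d, (0:ℝ))) := by
      refine tendsto_tsum_of_dominated_convergence (bound := fun l => a l * Ce) (hasum.mul_right _) ?_ ?_
      · intro l
        by_cases hl : l = 0
        · subst hl; simp [ha, h10, h20, r0]
        · simpa using (het l hl).const_mul (a l)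
      · filter_upwards [hev] with μ hμ l
        rw [Real.norm_of_nonneg (mul_nonneg (by positivity) (he0 l μ hμ.1 hμ.2))]
        exact mul_le_mul_of_nonneg_left (heC l μ hμ.1 hμ.2) (by positivity)
    simpa using this
  refine ⟨C0 * ((1 + g * C0) * 2) + 1, by positivity, fun η hη => ?_⟩
  set D := 1 + C0 * g + C0 * ((1 + g * C0) * (g * (2 * ‖r‖))) with hD
  have hD0 : 0 < D := by positivity
  have hev2 : ∀ᶠ μ in 𝓝[>] (0:ℝ), Tm μ < min (1 / (2 * (g + 1))) (η / D) :=
    hTt.eventually_lt_const (by positivity)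
  obtain ⟨μ2', hμ2', hμ2''⟩ := (mem_nhdsGT_iff_exists_Ioc_subset).1 hev2
  refine ⟨min μ1 μ2', lt_min hμ1 hμ2', min_le_left _ _, fun μ hμ hμle => ?_⟩
  have hμ1' : μ ≤ μ1 := hμle.trans (min_le_left _ _)
  have hT : Tm μ < min (1 / (2 * (g + 1))) (η / D) := hμ2'' ⟨hμ, hμle.trans (min_le_right _ _)⟩
  have hTa := hT.trans_le (min_le_left _ _)
  have hTb := hT.trans_le (min_le_right _ _)
  have hsae : Summable fun l => a l * e l μ :=
    Summable.of_nonneg_of_le (fun l => mul_nonneg (by positivity) (he0 l μ hμ hμ1'))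
      (fun l => mul_le_mul_of_nonneg_left (heC l μ hμ hμ1') (by positivity)) (hasum.mul_right Ce)
  have hT0 : 0 ≤ Tm μ := tsum_nonneg fun l => mul_nonneg (by positivity) (he0 l μ hμ hμ1')
  have hs' : ∀ h : Wal d ρ B, (∀ l, ‖cf h l‖ ≤ a l) → Summable fun l => ‖cf h l‖ * e l μ := fun h hh =>
    Summable.of_nonneg_of_le (fun l => mul_nonneg (by positivity) (he0 l μ hμ hμ1'))
      (fun l => mul_le_mul_of_nonneg_right (hh l) (he0 l μ hμ hμ1')) hsae
  have ha1 : ∀ l, ‖cf h1 l‖ ≤ a l := fun l => by simp only [ha]; linarith [norm_nonneg (cf h2 l), norm_nonneg (cf r l)]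
  have ha2 : ∀ l, ‖cf h2 l‖ ≤ a l := fun l => by simp only [ha]; linarith [norm_nonneg (cf h1 l), norm_nonneg (cf r l)]
  have ha3 : ∀ l, ‖cf r l‖ ≤ a l := fun l => by simp only [ha]; linarith [norm_nonneg (cf h1 l), norm_nonneg (cf h2 l)]
  obtain ⟨W, Z, hWZ, hZW, hWn, hWσ, Y, hWY, hYn⟩ := ring_inv (A := Wal d ρ B →L[ℝ] Wal d ρ B) ContinuousLinearMap.norm_id_le
    (mult (Em μ)) (Gt h1 h2 B1 B2) hC0 hg0 (norm_mult_le hC0 (hE μ hμ hμ1')) (norm_Gt_le h1 h2 hB1 hB2)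
    (T := Tm μ) (by
      refine (Gt_sandwich h1 h2 h10 h20 hB1 hB2 (hE μ hμ hμ1') (fun l => he0 l μ hμ hμ1') (fun l hl => heE2 l hl μ hμ hμ1') (hs' _ ha1) (hs' _ ha2)).trans ?_
      rw [← (hs' _ ha1).tsum_add (hs' _ ha2)]
      refine ((hs' _ ha1).add (hs' _ ha2)).tsum_le_tsum (fun l => ?_) hsae
      rw [← add_mul]
      refine mul_le_mul_of_nonneg_right ?_ (he0 l μ hμ hμ1')
      simp only [ha]; linarith [norm_nonneg (cf r l)])
    (by
      have := mul_le_mul_of_nonneg_left hTa.le hg0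
      refine this.trans ?_
      rw [mul_one_div, div_le_div_iff₀ (by positivity) (by norm_num)]; linarith)
  have hEr : ‖mult (Em μ) r‖ ≤ Tm μ := by
    rw [norm_eq_tsum]
    refine Summable.tsum_le_tsum (fun l => ?_) (summable_norm_cf _) hsae
    rw [cf_mult (hE μ hμ hμ1')]
    by_cases hl : l = 0
    · subst hl; simp [ha, h10, h20, r0]
    refine (norm_mul_le _ _).trans ?_
    rw [mul_comm]
    exact mul_le_mul (ha3 l) (heE l hl μ hμ hμ1') (norm_nonneg _) (by positivity)
  refine ⟨W, by linarith, ?_, ?_, ?_⟩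
  · rw [hWY]
    have e1 : ‖mult (Em μ) (Gt h1 h2 B1 B2 (mult (Em μ) r))‖ ≤ C0 * (g * Tm μ) := by
      refine ((mult (Em μ)).le_of_opNorm_le (norm_mult_le hC0 (hE μ hμ hμ1')) _).trans ?_
      refine mul_le_mul_of_nonneg_left ?_ hC0
      exact ((Gt h1 h2 B1 B2).le_of_opNorm_le (norm_Gt_le h1 h2 hB1 hB2) _).trans (mul_le_mul_of_nonneg_left hEr hg0)
    have e2 := Y.le_of_opNorm_le hYn r
    have e3 : Tm μ * D ≤ η := by
      rw [lt_div_iff₀ hD0] at hTb; exact hTb.le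
    refine le_trans ?_ e3
    refine (norm_add₃_le (a := mult (Em μ) r) (b := mult (Em μ) (Gt h1 h2 B1 B2 (mult (Em μ) r))) (c := Y r)).trans ?_
    calc _ ≤ Tm μ + C0 * (g * Tm μ) + (C0 * ((1 + g * C0) * ((g * Tm μ) * 2))) * ‖r‖ := by linarith
      _ = Tm μ * D := by rw [hD]; ring
  · intro u
    exact DFunLike.congr_fun (hWσ sg (by ext1 v; exact sg_mult (hE μ hμ hμ1') (hEs μ hμ hμ1') v)
      (sg_Gt h1 h2 h1s h2s hB1 hB2 hB1s hB2s)) u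
  · intro R
    exact ⟨Z R, DFunLike.congr_fun hWZ R, DFunLike.congr_fun hZW R⟩

/-- Abstract solution of the nonlinear problem. -/
lemma fixed_point (r : Wal d ρ B) (rs : sg r = r) {C μ1 : ℝ} (hC : 0 < C) (_hμ1 : 0 < μ1)
    (Q : ℝ → (Wal d ρ B →L[ℝ] Wal d ρ B) → Prop)
    (hlin : ∀ η : ℝ, 0 < η → ∃ μ2 : ℝ, 0 < μ2 ∧ μ2 ≤ μ1 ∧ ∀ μ, 0 < μ → μ ≤ μ2 →
      ∃ W : Wal d ρ B →L[ℝ] Wal d ρ B, ‖W‖ ≤ C ∧ ‖W r‖ ≤ η ∧ (∀ u, sg (W u) = W (sg u)) ∧ Q μ W)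
    (Rest : ℝ → Wal d ρ B → Wal d ρ B) {CR μR : ℝ} (hCR : 0 < CR) (hμR : 0 < μR)
    (hR0 : ∀ μ, 0 < μ → μ ≤ μR → ‖Rest μ 0‖ ≤ CR * μ)
    (hRL : ∀ μ, 0 < μ → μ ≤ μR → ∀ δ, 0 < δ → δ ≤ 1 → ∀ y y', ‖y‖ ≤ δ → ‖y'‖ ≤ δ →
      ‖Rest μ y - Rest μ y'‖ ≤ CR * (μ + δ) * ‖y - y'‖)
    (hRs : ∀ μ, 0 < μ → μ ≤ μR → ∀ y, ‖y‖ ≤ 1 → sg y = y → sg (Rest μ y) = Rest μ y) :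
    ∃ μ0 : ℝ, 0 < μ0 ∧ μ0 ≤ μ1 ∧ μ0 ≤ μR ∧ ∀ μ, 0 < μ → μ ≤ μ0 →
      ∃ (W : Wal d ρ B →L[ℝ] Wal d ρ B) (y : Wal d ρ B), Q μ W ∧ ‖y‖ ≤ 1 ∧ sg y = y ∧
        y = W (r + Rest μ y) := by
  set δ := min 1 (1 / (4 * C * CR)) with hδ
  have hδ0 : 0 < δ := by positivity
  have hδ1 : δ ≤ 1 := min_le_left _ _
  have hδ2 : C * CR * δ ≤ 1 / 4 := by
    have : δ ≤ 1 / (4 * C * CR) := min_le_right _ _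
    rw [le_div_iff₀ (by positivity)] at this; linarith
  obtain ⟨μ2, hμ2, hμ21, hW⟩ := hlin (δ / 4) (by positivity)
  set μ0 := min (min μ2 μR) (δ / (4 * C * CR)) with hμ0
  have hμ00 : 0 < μ0 := by positivity
  refine ⟨μ0, hμ00, ((min_le_left _ _).trans (min_le_left _ _)).trans hμ21,
    (min_le_left _ _).trans (min_le_right _ _), fun μ hμ hμle => ?_⟩
  have hμR' : μ ≤ μR := hμle.trans ((min_le_left _ _).trans (min_le_right _ _))
  obtain ⟨W, hWn, hWr, hWs, hQ⟩ := hW μ hμ (hμle.trans ((min_le_left _ _).trans (min_le_left _ _)))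
  have hμ3 : C * CR * μ ≤ δ / 4 := by
    have : μ ≤ δ / (4 * C * CR) := hμle.trans (min_le_right _ _)
    rw [le_div_iff₀ (by positivity)] at this; linarith
  let Ψ : Wal d ρ B → Wal d ρ B := fun y => W (r + Rest μ y)
  let s : Set (Wal d ρ B) := Metric.closedBall 0 δ ∩ {y | sg y = y}
  have hs : IsComplete s := by
    refine IsClosed.isComplete (Metric.isClosed_closedBall.inter ?_)
    exact isClosed_eq sg.continuous continuous_id
  have hlip : ∀ y ∈ s, ∀ y' ∈ s, ‖Ψ y - Ψ y'‖ ≤ 1 / 2 * ‖y - y'‖ := by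
    intro y hy y' hy'
    have h1 : ‖y‖ ≤ δ := by simpa using hy.1
    have h2 : ‖y'‖ ≤ δ := by simpa using hy'.1
    have h3 := hRL μ hμ hμR' δ hδ0 hδ1 y y' h1 h2
    calc ‖Ψ y - Ψ y'‖ = ‖W (Rest μ y - Rest μ y')‖ := by
          simp only [Ψ]; rw [← map_sub]; congr 2; abel
      _ ≤ C * (CR * (μ + δ) * ‖y - y'‖) := (W.le_of_opNorm_le hWn _).trans (by gcongr)
      _ = (C * CR * μ + C * CR * δ) * ‖y - y'‖ := by ring
      _ ≤ (1 / 2) * ‖y - y'‖ := by gcongr; linarith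
  have h0s : (0 : Wal d ρ B) ∈ s := ⟨by simp [hδ0.le], by simp⟩
  have hΨ0 : ‖Ψ 0‖ ≤ δ / 2 := by
    calc ‖Ψ 0‖ = ‖W r + W (Rest μ 0)‖ := by simp [Ψ]
      _ ≤ δ / 4 + C * (CR * μ) := (norm_add_le _ _).trans
          (add_le_add hWr ((W.le_of_opNorm_le hWn _).trans (by gcongr; exact hR0 μ hμ hμR')))
      _ ≤ _ := by linarith
  have hmaps : Set.MapsTo Ψ s s := by
    intro y hy
    have h1 : ‖y‖ ≤ δ := by simpa using hy.1
    have h3 := hlip y hy 0 h0s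
    refine ⟨?_, ?_⟩
    · simp only [Metric.mem_closedBall, dist_zero_right]
      have : ‖Ψ y‖ ≤ ‖Ψ y - Ψ 0‖ + ‖Ψ 0‖ := by simpa using norm_add_le (Ψ y - Ψ 0) (Ψ 0)
      rw [sub_zero] at h3
      linarith
    · have hy2 : sg y = y := hy.2
      change sg (W (r + Rest μ y)) = W (r + Rest μ y)
      rw [hWs, map_add, rs, hRs μ hμ hμR' y (h1.trans hδ1) hy2]
  have hcontr : ContractingWith (1 / 2) (hmaps.restrict Ψ s s) := by
    refine ⟨by norm_num, LipschitzWith.of_dist_le_mul fun y y' => ?_⟩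
    rw [Subtype.dist_eq, Subtype.dist_eq, dist_eq_norm, dist_eq_norm]
    simpa using hlip y y.2 y' y'.2
  obtain ⟨y, hy, hfix, -⟩ := hcontr.exists_fixedPoint' hs hmaps h0s (edist_ne_top _ _)
  have h1 : ‖y‖ ≤ δ := by simpa using hy.1
  exact ⟨W, y, hQ, h1.trans hδ1, hy.2, hfix.symm⟩

end lin
end
end VdP

set_option linter.unusedSectionVars false
set_option linter.style.longLine false

namespace VdP
open scoped NNReal ENNReal
noncomputable section
open Filter Topology

section tau

lemma omega0_pos {a : ℝ} (_h0 : 0 < a) (h2 : a ^ 2 < 2) : 0 < omega0 a := by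
  unfold omega0; exact Real.sqrt_pos.2 (by linarith)

lemma omega0_sq {a : ℝ} (h2 : a ^ 2 < 2) : omega0 a ^ 2 = 2 - a ^ 2 := by
  unfold omega0; exact Real.sq_sqrt (by linarith)

lemma tau0_eq {a : ℝ} (h0 : 0 < a) (_h2 : a ^ 2 < 2) : tau0 a = Real.arccos (a ^ 2 - 1) / omega0 a := by
  have key : √(1 - (a ^ 2 - 1) ^ 2) = a * omega0 a := by
    rw [show 1 - (a ^ 2 - 1) ^ 2 = a ^ 2 * (2 - a ^ 2) by ring, Real.sqrt_mul (by positivity), Real.sqrt_sq h0.le, omega0]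
  unfold tau0
  split_ifs with h
  · rw [Real.arccos_eq_arcsin (by nlinarith), key]
  · rw [show a ^ 2 - 1 = -(1 - a ^ 2) by ring, Real.arccos_neg, Real.arccos_eq_arcsin (by nlinarith), ← key]
    congr 4; ring

lemma cos_tau {a : ℝ} (h0 : 0 < a) (h2 : a ^ 2 < 2) : Real.cos (omega0 a * tau0 a) = a ^ 2 - 1 := by
  rw [tau0_eq h0 h2, mul_div_cancel₀ _ (omega0_pos h0 h2).ne', Real.cos_arccos (by nlinarith) (by linarith)]

lemma sin_tau {a : ℝ} (h0 : 0 < a) (h2 : a ^ 2 < 2) : Real.sin (omega0 a * tau0 a) = a * omega0 a := by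
  rw [tau0_eq h0 h2, mul_div_cancel₀ _ (omega0_pos h0 h2).ne', Real.sin_arccos]
  rw [show 1 - (a ^ 2 - 1) ^ 2 = a ^ 2 * (2 - a ^ 2) by ring, Real.sqrt_mul (by positivity), Real.sqrt_sq h0.le, omega0]

lemma tau_gt {a : ℝ} (h0 : 0 < a) (h2 : a ^ 2 < 2) : a < tau0 a := by
  have hw := omega0_pos h0 h2
  have h := sin_tau h0 h2
  have hp : 0 < omega0 a * tau0 a := by
    rw [tau0_eq h0 h2, mul_div_cancel₀ _ hw.ne', Real.arccos_pos]; linarith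
  have := Real.sin_lt hp
  rw [h, mul_comm a] at this
  exact lt_of_mul_lt_mul_left this hw.le

lemma omega0_ge {a : ℝ} (h2 : a ^ 2 ≤ 25 / 16) : 1 / 2 ≤ omega0 a := by
  unfold omega0; exact Real.le_sqrt_of_sq_le (by linarith)

lemma omega0_le (a : ℝ) : omega0 a ≤ 3 / 2 := by
  unfold omega0; rw [Real.sqrt_le_left (by norm_num)]; nlinarith [sq_nonneg a]

lemma tau_le {a : ℝ} (h0 : 0 < a) (h2 : a ^ 2 ≤ 25 / 16) : tau0 a ≤ 7 := by
  have hw := omega0_ge h2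
  rw [tau0_eq h0 (by linarith), div_le_iff₀ (by linarith)]
  have := Real.arccos_le_pi (a ^ 2 - 1)
  have := Real.pi_lt_d2
  linarith

lemma expI (a : ℝ) (h0 : 0 < a) (h2 : a ^ 2 < 2) :
    Complex.exp (-(Complex.I * (omega0 a * tau0 a : ℝ))) = ((a ^ 2 - 1 : ℝ) : ℂ) - Complex.I * (a * omega0 a : ℝ) := by
  rw [← cos_tau h0 h2, ← sin_tau h0 h2, show -(Complex.I * (omega0 a * tau0 a : ℝ)) = ((-(omega0 a * tau0 a) : ℝ) : ℂ) * Complex.I by push_cast; ring,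
    Complex.exp_mul_I, ← Complex.ofReal_cos, ← Complex.ofReal_sin, Real.cos_neg, Real.sin_neg]
  push_cast; ring

lemma exp_b1 (θ : ℝ) : ‖Complex.exp (-(Complex.I * θ)) - 1‖ ≤ |θ| := by
  have := Real.norm_exp_I_mul_ofReal_sub_one_le (x := -θ)
  simpa using this

lemma exp_b2 (θ : ℝ) : ‖Complex.exp (-(Complex.I * θ)) - 1 + Complex.I * θ‖ ≤ 3 * θ ^ 2 := by
  by_cases h : |θ| ≤ 1
  · have := Complex.norm_exp_sub_one_sub_id_le (x := -(Complex.I * θ)) (by simpa using h)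
    rw [sub_neg_eq_add] at this
    refine this.trans ?_
    simp only [norm_neg, norm_mul, Complex.norm_I, one_mul, Complex.norm_real, Real.norm_eq_abs, sq_abs]
    nlinarith [sq_nonneg θ]
  · push Not at h
    refine (norm_add_le _ _).trans ?_
    have := exp_b1 θ
    have h2 : ‖Complex.I * (θ:ℂ)‖ = |θ| := by simp
    rw [h2, ← sq_abs]
    nlinarith

end tau

section hyp

/-- The linear symbol. -/
def Lsym (a τ Ω : ℝ) : ℂ := -(Ω ^ 2 : ℝ) - Complex.I * (a * Ω : ℝ) + 1 - Complex.exp (-(Complex.I * (Ω * τ : ℝ)))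

/-- The symbol of the averaged linearisation. -/
def qsym (α β ζ a τ Ω : ℝ) : ℂ := α + β * Complex.exp (-(Complex.I * (Ω * τ : ℝ))) - Complex.I * (ζ * a * Ω : ℝ)

lemma Lsym_neg (a τ Ω : ℝ) : Lsym a τ (-Ω) = (starRingEnd ℂ) (Lsym a τ Ω) := by
  unfold Lsym
  simp only [map_sub, map_add, map_neg, map_mul, Complex.conj_I, Complex.conj_ofReal, map_one, ← Complex.exp_conj]
  push_cast; ring_nf

lemma qsym_neg (α β ζ a τ Ω : ℝ) : qsym α β ζ a τ (-Ω) = (starRingEnd ℂ) (qsym α β ζ a τ Ω) := by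
  unfold qsym
  simp only [map_sub, map_add, map_neg, map_mul, Complex.conj_I, Complex.conj_ofReal, ← Complex.exp_conj]
  push_cast; ring_nf

lemma norm_expI (θ : ℝ) : ‖Complex.exp (-(Complex.I * θ))‖ = 1 := by
  rw [show -(Complex.I * (θ:ℂ)) = ((-θ : ℝ) : ℂ) * Complex.I by push_cast; ring, Complex.norm_exp_ofReal_mul_I]

lemma im_le (w z : ℂ) : |((starRingEnd ℂ) w * z).im| ≤ ‖w‖ * ‖z‖ := by
  refine (Complex.abs_im_le_norm _).trans ?_
  rw [norm_mul, RCLike.norm_conj]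

lemma near_lemma {A q0 z : ℂ} {κ M C δ s : ℝ} (hM : ‖q0‖ + ‖A‖ ≤ M) (hκ : 0 < κ) (hM0 : 0 < M) (hC : 0 < C)
    (hI : κ ≤ |((starRingEnd ℂ) A * q0).im|) (hs : 0 ≤ s)
    (hz : ‖z - (A * δ - s * q0)‖ ≤ C * (|δ| * (s + |δ|))) (hδ : |δ| ≤ κ / (2 * M * C)) :
    κ / (2 * M) * (s + |δ|) ≤ ‖z‖ := by
  have h1 : κ * (s + |δ|) ≤ M * ‖A * δ - s * q0‖ := by
    have e1 : |((starRingEnd ℂ) q0 * (A * δ - s * q0)).im| = |δ| * |((starRingEnd ℂ) A * q0).im| := by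
      rw [← abs_mul, ← abs_neg]
      congr 1
      simp [Complex.mul_im]; ring
    have e2 : |((starRingEnd ℂ) A * (A * δ - s * q0)).im| = s * |((starRingEnd ℂ) A * q0).im| := by
      rw [← abs_of_nonneg hs, ← abs_mul, abs_of_nonneg hs, ← abs_neg]
      congr 1
      simp [Complex.mul_im]; ring
    have f1 := im_le q0 (A * δ - s * q0)
    have f2 := im_le A (A * δ - s * q0)
    rw [e1] at f1; rw [e2] at f2
    calc κ * (s + |δ|) ≤ |((starRingEnd ℂ) A * q0).im| * (s + |δ|) := by gcongr
      _ ≤ (‖q0‖ + ‖A‖) * ‖A * δ - s * q0‖ := by linarith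
      _ ≤ _ := by gcongr
  have h2 : ‖A * δ - s * q0‖ ≤ ‖z‖ + ‖z - (A * δ - s * q0)‖ := by
    have := norm_sub_le z (z - (A * δ - s * q0)); simpa using this
  have h3 : C * (|δ| * (s + |δ|)) ≤ κ / (2 * M) * (s + |δ|) := by
    have : C * |δ| ≤ κ / (2 * M) := by
      calc C * |δ| ≤ C * (κ / (2 * M * C)) := by gcongr
        _ = _ := by field_simp
    calc C * (|δ| * (s + |δ|)) = (C * |δ|) * (s + |δ|) := by ring
      _ ≤ _ := by gcongr
  have h4 : κ / M * (s + |δ|) ≤ ‖A * δ - s * q0‖ := by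
    rw [div_mul_eq_mul_div, div_le_iff₀ hM0]; linarith
  have h5 : κ / M * (s + |δ|) = κ / (2 * M) * (s + |δ|) + κ / (2 * M) * (s + |δ|) := by field_simp; ring
  linarith

/-- Expansion of the symbol around a root `Ω0` (general `Ω0`, error `O(δ(s+δ))`). -/
lemma expand (α β ζ a τ Ω0 δ s : ℝ) (hs : 0 ≤ s) (hτ : |τ| ≤ 7) (ha : |a| ≤ 5 / 4) (h0 : Lsym a τ Ω0 = 0) :
    ‖Lsym a τ (Ω0 + δ) - s * qsym α β ζ a τ (Ω0 + δ) -
      ((-(2 * Ω0 : ℝ) - Complex.I * (a : ℝ) + Complex.I * (τ : ℝ) * Complex.exp (-(Complex.I * (Ω0 * τ : ℝ)))) * δ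
        - s * qsym α β ζ a τ Ω0)‖ ≤ (148 + 7 * |β| + 2 * |ζ|) * (|δ| * (s + |δ|)) := by
  set E0 := Complex.exp (-(Complex.I * (Ω0 * τ : ℝ))) with hE0
  set E1 := Complex.exp (-(Complex.I * (δ * τ : ℝ))) with hE1
  have hE : Complex.exp (-(Complex.I * ((Ω0 + δ) * τ : ℝ))) = E0 * E1 := by
    rw [hE0, hE1, ← Complex.exp_add]; congr 1; push_cast; ring
  have e : Lsym a τ (Ω0 + δ) - s * qsym α β ζ a τ (Ω0 + δ) -
      ((-(2 * Ω0 : ℝ) - Complex.I * (a : ℝ) + Complex.I * (τ : ℝ) * E0) * δ - s * qsym α β ζ a τ Ω0)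
      = -(δ ^ 2 : ℝ) - E0 * (E1 - 1 + Complex.I * (δ * τ : ℝ)) - (s:ℂ) * (β * E0 * (E1 - 1) - Complex.I * (ζ * a * δ : ℝ)) := by
    rw [← sub_zero (_ - _ : ℂ), ← h0]
    unfold Lsym qsym
    rw [hE, ← hE0]
    push_cast; ring
  rw [e]
  have n0 : ‖E0‖ = 1 := norm_expI _
  have b1 := exp_b1 (δ * τ)
  have b2 := exp_b2 (δ * τ)
  rw [← hE1] at b1 b2
  have t1 : ‖(-(δ ^ 2 : ℝ) : ℂ)‖ = |δ| ^ 2 := by simp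
  have t2 : ‖E0 * (E1 - 1 + Complex.I * (δ * τ : ℝ))‖ ≤ 147 * |δ| ^ 2 := by
    rw [norm_mul, n0, one_mul]
    refine b2.trans ?_
    rw [mul_pow, ← sq_abs δ, ← sq_abs τ]
    have : |τ| ^ 2 ≤ 49 := by nlinarith [abs_nonneg τ]
    nlinarith [sq_nonneg |δ|]
  have t3 : ‖(s:ℂ) * (β * E0 * (E1 - 1) - Complex.I * (ζ * a * δ : ℝ))‖ ≤ s * ((7 * |β| + 2 * |ζ|) * |δ|) := by
    rw [norm_mul, Complex.norm_real, Real.norm_of_nonneg hs]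
    refine mul_le_mul_of_nonneg_left ?_ hs
    refine (norm_sub_le _ _).trans ?_
    rw [norm_mul, norm_mul, n0, mul_one, norm_mul, Complex.norm_I, one_mul, Complex.norm_real, Complex.norm_real, Real.norm_eq_abs, Real.norm_eq_abs, abs_mul, abs_mul]
    rw [abs_mul] at b1
    have u1 : |β| * ‖E1 - 1‖ ≤ |β| * (|δ| * 7) := by
      refine mul_le_mul_of_nonneg_left (b1.trans ?_) (abs_nonneg _)
      gcongr
    have u2 : |ζ| * |a| * |δ| ≤ |ζ| * 2 * |δ| := by gcongr; linarith
    linarith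
  refine (norm_sub_le _ _).trans ((add_le_add (norm_sub_le _ _) le_rfl).trans ?_)
  rw [t1]
  have := mul_nonneg hs (abs_nonneg δ)
  have := mul_nonneg (abs_nonneg β) (sq_nonneg |δ|)
  have := mul_nonneg (abs_nonneg ζ) (sq_nonneg |δ|)
  nlinarith

/-- The distance-like function to the resonant set `{0, ±ω0}`. -/
def Dres (w Ω : ℝ) : ℝ := min 1 (min |Ω| (min |Ω - w| |Ω + w|))

lemma Dres_nonneg (w Ω : ℝ) : 0 ≤ Dres w Ω := by unfold Dres; positivity
lemma Dres_le_one (w Ω : ℝ) : Dres w Ω ≤ 1 := min_le_left _ _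

lemma Dres_neg (w Ω : ℝ) : Dres w (-Ω) = Dres w Ω := by
  unfold Dres
  rw [abs_neg, show -Ω - w = -(Ω + w) by ring, show -Ω + w = -(Ω - w) by ring, abs_neg, abs_neg, min_comm |Ω + w|]

end hyp
end
end VdP

set_option linter.unusedSectionVars false
set_option linter.style.longLine false

namespace VdP
open scoped NNReal ENNReal
noncomputable section
open Filter Topology

/-- The transversality function at `ω0`. -/
def hfun (α β ζ a : ℝ) : ℝ :=
  (2 - a * tau0 a) * a * (2 - a ^ 2) * (β + ζ) - (tau0 a * (a ^ 2 - 1) - a) * (α + β * (a ^ 2 - 1))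

lemma Lsym_zero (a τ : ℝ) : Lsym a τ 0 = 0 := by simp [Lsym]

lemma Lsym_omega {a : ℝ} (h0 : 0 < a) (h2 : a ^ 2 < 2) : Lsym a (tau0 a) (omega0 a) = 0 := by
  unfold Lsym
  rw [expI a h0 h2, omega0_sq h2]; push_cast; ring

lemma norm_qsym_le (α β ζ a τ Ω : ℝ) (ha : |a| ≤ 5 / 4) :
    ‖qsym α β ζ a τ Ω‖ ≤ (|α| + |β| + 2 * |ζ|) * (1 + |Ω|) := by
  unfold qsym
  refine (norm_sub_le _ _).trans ((add_le_add (norm_add_le _ _) le_rfl).trans ?_)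
  rw [norm_mul, norm_expI, norm_mul, Complex.norm_I, Complex.norm_real, Complex.norm_real, Complex.norm_real,
    Real.norm_eq_abs, Real.norm_eq_abs, Real.norm_eq_abs, abs_mul, abs_mul]
  have : |ζ| * |a| * |Ω| ≤ |ζ| * 2 * |Ω| := by gcongr; linarith
  have := mul_nonneg (abs_nonneg α) (abs_nonneg Ω)
  have := mul_nonneg (abs_nonneg β) (abs_nonneg Ω)
  have := abs_nonneg ζ
  nlinarith

lemma away {a Ω w δ0 : ℝ} (τ : ℝ) (ha : |a| ≤ 5 / 4) (hΩ : 0 ≤ Ω) (hw : w ^ 2 = 2 - a ^ 2) (hw2 : 1 / 2 ≤ w)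
    (hδ : 0 < δ0) (hδ1 : δ0 ≤ 1) (h1 : δ0 ≤ Ω) (h2 : δ0 ≤ |Ω - w|) :
    δ0 ^ 3 / 80 * (1 + Ω ^ 2) ≤ ‖Lsym a τ Ω‖ := by
  set z : ℂ := -(Ω ^ 2 : ℝ) - Complex.I * (a * Ω : ℝ) + 1 with hz
  have hL : |‖z‖ - 1| ≤ ‖Lsym a τ Ω‖ := by
    have := abs_norm_sub_norm_le z (Complex.exp (-(Complex.I * (Ω * τ : ℝ))))
    rwa [norm_expI] at this
  have hzn : ‖z‖ ^ 2 - 1 = Ω ^ 2 * (Ω ^ 2 - w ^ 2) := by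
    rw [← Complex.normSq_eq_norm_sq, Complex.normSq_apply, hw]
    simp only [hz, Complex.mul_im, Complex.mul_re, Complex.add_re, Complex.add_im, Complex.sub_re, Complex.sub_im, Complex.neg_re, Complex.neg_im, Complex.ofReal_re, Complex.ofReal_im, Complex.I_re, Complex.I_im, Complex.one_re, Complex.one_im]
    ring
  have hzle : ‖z‖ ≤ 1 + Ω ^ 2 + (5 / 4) * Ω := by
    rw [hz]
    refine (norm_add_le _ _).trans ?_
    have := norm_sub_le (-(Ω ^ 2 : ℝ) : ℂ) (Complex.I * (a * Ω : ℝ))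
    rw [norm_neg, norm_mul, Complex.norm_I, Complex.norm_real, Complex.norm_real, one_mul, Real.norm_eq_abs, Real.norm_eq_abs, abs_mul, abs_of_nonneg hΩ, abs_of_nonneg (sq_nonneg Ω)] at this
    have h3 : |a| * Ω ≤ 5 / 4 * Ω := by gcongr
    rw [norm_one]; linarith
  have hz4 : ‖z‖ + 1 ≤ 4 * (1 + Ω ^ 2) := by nlinarith [sq_nonneg (Ω - 1)]
  have hd : |‖z‖ - 1| * (‖z‖ + 1) = Ω ^ 2 * |Ω ^ 2 - w ^ 2| := by
    have e1 : |‖z‖ - 1| * (‖z‖ + 1) = |(‖z‖ - 1) * (‖z‖ + 1)| := by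
      rw [abs_mul, abs_of_nonneg (show 0 ≤ ‖z‖ + 1 by positivity)]
    rw [e1, show (‖z‖ - 1) * (‖z‖ + 1) = ‖z‖ ^ 2 - 1 by ring, hzn, abs_mul, abs_of_nonneg (sq_nonneg Ω)]
  have hA : δ0 / 10 * (1 + Ω ^ 2) ≤ |Ω ^ 2 - w ^ 2| := by
    by_cases h : Ω ≤ 2
    · rw [show Ω ^ 2 - w ^ 2 = (Ω - w) * (Ω + w) by ring, abs_mul, abs_of_nonneg (show 0 ≤ Ω + w by linarith)]
      calc δ0 / 10 * (1 + Ω ^ 2) ≤ δ0 / 10 * 5 := by gcongr; nlinarith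
        _ = δ0 * (1 / 2) := by ring
        _ ≤ _ := by gcongr; linarith
    · push Not at h
      have : w ^ 2 ≤ 2 := by nlinarith [sq_nonneg a]
      rw [abs_of_nonneg (by nlinarith)]
      nlinarith
  have hB : δ0 ^ 2 / 2 * (1 + Ω ^ 2) ≤ Ω ^ 2 := by
    have : δ0 ^ 2 ≤ Ω ^ 2 := by gcongr
    have : δ0 ^ 2 ≤ 1 := by nlinarith
    nlinarith [sq_nonneg Ω]
  have hAB : (δ0 ^ 2 / 2 * (1 + Ω ^ 2)) * (δ0 / 10 * (1 + Ω ^ 2)) ≤ |‖z‖ - 1| * (‖z‖ + 1) := by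
    rw [hd]; gcongr
  have h5 : |‖z‖ - 1| * (‖z‖ + 1) ≤ ‖Lsym a τ Ω‖ * (4 * (1 + Ω ^ 2)) :=
    mul_le_mul hL hz4 (by positivity) (norm_nonneg _)
  have h6 := hAB.trans h5
  have h7 : (0:ℝ) < 4 * (1 + Ω ^ 2) := by positivity
  refine le_of_mul_le_mul_right (le_trans (le_of_eq ?_) h6) h7
  ring

lemma one_add_le_sq (Ω : ℝ) : 1 + Ω ≤ 2 * (1 + Ω ^ 2) := by nlinarith [sq_nonneg (Ω - 1)]

set_option maxHeartbeats 1000000 in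
theorem hyp (α β ζ κ : ℝ) (hκ : 0 < κ) : ∃ c s0 : ℝ, 0 < c ∧ 0 < s0 ∧ s0 ≤ 1 ∧
    ∀ a : ℝ, 1 / 4 ≤ a → a ≤ 5 / 4 → κ ≤ |hfun α β ζ a| → κ ≤ |(tau0 a - a) * (α + β)| →
    ∀ s : ℝ, 0 ≤ s → s ≤ s0 → ∀ Ω : ℝ,
      c * (1 + Ω ^ 2) * (s + Dres (omega0 a) Ω) ≤ ‖Lsym a (tau0 a) Ω - s * qsym α β ζ a (tau0 a) Ω‖ := by
  set Cq := |α| + |β| + 2 * |ζ| with hCq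
  have hCq0 : 0 ≤ Cq := by positivity
  set M := 3 * Cq + 14 with hM
  have hM0 : 0 < M := by positivity
  set C := 148 + 7 * |β| + 2 * |ζ| with hC
  have hC0 : 0 < C := by positivity
  set δ0 := min (1 / 2) (κ / (2 * M * C)) with hδ0
  have hδ00 : 0 < δ0 := by positivity
  have hδ1 : δ0 ≤ 1 / 2 := min_le_left _ _
  set c2 := δ0 ^ 3 / 80 with hc2
  have hc20 : 0 < c2 := by positivity
  set s0 := min 1 (c2 / (4 * Cq + 1)) with hs0
  have hs00 : 0 < s0 := by positivity
  set c := min (κ / (2 * M) / 10) (c2 / 4) with hc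
  have hc0 : 0 < c := by positivity
  refine ⟨c, s0, hc0, hs00, min_le_left _ _, ?_⟩
  intro a ha1 ha2 hk1 hk2 s hs hs1 Ω
  have ha0 : 0 < a := by linarith
  have haa : |a| ≤ 5 / 4 := by rw [abs_of_pos ha0]; exact ha2
  have hasq : a ^ 2 ≤ 25 / 16 := by nlinarith
  have has2 : a ^ 2 < 2 := by linarith
  have hw := omega0_ge hasq
  have hw' := omega0_le a
  have hτ : |tau0 a| ≤ 7 := by
    rw [abs_of_pos (ha0.trans (tau_gt ha0 has2))]; exact tau_le ha0 hasq
  have hs1' : s ≤ 1 := hs1.trans (min_le_left _ _)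
  have main : ∀ Ω : ℝ, 0 ≤ Ω → c * (1 + Ω ^ 2) * (s + Dres (omega0 a) Ω) ≤ ‖Lsym a (tau0 a) Ω - s * qsym α β ζ a (tau0 a) Ω‖ := by
    clear Ω
    intro Ω hΩ
    have near : ∀ Ω0 : ℝ, 0 ≤ Ω0 → Ω0 ≤ 3 / 2 → Lsym a (tau0 a) Ω0 = 0 → Dres (omega0 a) Ω ≤ |Ω - Ω0| →
        κ ≤ |((starRingEnd ℂ) (-(2 * Ω0 : ℝ) - Complex.I * (a : ℝ) + Complex.I * (tau0 a : ℝ) * Complex.exp (-(Complex.I * (Ω0 * tau0 a : ℝ)))) * qsym α β ζ a (tau0 a) Ω0).im| →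
        |Ω - Ω0| ≤ δ0 → c * (1 + Ω ^ 2) * (s + Dres (omega0 a) Ω) ≤ ‖Lsym a (tau0 a) Ω - s * qsym α β ζ a (tau0 a) Ω‖ := by
      intro Ω0 h0 h1 hL hD hI hd
      have hex := expand α β ζ a (tau0 a) Ω0 (Ω - Ω0) s hs hτ haa hL
      rw [add_sub_cancel] at hex
      have hq0 : ‖qsym α β ζ a (tau0 a) Ω0‖ ≤ 3 * Cq := by
        refine (norm_qsym_le α β ζ a (tau0 a) Ω0 haa).trans ?_
        rw [abs_of_nonneg h0, ← hCq]; nlinarith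
      have hA : ‖(-(2 * Ω0 : ℝ) - Complex.I * (a : ℝ) + Complex.I * (tau0 a : ℝ) * Complex.exp (-(Complex.I * (Ω0 * tau0 a : ℝ))) : ℂ)‖ ≤ 14 := by
        refine (norm_add_le _ _).trans ((add_le_add (norm_sub_le _ _) le_rfl).trans ?_)
        rw [norm_neg, norm_mul, norm_mul, norm_mul, norm_expI, Complex.norm_I, Complex.norm_real, Complex.norm_real, Complex.norm_real, Real.norm_eq_abs, Real.norm_eq_abs, Real.norm_eq_abs, abs_of_nonneg (show 0 ≤ 2 * Ω0 by linarith)]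
        linarith
      have := near_lemma (by rw [hM]; exact add_le_add hq0 hA) hκ hM0 hC0 hI hs hex (hd.trans (min_le_right _ _))
      refine le_trans ?_ this
      have hΩ2 : Ω ≤ 2 := by linarith [le_abs_self (Ω - Ω0)]
      have h10 : 1 + Ω ^ 2 ≤ 10 := by nlinarith
      calc c * (1 + Ω ^ 2) * (s + Dres (omega0 a) Ω) ≤ (κ / (2 * M) / 10) * 10 * (s + |Ω - Ω0|) := by
            gcongr
            · exact add_nonneg hs (Dres_nonneg _ _)
            · exact min_le_left _ _
        _ = _ := by ring
    by_cases hn0 : Ω ≤ δ0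
    · refine near 0 le_rfl (by norm_num) (Lsym_zero _ _) ?_ ?_ ?_
      · rw [sub_zero]; exact (min_le_right _ _).trans (min_le_left _ _)
      · refine hk2.trans (le_of_eq ?_)
        rw [← abs_neg]; congr 1
        simp [qsym, Complex.mul_im]; ring
      · rw [sub_zero, abs_of_nonneg hΩ]; exact hn0
    by_cases hn1 : |Ω - omega0 a| ≤ δ0
    · refine near (omega0 a) (by linarith) (by linarith) (Lsym_omega ha0 has2) ?_ ?_ hn1
      · exact (min_le_right _ _).trans ((min_le_right _ _).trans (min_le_left _ _))
      · refine hk1.trans (le_of_eq ?_)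
        congr 1
        have hw2 := omega0_sq has2
        unfold qsym
        rw [expI a ha0 has2]
        simp only [Complex.mul_im, Complex.mul_re, Complex.conj_re, Complex.conj_im, Complex.add_re, Complex.add_im, Complex.sub_re, Complex.sub_im, Complex.neg_re, Complex.neg_im, Complex.ofReal_re, Complex.ofReal_im, Complex.I_re, Complex.I_im]
        unfold hfun
        rw [← hw2]
        ring
    · push Not at hn0 hn1
      have h1 := away (tau0 a) haa hΩ (omega0_sq has2) hw hδ00 (by linarith) hn0.le hn1.le
      rw [← hc2] at h1
      have h2 : ‖(s:ℂ) * qsym α β ζ a (tau0 a) Ω‖ ≤ c2 / 2 * (1 + Ω ^ 2) := by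
        rw [norm_mul, Complex.norm_real, Real.norm_of_nonneg hs]
        have hq := norm_qsym_le α β ζ a (tau0 a) Ω haa
        rw [abs_of_nonneg hΩ, ← hCq] at hq
        have h3 : s * (4 * Cq + 1) ≤ c2 := by
          have := hs1.trans (min_le_right _ _)
          rwa [le_div_iff₀ (by positivity)] at this
        have h4 := one_add_le_sq Ω
        calc s * ‖qsym α β ζ a (tau0 a) Ω‖ ≤ s * (Cq * (2 * (1 + Ω ^ 2))) := by
              gcongr; exact hq.trans (by gcongr)
          _ = (s * (4 * Cq)) / 2 * (1 + Ω ^ 2) := by ring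
          _ ≤ _ := by gcongr; linarith
      have h3 := norm_sub_norm_le (Lsym a (tau0 a) Ω) (s * qsym α β ζ a (tau0 a) Ω)
      have hD := Dres_le_one (omega0 a) Ω
      have hD0 := Dres_nonneg (omega0 a) Ω
      calc c * (1 + Ω ^ 2) * (s + Dres (omega0 a) Ω) ≤ (c2 / 4) * (1 + Ω ^ 2) * (1 + 1) := by
            gcongr
            exact min_le_right _ _
        _ ≤ _ := by linarith
  rcases le_total 0 Ω with h | h
  · exact main Ω h
  · have := main (-Ω) (by linarith)
    rw [Lsym_neg, qsym_neg, Dres_neg] at this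
    have e : (starRingEnd ℂ) (Lsym a (tau0 a) Ω) - (s:ℂ) * (starRingEnd ℂ) (qsym α β ζ a (tau0 a) Ω) =
      (starRingEnd ℂ) (Lsym a (tau0 a) Ω - s * qsym α β ζ a (tau0 a) Ω) := by simp
    rw [e, RCLike.norm_conj, neg_sq] at this
    exact this

lemma Dres_sum {w Ω1 Ω2 m : ℝ} (hm1 : m ≤ 1) (h0 : m ≤ |Ω1 - Ω2|) (h1 : m ≤ |Ω1 - Ω2 - w|) (h2 : m ≤ |Ω1 - Ω2 + w|)
    (h3 : m ≤ |Ω1 - Ω2 - 2 * w|) (h4 : m ≤ |Ω1 - Ω2 + 2 * w|) : m ≤ Dres w Ω1 + Dres w Ω2 := by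
  have n1 := Dres_nonneg w Ω1
  have n2 := Dres_nonneg w Ω2
  have key : ∀ Ω, Dres w Ω = 1 ∨ Dres w Ω = |Ω| ∨ Dres w Ω = |Ω - w| ∨ Dres w Ω = |Ω + w| := by
    intro Ω
    unfold Dres
    rcases min_choice 1 (min |Ω| (min |Ω - w| |Ω + w|)) with h | h <;> rw [h]
    · simp
    rcases min_choice |Ω| (min |Ω - w| |Ω + w|) with h | h <;> rw [h]
    · simp
    rcases min_choice |Ω - w| |Ω + w| with h | h <;> rw [h] <;> simp
  have tri : ∀ x y z : ℝ, m ≤ |z| → z = x - y → m ≤ |x| + |y| := by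
    intro x y z h e; rw [e] at h; exact h.trans (abs_sub _ _)
  rcases key Ω1 with e1 | e1 | e1 | e1
  · linarith
  all_goals
    rcases key Ω2 with e2 | e2 | e2 | e2
    · linarith
    all_goals rw [e1, e2]
  · exact tri _ _ _ h0 (by ring)
  · exact tri _ _ _ h2 (by ring)
  · exact tri _ _ _ h1 (by ring)
  · exact tri _ _ _ h1 (by ring)
  · exact tri _ _ _ h0 (by ring)
  · exact tri _ _ _ h3 (by ring)
  · exact tri _ _ _ h2 (by ring)
  · exact tri _ _ _ h4 (by ring)
  · exact tri _ _ _ h0 (by ring)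

lemma Dres_ge {w Ω m : ℝ} (hm1 : m ≤ 1) (h0 : m ≤ |Ω|) (h1 : m ≤ |Ω - w|) (h2 : m ≤ |Ω + w|) : m ≤ Dres w Ω :=
  le_min hm1 (le_min h0 (le_min h1 h2))

end
end VdP

set_option linter.unusedSectionVars false
set_option linter.style.longLine false

namespace VdP
open scoped NNReal ENNReal
noncomputable section
open Filter Topology

lemma summable_exp_int {δ : ℝ} (hδ : 0 < δ) : Summable fun k : ℤ => Real.exp (-(δ * |(k : ℝ)|)) := by
  have h : Summable fun n : ℕ => Real.exp (-δ) ^ n := summable_geometric_of_lt_one (Real.exp_pos _).le (by rw [Real.exp_lt_one_iff]; linarith)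
  have h2 : ∀ n : ℕ, Real.exp (-δ) ^ n = Real.exp (-(δ * (n:ℝ))) := fun n => by
    rw [← Real.exp_nat_mul]; congr 1; ring
  refine Summable.of_nat_of_neg ?_ ?_
  · refine h.congr fun n => ?_
    rw [h2]; simp
  · refine h.congr fun n => ?_
    rw [h2]; simp

lemma summable_exp_nrm {δ : ℝ} (hδ : 0 < δ) : ∀ d : ℕ, Summable fun k : Idx d => Real.exp (-(δ * nrm k)) := by
  intro d
  induction d with
  | zero => exact (hasSum_fintype _).summable
  | succ d ih =>
    have := (summable_exp_int hδ).mul_of_nonneg ih (fun _ => (Real.exp_pos _).le) (fun _ => (Real.exp_pos _).le)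
    rw [← (Fin.consEquiv (fun _ : Fin (d+1) => ℤ)).summable_iff]
    refine this.congr fun p => ?_
    simp only [Function.comp_apply, Fin.consEquiv_apply, nrm, Fin.sum_univ_succ, Fin.cons_zero, Fin.cons_succ]
    rw [← Real.exp_add]; congr 1; ring

lemma null_small (F : ℝ → ℝ) (hF : Measurable F) (hF0 : ∀ a, 0 ≤ F a) {S : Set ℝ} (hS : MeasurableSet S) (hSf : volume S ≠ ⊤)
    (hnull : volume {a | a ∈ S ∧ F a = 0} = 0) {η : ℝ} (hη : 0 < η) :
    ∃ κ : ℝ, 0 < κ ∧ volume {a | a ∈ S ∧ F a < κ} ≤ ENNReal.ofReal η := by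
  let A : ℕ → Set ℝ := fun n => {a | a ∈ S ∧ F a < 1 / ((n : ℝ) + 1)}
  have hA : ∀ n, MeasurableSet (A n) := fun n => hS.inter (measurableSet_lt hF measurable_const)
  have hanti : Antitone A := by
    intro m n hmn a ha
    refine ⟨ha.1, ha.2.trans_le ?_⟩
    exact Nat.one_div_le_one_div hmn
  have ht := tendsto_measure_iInter_atTop (μ := volume) (s := A) (fun n => (hA n).nullMeasurableSet) hanti
    ⟨0, ne_top_of_le_ne_top hSf (measure_mono fun a ha => ha.1)⟩
  have hI : (⋂ n, A n) ⊆ {a | a ∈ S ∧ F a = 0} := by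
    intro a ha
    rw [Set.mem_iInter] at ha
    refine ⟨(ha 0).1, le_antisymm ?_ (hF0 a)⟩
    exact ge_of_tendsto' tendsto_one_div_add_atTop_nhds_zero_nat fun n => (ha n).2.le
  rw [measure_mono_null hI hnull] at ht
  obtain ⟨n, hn⟩ := (ht.eventually_lt_const (ENNReal.ofReal_pos.2 hη)).exists
  exact ⟨1 / ((n:ℝ) + 1), by positivity, hn.le⟩

/-- Smooth version of `τ0`. -/
def Tf (a : ℝ) : ℝ := Real.arccos (a ^ 2 - 1) / √(2 - a ^ 2)

lemma tau0_Tf {a : ℝ} (h0 : 0 < a) (h2 : a ^ 2 < 2) : tau0 a = Tf a := tau0_eq h0 h2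

lemma Tf_analytic {a : ℝ} (h0 : 0 < a) (h2 : a ^ 2 < 2) : AnalyticAt ℝ Tf a := by
  unfold Tf
  have hp : AnalyticAt ℝ (fun a : ℝ => a ^ 2) a := by fun_prop
  refine AnalyticAt.div ?_ ?_ (Real.sqrt_pos.2 (by linarith)).ne'
  · have h : AnalyticAt ℝ Real.arccos (a ^ 2 - 1) :=
      (Real.contDiffAt_arccos (by nlinarith) (by linarith)).analyticAt
    exact AnalyticAt.fun_comp (g := Real.arccos) (f := fun a : ℝ => a ^ 2 - 1) h (by fun_prop)
  · have h : AnalyticAt ℝ Real.sqrt (2 - a ^ 2) := (Real.contDiffAt_sqrt (by linarith)).analyticAt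
    exact AnalyticAt.fun_comp (g := Real.sqrt) (f := fun a : ℝ => 2 - a ^ 2) h (by fun_prop)

lemma Tf_cont : ContinuousAt Tf 0 := by
  unfold Tf
  refine ContinuousAt.div (Continuous.continuousAt ?_) (Continuous.continuousAt ?_) ?_
  · exact Real.continuous_arccos.comp (by fun_prop)
  · fun_prop
  · simp

lemma hfun_finite (α β ζ : ℝ) (hαβ : α + β ≠ 0) (hnd : α ≠ β ∨ ζ = 0) :
    {a | a ∈ Set.Icc (1/4 : ℝ) (5/4) ∧ hfun α β ζ a = 0}.Finite := by
  let H : ℝ → ℝ := fun a => (2 - a * Tf a) * a * (2 - a ^ 2) * (β + ζ) - (Tf a * (a ^ 2 - 1) - a) * (α + β * (a ^ 2 - 1))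
  set U := Set.Ioo (0:ℝ) (√2) with hU
  have hU2 : ∀ a ∈ U, 0 < a ∧ a ^ 2 < 2 := by
    intro a ha; exact ⟨ha.1, (Real.lt_sqrt ha.1.le).1 ha.2⟩
  have hHh : ∀ a, 0 < a → a ^ 2 < 2 → H a = hfun α β ζ a := by
    intro a h0 h2; simp only [H, hfun, tau0_Tf h0 h2]
  have hHa : AnalyticOnNhd ℝ H U := by
    intro a ha
    obtain ⟨h0, h2⟩ := hU2 a ha
    have := Tf_analytic h0 h2
    simp only [H]
    fun_prop
  by_contra hinf
  obtain ⟨z, hz, hacc⟩ := Set.Infinite.exists_accPt_of_subset_isCompact (s := {a | a ∈ Set.Icc (1/4 : ℝ) (5/4) ∧ hfun α β ζ a = 0}) hinf (isCompact_Icc (a := (1/4:ℝ)) (b := 5/4)) (fun a ha => ha.1)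
  have hIU : ∀ a ∈ Set.Icc (1/4:ℝ) (5/4), a ∈ U := by
    intro a ha
    refine ⟨by linarith [ha.1], (Real.lt_sqrt (by linarith [ha.1])).2 (by nlinarith [ha.1, ha.2])⟩
  have hfr : ∃ᶠ x in 𝓝[≠] z, H x = 0 := by
    rw [accPt_iff_frequently_nhdsNE] at hacc
    refine hacc.mono fun x hx => ?_
    obtain ⟨h0, h2⟩ := hU2 x (hIU x hx.1)
    rw [hHh x h0 h2]; exact hx.2
  have hEq := hHa.eqOn_zero_of_preconnected_of_frequently_eq_zero isPreconnected_Ioo (hIU z hz) hfr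
  have hmem : U ∈ 𝓝[>] (0:ℝ) := Ioo_mem_nhdsGT (by positivity)
  have hT := Tf_cont
  have hT0 : Tf 0 ≠ 0 := by
    simp [Tf, Real.pi_ne_zero]
  by_cases hab : α = β
  · have hζ : ζ = 0 := hnd.resolve_left (fun h => h hab)
    subst hab hζ
    have hα : α ≠ 0 := fun h => hαβ (by rw [h]; ring)
    let K : ℝ → ℝ := fun a => α * (4 - a ^ 2 - a * Tf a)
    have hKc : ContinuousAt K 0 := by simp only [K]; fun_prop
    have hK0 : ∀ᶠ a in 𝓝[>] (0:ℝ), K a = 0 := by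
      filter_upwards [hmem] with a ha
      have h1 : H a = 0 := hEq ha
      have h2 : H a = a * K a := by simp only [H, K]; ring
      rw [h2] at h1
      exact (mul_eq_zero.1 h1).resolve_left ha.1.ne'
    have h1 : Tendsto K (𝓝[>] 0) (𝓝 (K 0)) := hKc.tendsto.mono_left nhdsWithin_le_nhds
    have h2 : K 0 = 0 := tendsto_nhds_unique h1 ((tendsto_congr' hK0).2 tendsto_const_nhds)
    simp [K] at h2
    exact hα h2
  · have hHc : ContinuousAt H 0 := by simp only [H]; fun_prop
    have h1 : Tendsto H (𝓝[>] 0) (𝓝 (H 0)) := hHc.tendsto.mono_left nhdsWithin_le_nhds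
    have hH0 : ∀ᶠ a in 𝓝[>] (0:ℝ), H a = 0 := by
      filter_upwards [hmem] with a ha using hEq ha
    have h2 : H 0 = 0 := tendsto_nhds_unique h1 ((tendsto_congr' hH0).2 tendsto_const_nhds)
    simp [H] at h2
    rcases h2 with h2 | h2
    · exact hT0 h2
    · exact hab (by linarith)

lemma omega0_measurable : Measurable omega0 := by
  unfold omega0; fun_prop

lemma tau0_measurable : Measurable tau0 := by
  unfold tau0
  refine Measurable.ite measurableSet_Ioi ?_ ?_
  · exact (Real.measurable_arcsin.comp (measurable_id.mul omega0_measurable)).div omega0_measurable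
  · exact ((measurable_const).sub (Real.measurable_arcsin.comp (measurable_id.mul omega0_measurable))).div omega0_measurable

lemma omega0_inj {a b : ℝ} (ha : a ∈ Set.Icc (1/4:ℝ) (5/4)) (hb : b ∈ Set.Icc (1/4:ℝ) (5/4)) :
    |a - b| ≤ 6 * |omega0 a - omega0 b| := by
  have e1 := omega0_sq (a := a) (by nlinarith [ha.1, ha.2])
  have e2 := omega0_sq (a := b) (by nlinarith [hb.1, hb.2])
  have h1 : |omega0 a - omega0 b| * (omega0 a + omega0 b) = |a - b| * (a + b) := by
    have p1 : 0 ≤ omega0 a + omega0 b := by unfold omega0; positivity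
    have p2 : 0 ≤ a + b := by linarith [ha.1, hb.1]
    have e : (omega0 a - omega0 b) * (omega0 a + omega0 b) = -((a - b) * (a + b)) := by nlinarith
    have e' := congrArg abs e
    rwa [abs_neg, abs_mul, abs_mul, abs_of_nonneg p1, abs_of_nonneg p2] at e'
  have h2 := omega0_le a
  have h3 := omega0_le b
  have h4 : |a - b| * (1 / 2) ≤ |a - b| * (a + b) := by
    gcongr; linarith [ha.1, hb.1]
  have h5 : |omega0 a - omega0 b| * (omega0 a + omega0 b) ≤ |omega0 a - omega0 b| * 3 := by
    gcongr; linarith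
  linarith

lemma vol_res (x j e : ℝ) (hj : 1 ≤ |j|) (he : 0 ≤ e) :
    volume {a | a ∈ Set.Icc (1/4:ℝ) (5/4) ∧ |x - j * omega0 a| < e} ≤ ENNReal.ofReal (12 * e) := by
  refine (Real.volume_le_diam _).trans (Metric.ediam_le ?_)
  rintro a ⟨ha, ha'⟩ b ⟨hb, hb'⟩
  rw [edist_dist, Real.dist_eq]
  apply ENNReal.ofReal_le_ofReal
  refine (omega0_inj ha hb).trans ?_
  have h1 : |j| * |omega0 a - omega0 b| ≤ 2 * e := by
    rw [← abs_mul, show j * (omega0 a - omega0 b) = (x - j * omega0 b) - (x - j * omega0 a) by ring]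
    refine (abs_sub _ _).trans ?_
    linarith
  nlinarith [abs_nonneg (omega0 a - omega0 b)]

theorem good_set {d : ℕ} (Ω : Idx d → ℝ) (α β ζ : ℝ) (hαβ : α + β ≠ 0) (hnd : α ≠ β ∨ ζ = 0) {δ η : ℝ} (hδ : 0 < δ) (hη : 0 < η) :
    ∃ κ γ : ℝ, 0 < κ ∧ 0 < γ ∧ γ ≤ 1 ∧ ∃ Pa : Set ℝ, MeasurableSet Pa ∧ Pa ⊆ Set.Icc (1/4 : ℝ) (5/4) ∧
      volume (Set.Icc (1/4 : ℝ) (5/4)) ≤ volume Pa + ENNReal.ofReal η ∧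
      ∀ a ∈ Pa, κ ≤ |hfun α β ζ a| ∧ κ ≤ |(tau0 a - a) * (α + β)| ∧
        ∀ l : Idx d, γ * Real.exp (-(δ * nrm l)) ≤ |Ω l - omega0 a| ∧ γ * Real.exp (-(δ * nrm l)) ≤ |Ω l + omega0 a| ∧
          γ * Real.exp (-(δ * nrm l)) ≤ |Ω l - 2 * omega0 a| ∧ γ * Real.exp (-(δ * nrm l)) ≤ |Ω l + 2 * omega0 a| := by
  set F : ℝ → ℝ := fun a => min |hfun α β ζ a| |(tau0 a - a) * (α + β)| with hF
  have hτm := tau0_measurable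
  have hFm : Measurable F := by
    simp only [hF, hfun]
    fun_prop
  obtain ⟨κ, hκ, hκv⟩ := null_small F hFm (fun a => le_min (abs_nonneg _) (abs_nonneg _)) (S := Set.Icc (1/4:ℝ) (5/4)) measurableSet_Icc
    (by simp) (by
      refine measure_mono_null ?_ ((hfun_finite α β ζ hαβ hnd).measure_zero volume)
      rintro a ⟨ha, ha2⟩
      refine ⟨ha, ?_⟩
      have h3 : 0 < |(tau0 a - a) * (α + β)| := by
        rw [abs_pos]
        refine mul_ne_zero ?_ hαβ
        have := tau_gt (a := a) (by linarith [ha.1]) (by nlinarith [ha.1, ha.2])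
        linarith
      by_contra h
      have := lt_min (abs_pos.2 h) h3
      simp only [hF] at ha2
      linarith) (half_pos hη)
  have hsum := summable_exp_nrm hδ d
  set S0 := ∑' l : Idx d, Real.exp (-(δ * nrm l)) with hS0
  have hS : 0 ≤ S0 := tsum_nonneg fun _ => (Real.exp_pos _).le
  set γ := min 1 (η / 2 / (48 * (S0 + 1))) with hγ
  have hγ0 : 0 < γ := by positivity
  have hγ2 : 48 * γ * S0 ≤ η / 2 := by
    have : γ ≤ η / 2 / (48 * (S0 + 1)) := min_le_right _ _
    rw [le_div_iff₀ (by positivity)] at this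
    nlinarith
  set e : Idx d → ℝ := fun l => γ * Real.exp (-(δ * nrm l)) with he
  have he0 : ∀ l, 0 ≤ e l := fun l => by positivity
  let R : Idx d → ℝ → Set ℝ := fun l j => {a | a ∈ Set.Icc (1/4:ℝ) (5/4) ∧ |Ω l - j * omega0 a| < e l}
  have hRm : ∀ l j, MeasurableSet (R l j) := by
    intro l j
    have := omega0_measurable
    have h : Measurable fun a => |Ω l - j * omega0 a| := by fun_prop
    exact measurableSet_Icc.inter (measurableSet_lt h measurable_const)
  set A := {a | a ∈ Set.Icc (1/4:ℝ) (5/4) ∧ F a < κ} with hA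
  have hAm : MeasurableSet A := measurableSet_Icc.inter (measurableSet_lt hFm measurable_const)
  let RR : Idx d → Set ℝ := fun l => (R l 1 ∪ R l (-1)) ∪ (R l 2 ∪ R l (-2))
  have hRR : ∀ l, volume (RR l) ≤ ENNReal.ofReal (48 * e l) := by
    intro l
    have hv : ∀ j : ℝ, 1 ≤ |j| → volume (R l j) ≤ ENNReal.ofReal (12 * e l) := fun j hj => vol_res _ _ _ hj (he0 l)
    have h12 : 0 ≤ 12 * e l := by linarith [he0 l]
    calc volume (RR l) ≤ (volume (R l 1) + volume (R l (-1))) + (volume (R l 2) + volume (R l (-2))) :=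
          (measure_union_le _ _).trans (add_le_add (measure_union_le _ _) (measure_union_le _ _))
      _ ≤ (ENNReal.ofReal (12 * e l) + ENNReal.ofReal (12 * e l)) + (ENNReal.ofReal (12 * e l) + ENNReal.ofReal (12 * e l)) :=
          add_le_add (add_le_add (hv _ (by simp)) (hv _ (by simp))) (add_le_add (hv _ (by simp)) (hv _ (by simp)))
      _ = _ := by
          rw [← ENNReal.ofReal_add h12 h12, ← ENNReal.ofReal_add (by linarith) (by linarith)]; congr 1; ring
  set Bad := A ∪ ⋃ l, RR l with hBad
  have hBm : MeasurableSet Bad := hAm.union (MeasurableSet.iUnion fun l => ((hRm _ _).union (hRm _ _)).union ((hRm _ _).union (hRm _ _)))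
  have hBv : volume Bad ≤ ENNReal.ofReal η := by
    have h1 : volume (⋃ l, RR l) ≤ ENNReal.ofReal (η / 2) := by
      refine (measure_iUnion_le _).trans ((ENNReal.tsum_le_tsum hRR).trans ?_)
      rw [← ENNReal.ofReal_tsum_of_nonneg (fun l => by have := he0 l; linarith) ((hsum.mul_left γ).mul_left 48)]
      apply ENNReal.ofReal_le_ofReal
      refine le_trans (le_of_eq ?_) hγ2
      rw [tsum_mul_left, tsum_mul_left]; ring
    refine (measure_union_le _ _).trans ((add_le_add hκv h1).trans ?_)
    rw [← ENNReal.ofReal_add (by linarith) (by linarith), add_halves]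
  refine ⟨κ, γ, hκ, hγ0, min_le_left _ _, Set.Icc (1/4:ℝ) (5/4) \ Bad, measurableSet_Icc.diff hBm, Set.sdiff_subset, ?_, ?_⟩
  · calc volume (Set.Icc (1/4:ℝ) (5/4)) ≤ volume ((Set.Icc (1/4:ℝ) (5/4) \ Bad) ∪ Bad) := measure_mono (by intro a ha; by_cases h : a ∈ Bad; exacts [Or.inr h, Or.inl ⟨ha, h⟩])
      _ ≤ _ := (measure_union_le _ _).trans (add_le_add le_rfl hBv)
  · rintro a ⟨ha, hb⟩
    have h1 : a ∉ A := fun h => hb (Or.inl h)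
    have h2 : κ ≤ F a := by
      by_contra h; exact h1 ⟨ha, not_le.1 h⟩
    refine ⟨h2.trans (min_le_left _ _), h2.trans (min_le_right _ _), fun l => ?_⟩
    have h3 : a ∉ RR l := fun h => hb (Or.inr (Set.mem_iUnion.2 ⟨l, h⟩))
    have h4 : ∀ j : ℝ, a ∉ R l j → γ * Real.exp (-(δ * nrm l)) ≤ |Ω l - j * omega0 a| := by
      intro j hj; by_contra h; exact hj ⟨ha, not_le.1 h⟩
    refine ⟨?_, ?_, ?_, ?_⟩
    · simpa using h4 1 fun h => h3 (Or.inl (Or.inl h))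
    · simpa using h4 (-1) fun h => h3 (Or.inl (Or.inr h))
    · simpa using h4 2 fun h => h3 (Or.inr (Or.inl h))
    · simpa using h4 (-2) fun h => h3 (Or.inr (Or.inr h))

end
end VdP

set_option linter.unusedSectionVars false
set_option linter.style.longLine false

namespace VdP
open scoped NNReal ENNReal
noncomputable section
open Filter Topology
open scoped Nat

section UniformBounds
variable {E : Type} [NormedAddCommGroup E] [NormedSpace ℝ E]

/-- Uniform analyticity bounds on a set. -/
def UB (F : E → ℝ) (S : Set E) : Prop :=
  ∃ r C R : ℝ, 0 < r ∧ 0 < C ∧ 0 < R ∧ ∀ y ∈ S, (∀ n, ‖iteratedFDeriv ℝ n F y‖ ≤ n ! * (C * R ^ n)) ∧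
    ∀ z, ‖z‖ < r → HasSum (fun n => (n ! : ℝ)⁻¹ • iteratedFDeriv ℝ n F y (fun _ => z)) (F (y + z))

lemma changeOrigin_bd (p : FormalMultilinearSeries ℝ E ℝ) {r : ℝ≥0} {v : E}
    (hs : Summable fun s : Σ k l : ℕ, { s : Finset (Fin (k + l)) // s.card = l } => ‖p (s.1 + s.2.1)‖₊ * r ^ s.2.1 * r ^ s.1)
    (hvr : ‖v‖₊ ≤ r) (hv : (‖v‖₊ : ℝ≥0∞) < p.radius) (n : ℕ) :
    ‖p.changeOrigin v n‖₊ * r ^ n ≤ ∑' s : Σ k l : ℕ, { s : Finset (Fin (k + l)) // s.card = l }, ‖p (s.1 + s.2.1)‖₊ * r ^ s.2.1 * r ^ s.1 := by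
  have h1 := p.nnnorm_changeOrigin_le n (x := v) hv
  have h3 : Summable fun s : Σ l : ℕ, { s : Finset (Fin (n + l)) // s.card = l } => ‖p (n + s.1)‖₊ * r ^ s.1 * r ^ n := (NNReal.summable_sigma.1 hs).1 n
  have h4 : ∀ s : Σ l : ℕ, { s : Finset (Fin (n + l)) // s.card = l }, ‖p (n + s.1)‖₊ * ‖v‖₊ ^ s.1 * r ^ n ≤ ‖p (n + s.1)‖₊ * r ^ s.1 * r ^ n := by
    intro s
    have : ‖v‖₊ ^ s.1 ≤ r ^ s.1 := pow_le_pow_left' hvr _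
    exact mul_le_mul_left (mul_le_mul_right this _) _
  have h5 := NNReal.summable_of_le h4 h3
  have h6 := Summable.tsum_le_tsum h4 h5 h3
  have h7 := NNReal.tsum_comp_le_tsum_of_inj hs (i := fun s : Σ l : ℕ, { s : Finset (Fin (n + l)) // s.card = l } => Sigma.mk n s) (fun a b h => eq_of_heq (Sigma.mk.inj h).2)
  rw [NNReal.tsum_mul_right] at h6
  exact (mul_le_mul_left h1 _).trans (h6.trans h7)

lemma UB_local [CompleteSpace E] (F : E → ℝ) (hF : AnalyticOnNhd ℝ F Set.univ) (x : E) : ∃ U ∈ 𝓝 x, UB F U := by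
  obtain ⟨p, r0, hp⟩ := hF x trivial
  obtain ⟨r, hr0, hr⟩ : ∃ r : ℝ≥0, 0 < r ∧ (r + r + r : ℝ≥0∞) < r0 := by
    obtain ⟨r1, h1, h2⟩ := ENNReal.lt_iff_exists_nnreal_btwn.1 hp.r_pos
    refine ⟨r1 / 3, by have : 0 < r1 := by exact_mod_cast h1
                       positivity, ?_⟩
    refine lt_of_eq_of_lt ?_ h2
    norm_cast
    rw [← NNReal.coe_inj]; push_cast; ring
  have hrr : (r + r : ℝ≥0∞) < p.radius := by
    refine lt_of_le_of_lt ?_ (hr.trans_le hp.r_le)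
    norm_cast; rw [← NNReal.coe_le_coe]; push_cast; linarith [r.2]
  have hs := p.changeOriginSeries_summable_aux₁ hrr
  set S0 := ∑' s : Σ k l : ℕ, { s : Finset (Fin (k + l)) // s.card = l }, ‖p (s.1 + s.2.1)‖₊ * r ^ s.2.1 * r ^ s.1 with hS0
  refine ⟨Metric.ball x r, Metric.ball_mem_nhds _ (by exact_mod_cast hr0), r, S0 + 1, (r : ℝ)⁻¹, by exact_mod_cast hr0, by positivity, by positivity, ?_⟩
  intro y hy
  set v := y - x with hv
  have hvr : ‖v‖₊ ≤ r := by
    rw [Metric.mem_ball, dist_eq_norm] at hy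
    exact_mod_cast hy.le
  have hvr' : (‖v‖₊ : ℝ≥0∞) ≤ r := by exact_mod_cast hvr
  have hrlt : (r : ℝ≥0∞) < r0 := by
    refine lt_of_le_of_lt ?_ hr
    norm_cast; rw [← NNReal.coe_le_coe]; push_cast; linarith [r.2]
  have hq := hp.changeOrigin (y := v) (hvr'.trans_lt hrlt)
  rw [show x + v = y by simp [hv]] at hq
  have hb : ∀ n, ‖p.changeOrigin v n‖₊ * r ^ n ≤ S0 := fun n => changeOrigin_bd p hs hvr (hvr'.trans_lt (hrlt.trans_le hp.r_le)) n
  constructor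
  · intro n
    refine ContinuousMultilinearMap.opNorm_le_bound (by positivity) fun m => ?_
    rw [HasFPowerSeriesOnBall.iteratedFDeriv_eq_sum hq hF.analyticOn]
    have h5 : ‖p.changeOrigin v n‖ ≤ (S0 + 1) * (r:ℝ)⁻¹ ^ n := by
      have := hb n
      rw [← NNReal.coe_le_coe] at this
      push_cast at this
      have hrn : (0:ℝ) < (r:ℝ) ^ n := by positivity
      rw [inv_pow, ← div_eq_mul_inv, le_div_iff₀ hrn]
      linarith
    refine (norm_sum_le _ _).trans ?_
    calc ∑ σ : Equiv.Perm (Fin n), ‖p.changeOrigin v n (fun i => m (σ i))‖ ≤ ∑ σ : Equiv.Perm (Fin n), (S0 + 1) * (r:ℝ)⁻¹ ^ n * ∏ i, ‖m i‖ := by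
          refine Finset.sum_le_sum fun σ _ => ?_
          refine ((p.changeOrigin v n).le_opNorm _).trans ?_
          rw [Equiv.prod_comp σ (fun i => ‖m i‖)]
          gcongr
      _ = _ := by
          rw [Finset.sum_const, Finset.card_univ, Fintype.card_perm, Fintype.card_fin, nsmul_eq_mul]; ring
  · intro z hz
    apply hq.hasSum_iteratedFDeriv
    rw [Metric.mem_eball, edist_zero_right]
    have : (r : ℝ≥0∞) ≤ r0 - ‖v‖₊ := by
      refine ENNReal.le_sub_of_add_le_right (by simp) ?_
      refine le_trans ?_ hr.le
      calc (r : ℝ≥0∞) + ‖v‖₊ ≤ r + r := by gcongr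
        _ ≤ _ := le_self_add
    refine lt_of_lt_of_le ?_ this
    rw [← ofReal_norm, ← ENNReal.ofReal_coe_nnreal]
    exact (ENNReal.ofReal_lt_ofReal_iff (by exact_mod_cast hr0)).2 hz

lemma UB_compact [CompleteSpace E] (F : E → ℝ) (hF : AnalyticOnNhd ℝ F Set.univ) {K : Set E} (hK : IsCompact K) : UB F K := by
  refine hK.induction_on (p := UB F) ⟨1, 1, 1, by simp⟩ ?_ ?_ ?_
  · rintro s t hst ⟨r, C, R, hr, hC, hR, h⟩
    exact ⟨r, C, R, hr, hC, hR, fun y hy => h y (hst hy)⟩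
  · rintro s t ⟨r, C, R, hr, hC, hR, h⟩ ⟨r', C', R', hr', hC', hR', h'⟩
    refine ⟨min r r', max C C', max R R', by positivity, by positivity, by positivity, ?_⟩
    rintro y (hy | hy)
    · refine ⟨fun n => ((h y hy).1 n).trans ?_, fun z hz => (h y hy).2 z (hz.trans_le (min_le_left _ _))⟩
      gcongr
      · exact le_max_left _ _
      · exact le_max_left _ _
    · refine ⟨fun n => ((h' y hy).1 n).trans ?_, fun z hz => (h' y hy).2 z (hz.trans_le (min_le_right _ _))⟩
      gcongr
      · exact le_max_right _ _
      · exact le_max_right _ _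
  · intro x _
    obtain ⟨U, hU, h⟩ := UB_local F hF x
    exact ⟨U, mem_nhdsWithin_of_mem_nhds hU, h⟩

end UniformBounds

end
end VdP

set_option linter.unusedSectionVars false
set_option linter.style.longLine false

namespace VdP
open scoped NNReal ENNReal
noncomputable section
open Filter Topology
open scoped Pointwise

variable {d : ℕ}

/-- The pairing of an index and a vector. -/
def dotp (k : Idx d) (φ : Fin d → ℝ) : ℝ := ∑ i, (k i : ℝ) * φ i

/-- Projection to the unit torus. -/
def pr (x : Fin d → ℝ) : UnitAddTorus (Fin d) := fun i => (x i : UnitAddCircle)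

lemma pr_cont : Continuous (pr (d := d)) := by
  unfold pr
  refine continuous_pi fun i => ?_
  exact (AddCircle.continuous_mk' 1).comp (continuous_apply i)

lemma pr_add (x y : Fin d → ℝ) : pr (x + y) = pr x + pr y := by
  funext i; simp [pr]

lemma mF (k : Idx d) (x : Fin d → ℝ) : UnitAddTorus.mFourier k (pr x) = Complex.exp (Complex.I * ((2 * π * dotp k x : ℝ) : ℂ)) := by
  simp only [UnitAddTorus.mFourier, ContinuousMap.coe_mk, pr, fourier_coe_apply]
  rw [← Complex.exp_sum]
  congr 1
  unfold dotp
  push_cast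
  rw [Finset.mul_sum, Finset.mul_sum]
  refine Finset.sum_congr rfl fun i _ => ?_
  ring

/-- Periodicity. -/
def Per (h : (Fin d → ℝ) → ℝ) : Prop := ∀ (φ : Fin d → ℝ) (m : Idx d), h (fun i => φ i + 2 * π * m i) = h φ

/-- Unit cube. -/
def cube (d : ℕ) : Set (Fin d → ℝ) := {x | ∀ i, x i ∈ Set.Ioc (0:ℝ) (0 + 1)}

/-- Fourier coefficients of a periodic function. -/
def fc (h : (Fin d → ℝ) → ℝ) (k : Idx d) : ℂ :=
  ∫ x in cube d, UnitAddTorus.mFourier (-k) (pr x) • ((h ((2 * π) • x) : ℝ) : ℂ)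

lemma pr_quot : IsQuotientMap (pr (d := d)) := by
  have : IsOpenQuotientMap (Pi.map (fun (_ : Fin d) (x : ℝ) => (x : UnitAddCircle))) :=
    IsOpenQuotientMap.piMap fun _ => QuotientAddGroup.isOpenQuotientMap_mk
  exact this.isQuotientMap

lemma exists_lift (h : (Fin d → ℝ) → ℝ) (hc : Continuous h) (hp : Per h) :
    ∃ H : C(UnitAddTorus (Fin d), ℂ), ∀ x, H (pr x) = ((h ((2 * π) • x) : ℝ) : ℂ) := by
  let h1 : C(Fin d → ℝ, ℂ) := ⟨fun x => ((h ((2 * π) • x) : ℝ) : ℂ), by fun_prop⟩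
  let p1 : C(Fin d → ℝ, UnitAddTorus (Fin d)) := ⟨pr, pr_cont⟩
  have hq : IsQuotientMap p1 := pr_quot
  have hcomp : ∀ x y : Fin d → ℝ, p1 x = p1 y → h1 x = h1 y := by
    intro x y hxy
    have h2 : ∀ i, ∃ n : ℤ, (n : ℝ) = - y i + x i := by
      intro i
      have := congrFun hxy i
      change ((x i : ℝ) : UnitAddCircle) = ((y i : ℝ) : UnitAddCircle) at this
      rw [eq_comm, QuotientAddGroup.eq, AddSubgroup.mem_zmultiples_iff] at this
      obtain ⟨n, hn⟩ := this
      exact ⟨n, by simpa using hn⟩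
    choose n hn using h2
    change ((h ((2 * π) • x) : ℝ) : ℂ) = ((h ((2 * π) • y) : ℝ) : ℂ)
    rw [← hp ((2 * π) • y) n]
    congr 2
    funext i
    simp only [Pi.smul_apply, smul_eq_mul]
    rw [hn]; ring
  refine ⟨hq.lift h1 (by intro x y; exact hcomp x y), fun x => ?_⟩
  exact DFunLike.congr_fun (hq.lift_comp h1 (by intro x y; exact hcomp x y)) x

lemma fc_eq {h : (Fin d → ℝ) → ℝ} {H : C(UnitAddTorus (Fin d), ℂ)} (hH : ∀ x, H (pr x) = ((h ((2 * π) • x) : ℝ) : ℂ)) (k : Idx d) :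
    fc h k = UnitAddTorus.mFourierCoeff H k := by
  rw [UnitAddTorus.mFourierCoeff_eq_integral H k (fun _ => 0)]
  unfold fc
  refine setIntegral_congr_fun ?_ ?_
  · have : cube d = Set.pi Set.univ fun _ => Set.Ioc (0:ℝ) (0+1) := by ext; simp [cube]
    rw [this]
    exact MeasurableSet.univ_pi fun _ => measurableSet_Ioc
  · intro x _
    simp only
    rw [← hH]; rfl

lemma fc_shift (h : (Fin d → ℝ) → ℝ) (hc : Continuous h) (hp : Per h) (s : Fin d → ℝ) (k : Idx d) :
    fc (fun φ => h (φ + s)) k = Complex.exp (Complex.I * (dotp k s : ℝ)) * fc h k := by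
  obtain ⟨H, hH⟩ := exists_lift h hc hp
  set t : Fin d → ℝ := (2 * π)⁻¹ • s with ht
  have hst : s = (2 * π) • t := by rw [ht, smul_smul, mul_inv_cancel₀ (by positivity), one_smul]
  let H2 : C(UnitAddTorus (Fin d), ℂ) := ⟨fun θ => H (θ + pr t), by fun_prop⟩
  have hH2 : ∀ x, H2 (pr x) = (((fun φ => h (φ + s)) ((2 * π) • x) : ℝ) : ℂ) := by
    intro x
    change H (pr x + pr t) = _
    rw [← pr_add, hH, smul_add, hst]
  have hmeas : ∀ F : UnitAddTorus (Fin d) → ℂ, UnitAddTorus.mFourierCoeff F k = ∫ θ, UnitAddTorus.mFourier (-k) θ • F θ ∂(Measure.pi fun _ => AddCircle.haarAddCircle) := fun F => rfl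
  rw [fc_eq hH2, fc_eq hH, hmeas, hmeas]
  have h1 : ∀ θ, UnitAddTorus.mFourier (-k) θ • H2 θ = (fun θ => UnitAddTorus.mFourier k (pr t) * (UnitAddTorus.mFourier (-k) θ • H θ)) (θ + pr t) := by
    intro θ
    change UnitAddTorus.mFourier (-k) θ * H (θ + pr t) = UnitAddTorus.mFourier k (pr t) * (UnitAddTorus.mFourier (-k) (θ + pr t) * H (θ + pr t))
    have : UnitAddTorus.mFourier (-k) (θ + pr t) = UnitAddTorus.mFourier (-k) θ * UnitAddTorus.mFourier (-k) (pr t) := by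
      simp only [UnitAddTorus.mFourier, ContinuousMap.coe_mk, ← Finset.prod_mul_distrib]
      refine Finset.prod_congr rfl fun i _ => ?_
      simp [fourier_apply, smul_add, AddCircle.toCircle_add]
    rw [this]
    have h2 : UnitAddTorus.mFourier k (pr t) * UnitAddTorus.mFourier (-k) (pr t) = 1 := by
      rw [← UnitAddTorus.mFourier_add, add_neg_cancel, UnitAddTorus.mFourier_zero]; rfl
    linear_combination (-UnitAddTorus.mFourier (-k) θ * H (θ + pr t)) * h2
  simp_rw [h1]
  rw [integral_add_right_eq_self (fun θ => UnitAddTorus.mFourier k (pr t) * (UnitAddTorus.mFourier (-k) θ • H θ)) (pr t), integral_const_mul, mF]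
  congr 3
  rw [hst]; unfold dotp
  simp only [Pi.smul_apply, smul_eq_mul]
  rw [Finset.mul_sum]
  push_cast
  refine Finset.sum_congr rfl fun i _ => by ring

lemma cube_meas : MeasurableSet (cube d) := by
  have : cube d = Set.pi Set.univ fun _ => Set.Ioc (0:ℝ) (0+1) := by ext; simp [cube]
  rw [this]
  exact MeasurableSet.univ_pi fun _ => measurableSet_Ioc

lemma cube_vol : volume (cube d) = 1 := by
  have : cube d = Set.pi Set.univ fun _ => Set.Ioc (0:ℝ) (0+1) := by ext; simp [cube]
  rw [this, Real.volume_pi_Ioc]; simp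

lemma norm_mF_le (k : Idx d) (x : UnitAddTorus (Fin d)) : ‖UnitAddTorus.mFourier k x‖ ≤ 1 := by
  have := (UnitAddTorus.mFourier k).norm_coe_le_norm x
  rwa [UnitAddTorus.mFourier_norm] at this

lemma norm_fc_le (h : (Fin d → ℝ) → ℝ) {M : ℝ} (hM : ∀ φ, |h φ| ≤ M) (k : Idx d) : ‖fc h k‖ ≤ M := by
  unfold fc
  have := norm_setIntegral_le_of_norm_le_const (μ := volume) (s := cube d) (C := M) (f := fun x => UnitAddTorus.mFourier (-k) (pr x) • ((h ((2 * π) • x) : ℝ) : ℂ))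
    (by rw [cube_vol]; simp) (by
      intro x _
      rw [norm_smul, Complex.norm_real]
      calc _ ≤ 1 * M := mul_le_mul (norm_mF_le _ _) (hM _) (abs_nonneg _) zero_le_one
        _ = M := one_mul _)
  simpa [Measure.real, cube_vol] using this

lemma fc_deriv (h : (Fin d → ℝ) → ℝ) (hd : ContDiff ℝ 1 h) (hp : Per h) (v : Fin d → ℝ) {M M0 : ℝ} (hM0 : ∀ φ, |h φ| ≤ M0)
    (hM : ∀ φ, |fderiv ℝ h φ v| ≤ M) (k : Idx d) :
    fc (fun φ => fderiv ℝ h φ v) k = Complex.I * (dotp k v : ℝ) * fc h k := by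
  have hc := hd.continuous
  have hprc := pr_cont (d := d)
  have hfc : Continuous fun φ => fderiv ℝ h φ v := (hd.continuous_fderiv (by norm_num)).clm_apply continuous_const
  have : IsFiniteMeasure (volume.restrict (cube d)) := ⟨by simp [cube_vol]⟩
  have key := hasDerivAt_integral_of_dominated_loc_of_deriv_le (μ := volume.restrict (cube d)) (x₀ := (0:ℝ)) (s := Set.univ) (𝕜 := ℝ)
    (F := fun s x => UnitAddTorus.mFourier (-k) (pr x) • ((h ((2 * π) • x + s • v) : ℝ) : ℂ))
    (F' := fun s x => UnitAddTorus.mFourier (-k) (pr x) • ((fderiv ℝ h ((2 * π) • x + s • v) v : ℝ) : ℂ))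
    (bound := fun _ => M) univ_mem (Eventually.of_forall fun s => by
      apply Continuous.aestronglyMeasurable
      fun_prop) (by
      refine Integrable.mono' (integrable_const M0) (by apply Continuous.aestronglyMeasurable; fun_prop) (Eventually.of_forall fun x => ?_)
      rw [norm_smul, Complex.norm_real]
      calc _ ≤ 1 * M0 := mul_le_mul (norm_mF_le _ _) (hM0 _) (abs_nonneg _) zero_le_one
        _ = M0 := one_mul _) (by
      apply Continuous.aestronglyMeasurable
      have : Continuous fun x : Fin d → ℝ => fderiv ℝ h ((2 * π) • x + (0:ℝ) • v) v := hfc.comp (by fun_prop)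
      fun_prop) (Eventually.of_forall fun x s _ => by
      rw [norm_smul, Complex.norm_real]
      calc _ ≤ 1 * M := mul_le_mul (norm_mF_le _ _) (hM _) (abs_nonneg _) zero_le_one
        _ = M := one_mul _) (integrable_const _) (Eventually.of_forall fun x s _ => by
      have h1 : HasDerivAt (fun s : ℝ => (2 * π) • x + s • v) v s := by
        simpa using ((hasDerivAt_id s).smul_const v).const_add ((2 * π) • x)
      have h2 : HasFDerivAt h (fderiv ℝ h ((2 * π) • x + s • v)) ((2 * π) • x + s • v) := (hd.differentiable (by norm_num) _).hasFDerivAt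
      have h3 := h2.comp_hasDerivAt s h1
      exact (h3.ofReal_comp).const_mul _)
  have h2 := key.2
  have e1 : ∀ s : ℝ, (∫ x in cube d, UnitAddTorus.mFourier (-k) (pr x) • ((h ((2 * π) • x + s • v) : ℝ) : ℂ)) = Complex.exp (Complex.I * (dotp k (s • v) : ℝ)) * fc h k := by
    intro s
    rw [← fc_shift h hc hp]; rfl
  simp_rw [e1] at h2
  have h4 : HasDerivAt (fun s : ℝ => Complex.exp (Complex.I * (dotp k (s • v) : ℝ)) * fc h k) (Complex.I * (dotp k v : ℝ) * fc h k) 0 := by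
    have e2 : ∀ s : ℝ, (dotp k (s • v)) = s * dotp k v := by
      intro s; unfold dotp; rw [Finset.mul_sum]; exact Finset.sum_congr rfl fun i _ => by simp; ring
    simp_rw [e2]
    have h5 : HasDerivAt (fun s : ℝ => Complex.I * ((s * dotp k v : ℝ) : ℂ)) (Complex.I * (dotp k v : ℝ)) 0 := by
      have := (((hasDerivAt_id (0:ℝ)).mul_const (dotp k v)).ofReal_comp).const_mul Complex.I
      simpa using this
    have := (h5.cexp).mul_const (fc h k)
    simpa using this
  have h6 := h2.unique h4
  rw [← h6]
  unfold fc
  simp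

lemma fc_inversion (h : (Fin d → ℝ) → ℝ) (hc : Continuous h) (hp : Per h) (hs : Summable fun k => ‖fc h k‖) (φ : Fin d → ℝ) :
    HasSum (fun k => fc h k * Complex.exp (Complex.I * (dotp k φ : ℝ))) ((h φ : ℝ) : ℂ) := by
  obtain ⟨H, hH⟩ := exists_lift h hc hp
  have hs' : Summable (UnitAddTorus.mFourierCoeff H) := by
    refine (Summable.of_norm hs).congr fun k => fc_eq hH k
  have := UnitAddTorus.hasSum_mFourier_series_apply_of_summable hs' (pr ((2 * π)⁻¹ • φ))
  rw [hH, smul_smul, mul_inv_cancel₀ (by positivity), one_smul] at this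
  convert this using 2 with k
  rw [fc_eq hH, mF, smul_eq_mul]
  congr 4
  unfold dotp
  rw [Finset.mul_sum]
  refine Finset.sum_congr rfl fun i _ => ?_
  simp only [Pi.smul_apply, smul_eq_mul]
  field_simp

lemma fc_neg (h : (Fin d → ℝ) → ℝ) (k : Idx d) : fc h (-k) = (starRingEnd ℂ) (fc h k) := by
  unfold fc
  rw [← integral_conj]
  congr 1
  funext x
  rw [smul_eq_mul, smul_eq_mul, map_mul, Complex.conj_ofReal, ← UnitAddTorus.mFourier_neg]

lemma fc_zero (h : (Fin d → ℝ) → ℝ) : fc h 0 = ((torusAvg d h : ℝ) : ℂ) := by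
  unfold fc torusAvg
  simp only [neg_zero, UnitAddTorus.mFourier_zero, ContinuousMap.one_apply, one_smul]
  rw [integral_complex_ofReal]
  congr 1
  rw [Measure.setIntegral_comp_smul_of_pos volume h (cube d) (by positivity : 0 < 2 * π)]
  simp only [Module.finrank_fin_fun, smul_eq_mul]
  congr 1
  refine setIntegral_congr_set ?_
  have e1 : (2 * π) • cube d = Set.pi Set.univ fun _ : Fin d => Set.Ioc (0:ℝ) (2 * π) := by
    ext x
    rw [Set.mem_smul_set_iff_inv_smul_mem₀ (by positivity)]
    simp only [cube, Set.mem_setOf_eq, Set.mem_pi, Set.mem_univ, true_implies, Pi.smul_apply, smul_eq_mul, Set.mem_Ioc]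
    refine forall_congr' fun i => ?_
    rw [inv_mul_eq_div, div_le_iff₀ (by positivity), zero_add, one_mul, div_pos_iff_of_pos_right (by positivity)]
  rw [e1, Set.pi_univ_Icc]
  exact Measure.univ_pi_Ioc_ae_eq_Icc
end
end VdP

set_option linter.unusedSectionVars false
set_option linter.style.longLine false

namespace VdP
open scoped NNReal ENNReal
noncomputable section
open Filter Topology

variable {d : ℕ}

/-- The phase space of `g`. -/
abbrev EE (d : ℕ) := (Fin d → ℝ) × ℝ × ℝ × ℝ

/-- Periodicity in the angle variables. -/
def PerE (F : EE d → ℝ) : Prop := ∀ (p : EE d) (m : Idx d), F ((fun i => p.1 i + 2 * π * m i), p.2) = F p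

/-- Coordinate vectors in the non-angle directions. -/
def eb (j : Fin 3) : EE d := (0, if j = 0 then 1 else 0, if j = 1 then 1 else 0, if j = 2 then 1 else 0)

/-- Coordinates. -/
def zc (z : ℝ × ℝ × ℝ) (j : Fin 3) : ℝ := if j = 0 then z.1 else if j = 1 then z.2.1 else z.2.2

lemma norm_eb_le (j : Fin 3) : ‖(eb j : EE d)‖ ≤ 1 := by
  unfold eb
  simp only [Prod.norm_mk, norm_zero]
  refine max_le zero_le_one (max_le ?_ (max_le ?_ ?_)) <;> split_ifs <;> simp

/-- Taylor coefficients. -/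
def gc (F : EE d → ℝ) (n : ℕ) (f : Fin n → Fin 3) (φ : Fin d → ℝ) : ℝ :=
  ((n.factorial : ℕ) : ℝ)⁻¹ * iteratedFDeriv ℝ n F (φ, 0) (fun j => eb (f j))

lemma per_iter {F : EE d → ℝ} (hp : PerE F) (n : ℕ) (φ : Fin d → ℝ) (z : ℝ × ℝ × ℝ) (m : Idx d) :
    iteratedFDeriv ℝ n F ((fun i => φ i + 2 * π * m i), z) = iteratedFDeriv ℝ n F (φ, z) := by
  have h1 : (fun p : EE d => F (p + ((fun i => 2 * π * m i), 0))) = F := by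
    funext p
    rw [← hp p m]
    congr 1
    ext <;> simp
  have h2 := iteratedFDeriv_comp_add_right (𝕜 := ℝ) (f := F) n ((fun i => 2 * π * m i), 0) (φ, z)
  rw [h1] at h2
  rw [h2]
  congr 1
  ext <;> simp

lemma mod_box (φ : Fin d → ℝ) : ∃ m : Idx d, (fun i => φ i + 2 * π * m i) ∈ Set.pi Set.univ fun _ : Fin d => Set.Icc (0:ℝ) (2 * π) := by
  have : ∀ i, ∃ n : ℤ, φ i + 2 * π * n ∈ Set.Icc (0:ℝ) (2 * π) := by
    intro i
    refine ⟨-⌊φ i / (2 * π)⌋, ?_⟩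
    have h1 := Int.floor_le (φ i / (2 * π))
    have h2 := (Int.lt_floor_add_one (φ i / (2 * π))).le
    rw [le_div_iff₀ (by positivity)] at h1
    rw [div_le_iff₀ (by positivity)] at h2
    push_cast
    constructor <;> nlinarith
  choose m hm using this
  exact ⟨m, fun i _ => hm i⟩

lemma UB_torus (F : EE d → ℝ) (hF : AnalyticOnNhd ℝ F Set.univ) (hp : PerE F) :
    UB F {p : EE d | p.2 = 0} := by
  obtain ⟨r, C, R, hr, hC, hR, h⟩ := UB_compact F hF (K := (Set.pi Set.univ fun _ : Fin d => Set.Icc (0:ℝ) (2 * π)) ×ˢ {0})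
    ((isCompact_univ_pi fun _ => isCompact_Icc).prod isCompact_singleton)
  refine ⟨r, C, R, hr, hC, hR, ?_⟩
  rintro ⟨φ, z⟩ hz
  change z = 0 at hz
  subst hz
  obtain ⟨m, hm⟩ := mod_box φ
  have h1 := h ((fun i => φ i + 2 * π * m i), 0) ⟨hm, rfl⟩
  simp_rw [per_iter hp] at h1
  refine ⟨h1.1, fun w hw => ?_⟩
  have h2 := h1.2 w hw
  convert h2 using 1
  rw [← hp _ m]
  congr 1
  ext <;> simp; ring

lemma fc_iter_bd (F : EE d → ℝ) (hF : ContDiff ℝ ⊤ F) (hp : PerE F) {C R : ℝ}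
    (hb : ∀ φ n, ‖iteratedFDeriv ℝ n F (φ, 0)‖ ≤ n.factorial * (C * R ^ n)) (k : Idx d) (l : ℕ) :
    ∀ (n : ℕ) (m : Fin n → EE d), (∀ i, ‖m i‖ ≤ 1) →
      nrm k ^ l * ‖fc (fun φ => iteratedFDeriv ℝ n F (φ, 0) m) k‖ ≤ (n + l).factorial * (C * R ^ (n + l)) := by
  have hev : ∀ (n : ℕ) (m : Fin n → EE d), (∀ i, ‖m i‖ ≤ 1) → ∀ φ, |iteratedFDeriv ℝ n F (φ, 0) m| ≤ n.factorial * (C * R ^ n) := by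
    intro n m hm φ
    refine ((iteratedFDeriv ℝ n F (φ, 0)).le_opNorm m).trans ?_
    calc _ ≤ ‖iteratedFDeriv ℝ n F (φ, 0)‖ * 1 := by
          gcongr
          exact Finset.prod_le_one (fun _ _ => norm_nonneg _) (fun i _ => hm i)
      _ ≤ _ := by rw [mul_one]; exact hb φ n
  induction l with
  | zero =>
    intro n m hm
    simp only [pow_zero, one_mul, add_zero]
    exact norm_fc_le _ (hev n m hm) k
  | succ l ih =>
    intro n m hm
    set v : Fin d → ℝ := fun i => (SignType.sign (k i : ℝ) : ℝ) with hv
    have hvn : ‖((v, 0) : EE d)‖ ≤ 1 := by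
      rw [Prod.norm_mk, norm_zero]
      refine max_le ((pi_norm_le_iff_of_nonneg zero_le_one).2 fun i => ?_) zero_le_one
      simp only [hv]
      rcases lt_trichotomy (k i : ℝ) 0 with h | h | h
      · simp [sign_neg h]
      · simp [h]
      · simp [sign_pos h]
    have hdot : dotp k v = nrm k := by
      unfold dotp nrm
      exact Finset.sum_congr rfl fun i _ => self_mul_sign _
    have hm' : ∀ i, ‖(Fin.cons ((v, 0) : EE d) m : Fin (n+1) → EE d) i‖ ≤ 1 := by
      intro i
      refine Fin.cases ?_ (fun j => ?_) i
      · simpa using hvn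
      · simpa using hm j
    have hcd : ContDiff ℝ 1 (fun φ : Fin d → ℝ => iteratedFDeriv ℝ n F (φ, 0)) :=
      (hF.iteratedFDeriv_right (m := 1) (i := n) (by simp)).comp (by fun_prop : ContDiff ℝ 1 fun φ : Fin d → ℝ => ((φ, 0) : EE d))
    have hcd2 : ContDiff ℝ 1 (fun φ : Fin d → ℝ => iteratedFDeriv ℝ n F (φ, 0) m) :=
      (ContinuousMultilinearMap.apply ℝ (fun _ : Fin n => EE d) ℝ m).contDiff.comp hcd
    have hfd : ∀ φ, fderiv ℝ (fun φ : Fin d → ℝ => iteratedFDeriv ℝ n F (φ, 0) m) φ v = iteratedFDeriv ℝ (n+1) F (φ, 0) (Fin.cons ((v, 0) : EE d) m) := by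
      intro φ
      rw [iteratedFDeriv_succ_apply_left]
      simp only [Fin.cons_zero, Fin.tail_cons]
      have h1 : HasFDerivAt (iteratedFDeriv ℝ n F) (fderiv ℝ (iteratedFDeriv ℝ n F) (φ, 0)) (φ, 0) :=
        ((hF.iteratedFDeriv_right (m := 1) (i := n) (by simp)).differentiable (by norm_num) _).hasFDerivAt
      have h2 : HasFDerivAt (fun φ : Fin d → ℝ => ((φ, 0) : EE d)) (ContinuousLinearMap.inl ℝ (Fin d → ℝ) (ℝ × ℝ × ℝ)) φ :=
        (ContinuousLinearMap.inl ℝ (Fin d → ℝ) (ℝ × ℝ × ℝ)).hasFDerivAt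
      have h3 := (ContinuousMultilinearMap.apply ℝ (fun _ : Fin n => EE d) ℝ m).hasFDerivAt.comp φ (h1.comp φ h2)
      have h4 := h3.fderiv
      change fderiv ℝ ((ContinuousMultilinearMap.apply ℝ (fun _ : Fin n => EE d) ℝ m) ∘ (iteratedFDeriv ℝ n F ∘ (fun φ : Fin d → ℝ => ((φ, 0) : EE d)))) φ v = _
      rw [h4]
      rfl
    have h5 := fc_deriv (fun φ : Fin d → ℝ => iteratedFDeriv ℝ n F (φ, 0) m) hcd2 (fun φ mm => by simp only [per_iter hp]) v
      (hev n m hm) (fun φ => by rw [hfd]; exact hev _ _ hm' φ) k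
    simp_rw [hfd] at h5
    have h6 := ih (n+1) _ hm'
    rw [h5, norm_mul, norm_mul, Complex.norm_I, one_mul, Complex.norm_real, hdot, Real.norm_eq_abs, abs_of_nonneg (nrm_nonneg k)] at h6
    rw [pow_succ, mul_assoc, show n + (l + 1) = n + 1 + l by ring]
    exact h6

lemma factorial_add_le (n l : ℕ) : ((n + l).factorial : ℝ) ≤ 2 ^ (n + l) * (n.factorial * l.factorial) := by
  have h1 := Nat.add_choose_mul_factorial_mul_factorial n l
  have h2 := Nat.choose_le_two_pow (n + l) l
  have h3 : (n + l).factorial ≤ 2 ^ (n + l) * (n.factorial * l.factorial) := by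
    rw [← h1, mul_assoc]
    exact Nat.mul_le_mul_right _ h2
  exact_mod_cast h3

lemma exp_decay {x A q R : ℝ} (hx : 0 ≤ x) (hA : 0 ≤ A) (hR : 0 < R) (h : ∀ l : ℕ, x ^ l * q ≤ l.factorial * (A * R ^ l)) :
    q ≤ 2 * A * Real.exp (-((2 * R)⁻¹ * x)) := by
  have h1 : HasSum (fun l : ℕ => ((2 * R)⁻¹ * x) ^ l / l.factorial * q) (Real.exp ((2 * R)⁻¹ * x) * q) := by
    have := NormedSpace.expSeries_div_hasSum_exp ((2 * R)⁻¹ * x)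
    rw [← Real.exp_eq_exp_ℝ] at this
    exact this.mul_right q
  have h2 : HasSum (fun l : ℕ => A * (1/2 : ℝ) ^ l) (A * 2) := hasSum_geometric_two.mul_left A
  have h3 : Real.exp ((2 * R)⁻¹ * x) * q ≤ A * 2 := by
    refine hasSum_le (fun l => ?_) h1 h2
    have := h l
    have hf : (0:ℝ) < l.factorial := by positivity
    calc ((2 * R)⁻¹ * x) ^ l / l.factorial * q = (2 * R)⁻¹ ^ l / l.factorial * (x ^ l * q) := by rw [mul_pow]; ring
      _ ≤ (2 * R)⁻¹ ^ l / l.factorial * (l.factorial * (A * R ^ l)) := by gcongr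
      _ = A * (1/2 : ℝ) ^ l := by
        rw [inv_pow, mul_pow, div_pow, one_pow]; field_simp
  rw [Real.exp_neg, ← div_eq_mul_inv, le_div_iff₀ (Real.exp_pos _)]
  linarith

theorem g_expansion (F : EE d → ℝ) (hF : AnalyticOnNhd ℝ F Set.univ) (hp : PerE F) :
    ∃ r C K ρ' : ℝ, 0 < r ∧ 0 < C ∧ 0 < K ∧ 0 < ρ' ∧
      (∀ n f k, ‖fc (gc F n f) k‖ ≤ C * K ^ n * Real.exp (-(ρ' * nrm k))) ∧
      (∀ φ n f, |gc F n f φ| ≤ C * K ^ n) ∧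
      (∀ φ z, ‖z‖ < r → HasSum (fun n => ∑ f : Fin n → Fin 3, gc F n f φ * ∏ j, zc z (f j)) (F (φ, z))) ∧
      ∀ n f φ, HasSum (fun k => fc (gc F n f) k * Complex.exp (Complex.I * (dotp k φ : ℝ))) ((gc F n f φ : ℝ) : ℂ) := by
  obtain ⟨r, C, R, hr, hC, hR, h⟩ := UB_torus F hF hp
  have hcd : ContDiff ℝ ⊤ F := hF.contDiff
  have hb : ∀ φ n, ‖iteratedFDeriv ℝ n F (φ, 0)‖ ≤ n.factorial * (C * R ^ n) := fun φ n => (h (φ, 0) rfl).1 n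
  have hfcm : ∀ n f k, fc (gc F n f) k = ((n.factorial : ℝ)⁻¹ : ℝ) * fc (fun φ => iteratedFDeriv ℝ n F (φ, 0) (fun j => eb (f j))) k := by
    intro n f k
    unfold fc gc
    rw [← integral_const_mul]
    congr 1
    funext x
    push_cast
    simp only [smul_eq_mul]
    ring
  have hdec : ∀ n f k, ‖fc (gc F n f) k‖ ≤ (2 * C) * (2 * R) ^ n * Real.exp (-((2 * (2 * R))⁻¹ * nrm k)) := by
    intro n f k
    have hn : (0:ℝ) < n.factorial := by positivity
    have := exp_decay (x := nrm k) (A := C * (2 * R) ^ n) (q := ‖fc (gc F n f) k‖) (R := 2 * R) (nrm_nonneg k) (by positivity) (by positivity) (by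
      intro l
      rw [hfcm, norm_mul, Complex.norm_real, Real.norm_eq_abs, abs_of_pos (inv_pos.2 hn)]
      have h1 := fc_iter_bd F hcd hp hb k l n (fun j => eb (f j)) (fun j => norm_eb_le _)
      have h2 := factorial_add_le n l
      have h3 : nrm k ^ l * ‖fc (fun φ => iteratedFDeriv ℝ n F (φ, 0) fun j => eb (f j)) k‖ ≤ 2 ^ (n + l) * (n.factorial * l.factorial) * (C * R ^ (n + l)) :=
        h1.trans (by gcongr)
      calc _ = (n.factorial : ℝ)⁻¹ * (nrm k ^ l * ‖fc (fun φ => iteratedFDeriv ℝ n F (φ, 0) fun j => eb (f j)) k‖) := by ring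
        _ ≤ (n.factorial : ℝ)⁻¹ * (2 ^ (n + l) * (n.factorial * l.factorial) * (C * R ^ (n + l))) := by gcongr
        _ = _ := by rw [mul_pow, mul_pow, pow_add, pow_add]; field_simp)
    calc _ ≤ _ := this
      _ = _ := by ring
  refine ⟨r, 2 * C, 2 * R, (2 * (2 * R))⁻¹, hr, by positivity, by positivity, by positivity, hdec, ?_, ?_, ?_⟩
  · intro φ n f
    have hn : (0:ℝ) < n.factorial := by positivity
    unfold gc
    rw [abs_mul, abs_of_pos (inv_pos.2 hn)]
    have h1 := (iteratedFDeriv ℝ n F (φ, 0)).le_opNorm (fun j => eb (f j))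
    have h2 : ∏ j : Fin n, ‖(eb (f j) : EE d)‖ ≤ 1 := Finset.prod_le_one (fun _ _ => norm_nonneg _) (fun i _ => norm_eb_le _)
    have h3 : |iteratedFDeriv ℝ n F (φ, 0) (fun j => eb (f j))| ≤ n.factorial * (C * R ^ n) := by
      refine h1.trans ?_
      calc _ ≤ ‖iteratedFDeriv ℝ n F (φ, 0)‖ * 1 := by gcongr
        _ ≤ _ := by rw [mul_one]; exact hb φ n
    calc _ ≤ (n.factorial : ℝ)⁻¹ * (n.factorial * (C * R ^ n)) := by gcongr
      _ = C * R ^ n := by field_simp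
      _ ≤ 2 * C * (2 * R) ^ n := by gcongr <;> linarith
  · intro φ z hz
    have h1 := (h (φ, 0) rfl).2 (0, z) (by rw [Prod.norm_mk, norm_zero]; exact max_lt hr hz)
    rw [show ((φ, 0) : EE d) + (0, z) = (φ, z) by simp] at h1
    convert h1 using 2 with n
    have hz2 : ((0, z) : EE d) = ∑ j : Fin 3, zc z j • eb j := by
      rw [Fin.sum_univ_three]
      simp [zc, eb]
    rw [hz2, ContinuousMultilinearMap.map_sum, smul_eq_mul, Finset.mul_sum]
    refine Finset.sum_congr rfl fun f _ => ?_
    rw [ContinuousMultilinearMap.map_smul_univ, smul_eq_mul]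
    unfold gc
    ring
  · intro n f φ
    refine fc_inversion _ ?_ ?_ ?_ φ
    · unfold gc
      have h1 : Continuous fun φ : Fin d → ℝ => iteratedFDeriv ℝ n F (φ, 0) :=
        (hcd.continuous_iteratedFDeriv (m := n) (by simp)).comp (by fun_prop)
      exact continuous_const.mul ((ContinuousMultilinearMap.apply ℝ (fun _ : Fin n => EE d) ℝ _).continuous.comp h1)
    · intro φ m
      unfold gc
      rw [per_iter hp]
    · refine Summable.of_nonneg_of_le (fun _ => norm_nonneg _) (fun k => hdec n f k) (Summable.mul_left _ ?_)
      exact summable_exp_nrm (by positivity) d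

lemma gc_zero (F : EE d → ℝ) (f : Fin 0 → Fin 3) (φ : Fin d → ℝ) : gc F 0 f φ = F (φ, 0) := by
  unfold gc; simp

lemma gc_one (F : EE d → ℝ) (hF : AnalyticOnNhd ℝ F Set.univ) (f : Fin 1 → Fin 3) (φ : Fin d → ℝ) :
    gc F 1 f φ = deriv (fun s : ℝ => F ((φ, 0) + s • eb (f 0))) 0 := by
  unfold gc
  rw [iteratedFDeriv_one_apply]
  have h1 : HasFDerivAt F (fderiv ℝ F (φ, 0)) ((φ, 0) + (0:ℝ) • eb (f 0)) := by
    simpa using (hF (φ, 0) trivial).differentiableAt.hasFDerivAt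
  have h2 : HasDerivAt (fun s : ℝ => (φ, 0) + s • (eb (f 0) : EE d)) (eb (f 0)) 0 := by
    simpa using ((hasDerivAt_id (0:ℝ)).smul_const (eb (f 0) : EE d)).const_add (φ, 0)
  have h3 := (h1.comp_hasDerivAt (0:ℝ) h2).deriv
  simp only [Function.comp_def] at h3
  rw [h3]; simp

end
end VdP

set_option linter.unusedSectionVars false
set_option linter.style.longLine false

namespace VdP
open scoped NNReal ENNReal
noncomputable section
open Filter Topology

section anal


lemma abs_dotp_le {d : ℕ} (k : Idx d) (y : Fin d → ℝ) : |dotp k y| ≤ nrm k * ‖y‖ := by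
  unfold dotp nrm
  rw [Finset.sum_mul]
  refine (Finset.abs_sum_le_sum_abs _ _).trans (Finset.sum_le_sum fun i _ => ?_)
  rw [abs_mul]
  exact mul_le_mul_of_nonneg_left (norm_le_pi_norm y i) (abs_nonneg _)

/-- `y ↦ i⟨k,y⟩`. -/
def Lk {d : ℕ} (k : Idx d) : (Fin d → ℝ) →L[ℝ] ℂ :=
  LinearMap.mkContinuous
    { toFun := fun y => Complex.I * (dotp k y : ℝ)
      map_add' := by
        intro x y; simp only [dotp, Pi.add_apply, mul_add, Finset.sum_add_distrib, Complex.ofReal_add]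
      map_smul' := by
        intro c x
        simp only [dotp, Pi.smul_apply, smul_eq_mul, RingHom.id_apply, Complex.real_smul]
        rw [mul_left_comm, ← Complex.ofReal_mul, Finset.mul_sum]
        congr 3
        funext i; ring }
    (nrm k) (by
      intro y
      change ‖Complex.I * ((dotp k y : ℝ) : ℂ)‖ ≤ _
      simpa using abs_dotp_le k y)

lemma Lk_apply {d : ℕ} (k : Idx d) (y : Fin d → ℝ) : Lk k y = Complex.I * (dotp k y : ℝ) := rfl

lemma norm_Lk_le {d : ℕ} (k : Idx d) : ‖Lk k‖ ≤ nrm k := LinearMap.mkContinuous_norm_le _ (nrm_nonneg k) _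

lemma trig_analytic {d : ℕ} {ρ : ℝ} (hρ : 0 < ρ) (a : Idx d → ℂ)
    (ha : Summable fun k => ‖a k‖ * Real.exp (ρ * nrm k)) (F : (Fin d → ℝ) → ℂ)
    (hF : ∀ φ, HasSum (fun k => a k * Complex.exp (Complex.I * (dotp k φ : ℝ))) (F φ)) :
    AnalyticOnNhd ℝ F Set.univ := by
  intro φ0 _
  set b : Idx d → ℂ := fun k => a k * Complex.exp (Complex.I * (dotp k φ0 : ℝ)) with hb
  have hbn : ∀ k, ‖b k‖ = ‖a k‖ := by
    intro k; rw [hb]; simp only [norm_mul, mul_comm Complex.I, Complex.norm_exp_ofReal_mul_I, mul_one]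
  set p : Idx d → (n : ℕ) → ContinuousMultilinearMap ℝ (fun _ : Fin n => Fin d → ℝ) ℂ := fun k n =>
    (b k * (((n.factorial : ℕ) : ℝ) : ℂ)⁻¹) • (ContinuousMultilinearMap.mkPiAlgebraFin ℝ n ℂ).compContinuousLinearMap (fun _ => Lk k) with hp
  have hpn : ∀ k n, ‖p k n‖ * ρ ^ n ≤ ‖a k‖ * Real.exp (ρ * nrm k) := by
    intro k n
    have h1 : ‖(ContinuousMultilinearMap.mkPiAlgebraFin ℝ n ℂ).compContinuousLinearMap (fun _ => Lk k)‖ ≤ nrm k ^ n := by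
      refine (ContinuousMultilinearMap.norm_compContinuousLinearMap_le _ _).trans ?_
      rw [ContinuousMultilinearMap.norm_mkPiAlgebraFin, one_mul]
      simp only [Finset.prod_const, Finset.card_univ, Fintype.card_fin]
      exact pow_le_pow_left₀ (norm_nonneg _) (norm_Lk_le k) n
    have h2 : ‖p k n‖ ≤ ‖a k‖ * ((n.factorial : ℕ) : ℝ)⁻¹ * nrm k ^ n := by
      simp only [hp, norm_smul, norm_mul, hbn, norm_inv, Complex.norm_real]
      rw [Real.norm_of_nonneg (by positivity : (0:ℝ) ≤ n.factorial)]
      exact mul_le_mul_of_nonneg_left h1 (by positivity)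
    have h3 := Real.pow_div_factorial_le_exp (ρ * nrm k) (mul_nonneg hρ.le (nrm_nonneg k)) n
    calc _ ≤ ‖a k‖ * ((n.factorial : ℕ) : ℝ)⁻¹ * nrm k ^ n * ρ ^ n := by gcongr
      _ = ‖a k‖ * ((ρ * nrm k) ^ n / n.factorial) := by rw [mul_pow]; field_simp
      _ ≤ _ := by gcongr
  have hpn' : ∀ k n, ‖p k n‖ ≤ (‖a k‖ * Real.exp (ρ * nrm k)) * (ρ ^ n)⁻¹ := by
    intro k n
    rw [← div_eq_mul_inv, le_div_iff₀ (by positivity)]; exact hpn k n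
  have hsum : ∀ n, Summable fun k => p k n := fun n =>
    Summable.of_norm_bounded (ha.mul_right _) (fun k => hpn' k n)
  set P : FormalMultilinearSeries ℝ (Fin d → ℝ) ℂ := fun n => ∑' k, p k n with hP
  have hPn : ∀ n, ‖P n‖ * ρ ^ n ≤ ∑' k, ‖a k‖ * Real.exp (ρ * nrm k) := by
    intro n
    rw [← le_div_iff₀ (by positivity), div_eq_mul_inv, ← tsum_mul_right]
    exact tsum_of_norm_bounded (ha.mul_right _).hasSum (fun k => hpn' k n)
  set r : ℝ≥0 := ⟨ρ, hρ.le⟩ with hr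
  have hball : HasFPowerSeriesOnBall F P φ0 r := by
    refine ⟨P.le_radius_of_bound _ hPn, ENNReal.coe_pos.2 hρ, ?_⟩
    intro y hy
    have hy' : ‖y‖ < ρ := by
      have h : ‖y‖ < (r : ℝ) := by simpa using hy
      exact h
    have happ : ∀ k n, p k n (fun _ => y) = b k * ((Lk k y) ^ n / ((n.factorial : ℕ) : ℂ)) := by
      intro k n
      simp only [hp, smul_apply, ContinuousMultilinearMap.compContinuousLinearMap_apply,
        ContinuousMultilinearMap.mkPiAlgebraFin_apply, List.ofFn_const, List.prod_replicate, smul_eq_mul]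
      push_cast; ring
    have hk : ∀ k, HasSum (fun n => p k n (fun _ => y)) (b k * Complex.exp (Lk k y)) := by
      intro k
      simp only [happ]
      refine HasSum.mul_left _ ?_
      have := NormedSpace.expSeries_div_hasSum_exp (Lk k y)
      rwa [← Complex.exp_eq_exp_ℂ] at this
    have hq : 0 ≤ ‖y‖ / ρ := by positivity
    have hq1 : ‖y‖ / ρ < 1 := (div_lt_one hρ).2 hy'
    have hbound : ∀ q : Idx d × ℕ, ‖p q.1 q.2 (fun _ => y)‖ ≤ (‖a q.1‖ * Real.exp (ρ * nrm q.1)) * (‖y‖ / ρ) ^ q.2 := by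
      rintro ⟨k, n⟩
      refine ((p k n).le_opNorm _).trans ?_
      simp only [Finset.prod_const, Finset.card_univ, Fintype.card_fin]
      calc _ ≤ (‖a k‖ * Real.exp (ρ * nrm k)) * (ρ ^ n)⁻¹ * ‖y‖ ^ n := by
            gcongr; exact hpn' k n
        _ = _ := by rw [div_pow]; ring
    have hS : Summable fun q : Idx d × ℕ => p q.1 q.2 (fun _ => y) := by
      refine Summable.of_norm_bounded ?_ hbound
      exact ha.mul_of_nonneg (summable_geometric_of_lt_one hq hq1) (fun _ => by positivity) (fun _ => by positivity)
    have h1 := hS.hasSum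
    have h2 := h1.prod_fiberwise hk
    have h3 : ∑' q : Idx d × ℕ, p q.1 q.2 (fun _ => y) = F (φ0 + y) := by
      refine h2.unique ?_
      refine (hF (φ0 + y)).congr_fun ?_
      intro k
      simp only [hb, Lk_apply]
      rw [mul_assoc, ← Complex.exp_add, ← mul_add, ← Complex.ofReal_add]
      simp only [dotp, Pi.add_apply, mul_add, Finset.sum_add_distrib]
    rw [h3] at h1
    have h4 := (Equiv.prodComm ℕ (Idx d)).hasSum_iff.2 h1
    refine h4.prod_fiberwise fun n => ?_
    exact (hsum n).hasSum.mapL (ContinuousMultilinearMap.apply ℝ (fun _ : Fin n => Fin d → ℝ) ℂ (fun _ => y))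
  exact ⟨P, r, hball⟩

end anal

section evs
variable {d : ℕ} {ρ : ℝ≥0} {B : Type} [NormedCommRing B] [NormedAlgebra ℝ B] [CompleteSpace B]

lemma chr_eq (φ : Fin d → ℝ) (k : Idx d) : chr ρ φ k =
   (Real.exp (-(ρ * nrm k)) : ℝ) * Complex.exp (Complex.I * (dotp k φ : ℝ)) := rfl

lemma ev_analytic (hρ : 0 < ρ) (χ : B →L[ℝ] ℂ) (u : Wal d ρ B) :
    AnalyticOnNhd ℝ (fun φ => ev χ φ u) Set.univ := by
  refine trig_analytic (ρ := ρ) hρ (fun k => (Real.exp (-(ρ * nrm k)) : ℝ) * χ (cf u k)) ?_ _ ?_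
  · refine Summable.of_nonneg_of_le (fun _ => by positivity) (fun k => ?_) ((summable_norm_cf u).mul_left ‖χ‖)
    rw [norm_mul, Complex.norm_real, Real.norm_of_nonneg (Real.exp_pos _).le, mul_assoc, mul_comm, mul_assoc,
      ← Real.exp_add]
    simp only [add_neg_cancel, Real.exp_zero, mul_one]
    exact χ.le_opNorm _
  · intro φ
    refine (ev_hasSum χ φ u).congr_fun fun k => ?_
    rw [chr_eq]; ring

lemma ev_per (χ : B →L[ℝ] ℂ) (u : Wal d ρ B) (φ : Fin d → ℝ) (m : Fin d → ℤ) :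
    ev χ (fun i => φ i + 2 * Real.pi * m i) u = ev χ φ u := by
  refine (ev_hasSum χ _ u).unique ((ev_hasSum χ φ u).congr_fun fun k => ?_)
  congr 1
  rw [chr_eq, chr_eq]
  congr 1
  rw [Complex.exp_eq_exp_iff_exists_int]
  refine ⟨∑ i, k i * m i, ?_⟩
  simp only [dotp]
  push_cast
  simp only [mul_add, Finset.sum_add_distrib, Finset.mul_sum, Finset.sum_mul]
  congr 1
  exact Finset.sum_congr rfl fun i _ => by ring

lemma norm_ev_le (χ : B →L[ℝ] ℂ) (φ : Fin d → ℝ) (u : Wal d ρ B) : ‖ev χ φ u‖ ≤ ‖χ‖ * ‖u‖ :=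
  (ev χ φ : Wal d ρ B →L[ℝ] ℂ).le_of_opNorm_le (norm_lift_le (norm_nonneg _) (ev_aux χ φ)) u

/-- Differentiation along the flow. -/
lemma ev_deriv (χ : B →L[ℝ] ℂ) (ω : Fin d → ℝ) (u v : Wal d ρ B)
    (h : ∀ k, χ (cf v k) = Complex.I * (dotp k ω : ℝ) * χ (cf u k)) (t : ℝ) :
    HasDerivAt (fun t : ℝ => ev χ (fun i => t * ω i) u) (ev χ (fun i => t * ω i) v) t := by
  have hd : ∀ (s : ℝ) (k : Idx d), dotp k (fun i => s * ω i) = s * dotp k ω := by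
    intro s k; simp only [dotp, Finset.mul_sum]; exact Finset.sum_congr rfl fun i _ => by ring
  have key : ∀ (k : Idx d) (s : ℝ), HasDerivAt (fun s : ℝ => chr ρ (fun i => s * ω i) k * χ (cf u k))
      (chr ρ (fun i => s * ω i) k * χ (cf v k)) s := by
    intro k s
    simp only [chr_eq, hd, h]
    have h1 : HasDerivAt (fun s : ℝ => ((s * dotp k ω : ℝ) : ℂ)) ((dotp k ω : ℝ) : ℂ) s := by
      simpa using ((hasDerivAt_id s).mul_const (dotp k ω)).ofReal_comp
    have h2 := (((h1.const_mul Complex.I).cexp).const_mul ((Real.exp (-(ρ * nrm k)) : ℝ) : ℂ)).mul_const (χ (cf u k))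
    refine h2.congr_deriv ?_
    ring
  have h5 := hasDerivAt_tsum ((summable_norm_cf v).mul_left ‖χ‖) key (fun k s => by
      rw [norm_mul]
      exact (mul_le_of_le_one_left (norm_nonneg _) (norm_chr_le _ _)).trans (χ.le_opNorm _))
      (ev_hasSum χ (fun i => t * ω i) u).summable t
  simpa only [(ev_hasSum χ _ _).tsum_eq] using h5

lemma ev_shift (χ : B →L[ℝ] ℂ) (ω : Fin d → ℝ) (u v : Wal d ρ B) (τ : ℝ)
    (h : ∀ k, χ (cf v k) = Complex.exp (-(Complex.I * (dotp k ω * τ : ℝ))) * χ (cf u k)) (t : ℝ) :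
    ev χ (fun i => (t - τ) * ω i) u = ev χ (fun i => t * ω i) v := by
  refine (ev_hasSum χ _ u).unique ((ev_hasSum χ _ v).congr_fun fun k => ?_)
  have hd : ∀ (s : ℝ) (k : Idx d), dotp k (fun i => s * ω i) = s * dotp k ω := by
    intro s k; simp only [dotp, Finset.mul_sum]; exact Finset.sum_congr rfl fun i _ => by ring
  rw [chr_eq, chr_eq, hd, hd, h, sub_mul, Complex.ofReal_sub, mul_sub, sub_eq_add_neg, Complex.exp_add,
    mul_comm τ]
  ring
end evs
end
end VdP

set_option linter.unusedSectionVars false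
set_option linter.style.longLine false

namespace VdP
open scoped NNReal ENNReal
noncomputable section
open Filter Topology

section nc
variable {A : Type} [NormedCommRing A] [NormedAlgebra ℝ A] [CompleteSpace A] [NormOneClass A]

/-- Bounded Lipschitz maps on the unit ball, compatible with the conjugation `s`. -/
structure Nc (s : A →L[ℝ] A) (C : ℝ) (N : A → A) : Prop where
  bd : ∀ y, ‖y‖ ≤ 1 → ‖N y‖ ≤ C
  lip : ∀ y y', ‖y‖ ≤ 1 → ‖y'‖ ≤ 1 → ‖N y - N y'‖ ≤ C * ‖y - y'‖
  inv : ∀ y, ‖y‖ ≤ 1 → s y = y → s (N y) = N y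

/-- Maps vanishing quadratically at the origin. -/
structure Qc (s : A →L[ℝ] A) (C : ℝ) (N : A → A) : Prop where
  zero : N 0 = 0
  lip : ∀ δ, 0 < δ → δ ≤ 1 → ∀ y y', ‖y‖ ≤ δ → ‖y'‖ ≤ δ → ‖N y - N y'‖ ≤ C * δ * ‖y - y'‖
  inv : ∀ y, ‖y‖ ≤ 1 → s y = y → s (N y) = N y

variable {s : A →L[ℝ] A} {C C' : ℝ} {N N' : A → A}

lemma Nc.nonneg (h : Nc s C N) : 0 ≤ C := (norm_nonneg _).trans (h.bd 0 (by simp))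

lemma Nc.mono (h : Nc s C N) (hC : C ≤ C') : Nc s C' N :=
  ⟨fun y hy => (h.bd y hy).trans hC, fun y y' hy hy' => (h.lip y y' hy hy').trans (by gcongr), h.inv⟩

lemma Nc.const {c : A} (hc : ‖c‖ ≤ C) (hs : s c = c) : Nc s C (fun _ => c) :=
  ⟨fun _ _ => hc, fun y y' _ _ => by
    have : 0 ≤ C := (norm_nonneg _).trans hc
    simp only [sub_self, norm_zero]; positivity, fun _ _ _ => hs⟩

lemma Nc.lin {T : A →L[ℝ] A} (hT : ∀ u, ‖T u‖ ≤ C * ‖u‖) (hC : 0 ≤ C) (hs : ∀ u, s (T u) = T (s u)) : Nc s C (fun y => T y) :=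
  ⟨fun y hy => (hT y).trans (mul_le_of_le_one_right hC hy), fun y y' _ _ => by rw [← map_sub]; exact hT _,
    fun y _ h => by rw [hs, h]⟩

lemma Nc.add (h : Nc s C N) (h' : Nc s C' N') : Nc s (C + C') (fun y => N y + N' y) :=
  ⟨fun y hy => (norm_add_le _ _).trans (add_le_add (h.bd y hy) (h'.bd y hy)),
   fun y y' hy hy' => by
    rw [add_sub_add_comm, add_mul]
    exact (norm_add_le _ _).trans (add_le_add (h.lip y y' hy hy') (h'.lip y y' hy hy')),
   fun y hy hs => by rw [map_add, h.inv y hy hs, h'.inv y hy hs]⟩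

lemma Nc.smul (h : Nc s C N) (c : ℝ) : Nc s (|c| * C) (fun y => c • N y) :=
  ⟨fun y hy => by rw [norm_smul, Real.norm_eq_abs]; exact mul_le_mul_of_nonneg_left (h.bd y hy) (abs_nonneg _),
   fun y y' hy hy' => by
    rw [← smul_sub, norm_smul, Real.norm_eq_abs, mul_assoc]; exact mul_le_mul_of_nonneg_left (h.lip y y' hy hy') (abs_nonneg _),
   fun y hy hs => by rw [map_smul, h.inv y hy hs]⟩

lemma mul_sub_mul' (a b a' b' : A) : a * b - a' * b' = (a - a') * b + a' * (b - b') := by ring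

lemma Nc.mul (hsm : ∀ u v, s (u * v) = s u * s v) (h : Nc s C N) (h' : Nc s C' N') :
    Nc s (2 * C * C') (fun y => N y * N' y) := by
  have h0 := h.nonneg
  have h0' := h'.nonneg
  refine ⟨fun y hy => ?_, fun y y' hy hy' => ?_, fun y hy hs => by rw [hsm, h.inv y hy hs, h'.inv y hy hs]⟩
  · refine (norm_mul_le _ _).trans ((mul_le_mul (h.bd y hy) (h'.bd y hy) (norm_nonneg _) h0).trans ?_)
    nlinarith [mul_nonneg h0 h0']
  · rw [mul_sub_mul']
    calc _ ≤ ‖N y - N y'‖ * ‖N' y‖ + ‖N y'‖ * ‖N' y - N' y'‖ :=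
          (norm_add_le _ _).trans (add_le_add (norm_mul_le _ _) (norm_mul_le _ _))
      _ ≤ (C * ‖y - y'‖) * C' + C * (C' * ‖y - y'‖) := by
          gcongr
          · exact h.lip y y' hy hy'
          · exact h'.bd y hy
          · exact h.bd y' hy'
          · exact h'.lip y y' hy hy'
      _ = _ := by ring

lemma Nc.prod (hsm : ∀ u v, s (u * v) = s u * s v) (hs1 : s 1 = 1) {ι : Type} (t : Finset ι) (M : ι → A → A)
    (h : ∀ i, Nc s C (M i)) : Nc s ((2 * C) ^ t.card) (fun y => ∏ i ∈ t, M i y) := by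
  classical
  induction t using Finset.induction_on with
  | empty => simpa using Nc.const (C := 1) (s := s) (c := (1:A)) (by simp) hs1
  | insert i t hi ih =>
    rw [Finset.card_insert_of_notMem hi]
    simp only [Finset.prod_insert hi]
    refine ((h i).mul hsm ih).mono (le_of_eq (by ring))

lemma Nc.sum {ι : Type} (t : Finset ι) (M : ι → A → A) (h : ∀ i, Nc s C (M i)) :
    Nc s (t.card * C) (fun y => ∑ i ∈ t, M i y) := by
  classical
  induction t using Finset.induction_on with
  | empty => simpa using Nc.const (C := 0) (s := s) (c := (0:A)) (by simp) (by simp)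
  | insert i t hi ih =>
    rw [Finset.card_insert_of_notMem hi]
    simp only [Finset.sum_insert hi]
    refine ((h i).add ih).mono (le_of_eq (by push_cast; ring))

lemma geo_half {K μ : ℝ} (hK : 0 ≤ K) (hμ : 0 < μ) (h : μ * K ≤ 1 / 2) (C1 : ℝ) :
    Summable (fun n : ℕ => C1 * (μ * K) ^ n) ∧ (0 ≤ C1 → ∑' n : ℕ, C1 * (μ * K) ^ n ≤ 2 * C1) := by
  have h0 : 0 ≤ μ * K := by positivity
  have h1 : μ * K < 1 := by linarith
  refine ⟨(summable_geometric_of_lt_one h0 h1).mul_left _, fun hC => ?_⟩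
  rw [tsum_mul_left, tsum_geometric_of_lt_one h0 h1, mul_comm]
  refine mul_le_mul_of_nonneg_right ?_ hC
  rw [inv_le_comm₀ (by linarith) (by norm_num)]; linarith

lemma Nc.summable {M : ℕ → A → A} {C1 K μ : ℝ} (h : ∀ n, Nc s (C1 * K ^ n) (M n)) (hK : 0 ≤ K) (hμ : 0 < μ)
    (hμK : μ * K ≤ 1 / 2) (y : A) (hy : ‖y‖ ≤ 1) : Summable (fun n => μ ^ n • M n y) := by
  refine Summable.of_norm_bounded (geo_half hK hμ hμK C1).1 fun n => ?_
  rw [norm_smul, norm_pow, Real.norm_of_nonneg hμ.le]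
  calc _ ≤ μ ^ n * (C1 * K ^ n) := by gcongr; exact (h n).bd y hy
    _ = _ := by rw [mul_pow]; ring

lemma Nc.tsum {M : ℕ → A → A} {C1 K μ : ℝ} (h : ∀ n, Nc s (C1 * K ^ n) (M n)) (hK : 0 ≤ K) (hμ : 0 < μ)
    (hμK : μ * K ≤ 1 / 2) : Nc s (2 * C1) (fun y => ∑' n, μ ^ n • M n y) := by
  have hC1 : 0 ≤ C1 := by simpa using (h 0).nonneg
  have hg := geo_half hK hμ hμK C1
  refine ⟨fun y hy => ?_, fun y y' hy hy' => ?_, fun y hy hs => ?_⟩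
  · refine le_trans (tsum_of_norm_bounded hg.1.hasSum fun n => ?_) (hg.2 hC1)
    rw [norm_smul, norm_pow, Real.norm_of_nonneg hμ.le]
    calc _ ≤ μ ^ n * (C1 * K ^ n) := by gcongr; exact (h n).bd y hy
      _ = _ := by rw [mul_pow]; ring
  · rw [← (Nc.summable h hK hμ hμK y hy).tsum_sub (Nc.summable h hK hμ hμK y' hy')]
    refine le_trans (tsum_of_norm_bounded (hg.1.mul_right ‖y - y'‖).hasSum fun n => ?_) ?_
    · rw [← smul_sub, norm_smul, norm_pow, Real.norm_of_nonneg hμ.le]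
      calc _ ≤ μ ^ n * (C1 * K ^ n * ‖y - y'‖) := by gcongr; exact (h n).lip y y' hy hy'
        _ = _ := by rw [mul_pow]; ring
    · rw [tsum_mul_right]; gcongr; exact hg.2 hC1
  · rw [s.map_tsum (Nc.summable h hK hμ hμK y hy)]
    simp only [map_smul, (h _).inv y hy hs]

lemma Qc.mono (h : Qc s C N) (hC : C ≤ C') : Qc s C' N :=
  ⟨h.zero, fun δ h0 h1 y y' hy hy' => (h.lip δ h0 h1 y y' hy hy').trans (by gcongr), h.inv⟩

lemma Qc.add (h : Qc s C N) (h' : Qc s C' N') : Qc s (C + C') (fun y => N y + N' y) :=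
  ⟨by simp only [h.zero, h'.zero, add_zero],
   fun δ h0 h1 y y' hy hy' => by
    rw [add_sub_add_comm, add_mul, add_mul]
    exact (norm_add_le _ _).trans (add_le_add (h.lip δ h0 h1 y y' hy hy') (h'.lip δ h0 h1 y y' hy hy')),
   fun y hy hs => by rw [map_add, h.inv y hy hs, h'.inv y hy hs]⟩

/-- `Nc` maps vanishing at zero multiply to quadratic maps. -/
lemma Qc.of_mul (hsm : ∀ u v, s (u * v) = s u * s v) (h : Nc s C N) (h' : Nc s C' N') (h0 : N 0 = 0) (h0' : N' 0 = 0) :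
    Qc s (2 * C * C') (fun y => N y * N' y) := by
  have hc := h.nonneg
  have hc' := h'.nonneg
  refine ⟨by simp only [h0, zero_mul], fun δ hδ hδ1 y y' hy hy' => ?_, fun y hy hs => by rw [hsm, h.inv y hy hs, h'.inv y hy hs]⟩
  have b : ∀ y, ‖y‖ ≤ δ → ‖N y‖ ≤ C * δ := fun y hy => by
    have := h.lip y 0 (hy.trans hδ1) (by simp)
    rw [h0, sub_zero, sub_zero] at this
    exact this.trans (by gcongr)
  have b' : ∀ y, ‖y‖ ≤ δ → ‖N' y‖ ≤ C' * δ := fun y hy => by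
    have := h'.lip y 0 (hy.trans hδ1) (by simp)
    rw [h0', sub_zero, sub_zero] at this
    exact this.trans (by gcongr)
  rw [mul_sub_mul']
  calc _ ≤ ‖N y - N y'‖ * ‖N' y‖ + ‖N y'‖ * ‖N' y - N' y'‖ :=
        (norm_add_le _ _).trans (add_le_add (norm_mul_le _ _) (norm_mul_le _ _))
    _ ≤ (C * ‖y - y'‖) * (C' * δ) + (C * δ) * (C' * ‖y - y'‖) := by
        gcongr
        · exact h.lip y y' (hy.trans hδ1) (hy'.trans hδ1)
        · exact b' y hy
        · exact b y' hy'
        · exact h'.lip y y' (hy.trans hδ1) (hy'.trans hδ1)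
    _ = _ := by ring

end nc
end
end VdP

set_option linter.unusedSectionVars false
set_option linter.style.longLine false

namespace VdP
open scoped NNReal ENNReal
noncomputable section
open Filter Topology

/-- The parameter set with the discrete topology. -/
def Pt (Pa : Set ℝ) : Type := Pa
instance (Pa : Set ℝ) : TopologicalSpace (Pt Pa) := ⊥
instance (Pa : Set ℝ) : DiscreteTopology (Pt Pa) := ⟨rfl⟩

/-- Bounded functions of the parameter. -/
abbrev Bf (Pa : Set ℝ) : Type := BoundedContinuousFunction (Pt Pa) ℂ

section bf
variable {Pa : Set ℝ}

open Classical in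
/-- Bounded function from a formula. -/
def mkB (Pa : Set ℝ) (F : ℝ → ℂ) : Bf Pa :=
  if h : ∃ C, ∀ a : Pt Pa, ‖F a.1‖ ≤ C then
    BoundedContinuousFunction.ofNormedAddCommGroupDiscrete (fun a : Pt Pa => F a.1) h.choose h.choose_spec
  else 0

lemma mkB_apply {F : ℝ → ℂ} {C : ℝ} (h : ∀ a ∈ Pa, ‖F a‖ ≤ C) (a : Pt Pa) : mkB Pa F a = F a.1 := by
  unfold mkB; rw [dif_pos ⟨C, fun a => h a.1 a.2⟩]; rfl

lemma norm_mkB_le {F : ℝ → ℂ} {C : ℝ} (hC : 0 ≤ C) (h : ∀ a ∈ Pa, ‖F a‖ ≤ C) : ‖mkB Pa F‖ ≤ C := by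
  refine (BoundedContinuousFunction.norm_le hC).2 fun a => ?_
  rw [mkB_apply h]; exact h _ a.2

/-- Evaluation at a parameter. -/
def chi (a : Pt Pa) : Bf Pa →L[ℝ] ℂ := BoundedContinuousFunction.evalCLM ℝ a

lemma chi_apply (a : Pt Pa) (x : Bf Pa) : chi a x = x a := rfl
lemma chi_mul (a : Pt Pa) (x y : Bf Pa) : chi a (x * y) = chi a x * chi a y := rfl
lemma chi_star (a : Pt Pa) (x : Bf Pa) : chi a (star x) = (starRingEnd ℂ) (chi a x) := rfl
lemma chi_one (a : Pt Pa) : chi a (1 : Bf Pa) = 1 := rfl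
lemma norm_chi_le (a : Pt Pa) : ‖(chi a : Bf Pa →L[ℝ] ℂ)‖ ≤ 1 :=
  ContinuousLinearMap.opNorm_le_bound _ zero_le_one fun x => by
    rw [one_mul, chi_apply]; exact x.norm_coe_le_norm a

lemma bf_ext {x y : Bf Pa} (h : ∀ a, chi a x = chi a y) : x = y := BoundedContinuousFunction.ext h

/-- Constants. -/
def cB (Pa : Set ℝ) (z : ℂ) : Bf Pa := mkB Pa fun _ => z
lemma chi_cB (a : Pt Pa) (z : ℂ) : chi a (cB Pa z) = z := mkB_apply (C := ‖z‖) (fun _ _ => le_rfl) a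
lemma norm_cB_le (z : ℂ) : ‖cB Pa z‖ ≤ ‖z‖ := norm_mkB_le (norm_nonneg _) fun _ _ => le_rfl
lemma star_cB (z : ℂ) : star (cB Pa z) = cB Pa ((starRingEnd ℂ) z) := bf_ext fun a => by
  rw [chi_star, chi_cB, chi_cB]

variable {d : ℕ} {ρ : ℝ≥0}

instance instNOC [Nonempty (Pt Pa)] : NormOneClass (Bf Pa) := inferInstance

/-- Extensionality through coefficients and parameters. -/
lemma wal_ext {u v : Wal d ρ (Bf Pa)} (h : ∀ k a, chi a (cf u k) = chi a (cf v k)) : u = v :=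
  cf_ext fun k => bf_ext (h k)

lemma ev_norm_le_one (a : Pt Pa) (φ : Fin d → ℝ) (u : Wal d ρ (Bf Pa)) : ‖ev (chi a) φ u‖ ≤ ‖u‖ :=
  (norm_ev_le _ _ _).trans (mul_le_of_le_one_left (norm_nonneg _) (norm_chi_le a))

lemma ev_real (a : Pt Pa) (φ : Fin d → ℝ) {u : Wal d ρ (Bf Pa)} (h : sg u = u) :
    ((ev (chi a) φ u).re : ℂ) = ev (chi a) φ u := by
  have := ev_sg (chi a) (chi_star a) φ u
  rw [h] at this
  exact (Complex.conj_eq_iff_re.1 this.symm)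

open Classical in
/-- Embedding of an exponentially decaying family of Fourier coefficients. -/
def gW (Pa : Set ℝ) (ρ : ℝ≥0) (c : Idx d → ℂ) : Wal d ρ (Bf Pa) :=
  if h : Summable (fun k => ‖cB Pa (c k * (Real.exp (ρ * nrm k) : ℝ))‖) then
    mkW (fun k => cB Pa (c k * (Real.exp (ρ * nrm k) : ℝ))) h else 0

/-- The constant in the embedding. -/
def Sd (d : ℕ) (δ : ℝ) : ℝ := ∑' k : Idx d, Real.exp (-(δ * nrm k))

lemma Sd_nonneg (d : ℕ) (δ : ℝ) : 0 ≤ Sd d δ := tsum_nonneg fun _ => (Real.exp_pos _).le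

section gw
variable {c : Idx d → ℂ} {C ρ' : ℝ}

lemma gW_term (hρ : (ρ : ℝ) < ρ') (hc : ∀ k, ‖c k‖ ≤ C * Real.exp (-(ρ' * nrm k))) (k : Idx d) : ‖cB Pa (c k * (Real.exp (ρ * nrm k) : ℝ))‖ ≤ C * Real.exp (-((ρ' - ρ) * nrm k)) := by
  refine (norm_cB_le _).trans ?_
  rw [norm_mul, Complex.norm_real, Real.norm_of_nonneg (Real.exp_pos _).le]
  calc _ ≤ C * Real.exp (-(ρ' * nrm k)) * Real.exp (ρ * nrm k) := by gcongr; exact hc k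
    _ = _ := by rw [mul_assoc, ← Real.exp_add]; congr 2; ring

lemma gW_summable (hρ : (ρ : ℝ) < ρ') (hc : ∀ k, ‖c k‖ ≤ C * Real.exp (-(ρ' * nrm k))) : Summable (fun k => ‖cB Pa (c k * (Real.exp (ρ * nrm k) : ℝ))‖) :=
  Summable.of_nonneg_of_le (fun _ => norm_nonneg _) (gW_term hρ hc)
    ((summable_exp_nrm (sub_pos.2 hρ) d).mul_left C)

lemma cf_gW (hρ : (ρ : ℝ) < ρ') (hc : ∀ k, ‖c k‖ ≤ C * Real.exp (-(ρ' * nrm k))) (k : Idx d) : cf (gW Pa ρ c) k = cB Pa (c k * (Real.exp (ρ * nrm k) : ℝ)) := by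
  unfold gW; rw [dif_pos (gW_summable hρ hc), cf_mkW]

lemma norm_gW_le (hρ : (ρ : ℝ) < ρ') (hc : ∀ k, ‖c k‖ ≤ C * Real.exp (-(ρ' * nrm k))) : ‖gW Pa ρ c‖ ≤ C * Sd d (ρ' - ρ) := by
  rw [norm_eq_tsum, Sd, ← tsum_mul_left]
  refine Summable.tsum_le_tsum (fun k => ?_) (summable_norm_cf _) ((summable_exp_nrm (sub_pos.2 hρ) d).mul_left C)
  rw [cf_gW hρ hc]; exact gW_term hρ hc k

lemma sg_gW (hρ : (ρ : ℝ) < ρ') (hc : ∀ k, ‖c k‖ ≤ C * Real.exp (-(ρ' * nrm k))) (hr : ∀ k, c (-k) = (starRingEnd ℂ) (c k)) : sg (gW Pa ρ c) = gW Pa ρ c := by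
  refine cf_ext fun k => ?_
  rw [cf_sg, cf_gW hρ hc, cf_gW hρ hc, star_cB, map_mul, hr, Complex.conj_conj, Complex.conj_ofReal, nrm_neg]

lemma ev_gW (hρ : (ρ : ℝ) < ρ') (hc : ∀ k, ‖c k‖ ≤ C * Real.exp (-(ρ' * nrm k))) (a : Pt Pa) (φ : Fin d → ℝ) {z : ℂ}
    (hz : HasSum (fun k => c k * Complex.exp (Complex.I * (dotp k φ : ℝ))) z) : ev (chi a) φ (gW Pa ρ c) = z := by
  refine (ev_hasSum (chi a) φ _).unique (hz.congr_fun fun k => ?_)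
  rw [cf_gW hρ hc, chi_cB, chr_eq]
  have : ((Real.exp (-(ρ * nrm k)) : ℝ) : ℂ) * ((Real.exp (ρ * nrm k) : ℝ) : ℂ) = 1 := by
    rw [← Complex.ofReal_mul, ← Real.exp_add]; simp
  linear_combination (c k * Complex.exp (Complex.I * (dotp k φ : ℝ))) * this
end gw

/-- Homogeneous terms of the forcing. -/
def Hn (F : EE d → ℝ) (n : ℕ) (w : Fin 3 → Wal d ρ (Bf Pa)) : Wal d ρ (Bf Pa) :=
  ∑ f : Fin n → Fin 3, gW Pa ρ (fc (gc F n f)) * ∏ j, w (f j)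

lemma ev_prod {ι : Type} (a : Pt Pa) (φ : Fin d → ℝ) (t : Finset ι) (w : ι → Wal d ρ (Bf Pa)) :
    ev (chi a) φ (∏ i ∈ t, w i) = ∏ i ∈ t, ev (chi a) φ (w i) := by
  classical
  induction t using Finset.induction_on with
  | empty => simpa using ev_one (chi a) (chi_one a) φ
  | insert i t hi ih => rw [Finset.prod_insert hi, Finset.prod_insert hi, ev_mul _ (chi_mul a), ih]

section hn
variable {F : EE d → ℝ} {C K ρ' : ℝ}

lemma sg_gWF (hρ : (ρ : ℝ) < ρ')
    (hc : ∀ n f k, ‖fc (gc F n f) k‖ ≤ C * K ^ n * Real.exp (-(ρ' * nrm k))) (n : ℕ) (f : Fin n → Fin 3) : sg (gW Pa ρ (fc (gc F n f))) = gW Pa ρ (fc (gc F n f)) :=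
  sg_gW hρ (hc n f) (fun k => fc_neg _ k)

lemma Hn_Nc (hρ : (ρ : ℝ) < ρ')
    (hc : ∀ n f k, ‖fc (gc F n f) k‖ ≤ C * K ^ n * Real.exp (-(ρ' * nrm k))) [Nonempty (Pt Pa)] {Cw : ℝ} (w : Fin 3 → Wal d ρ (Bf Pa) → Wal d ρ (Bf Pa)) (hw : ∀ j, Nc sg Cw (w j)) (n : ℕ) :
    Nc sg (2 * (C * Sd d (ρ' - ρ)) * (6 * K * Cw) ^ n) (fun y => Hn F n (fun j => w j y)) := by
  have h1 : ∀ f : Fin n → Fin 3, Nc sg (2 * (C * K ^ n * Sd d (ρ' - ρ)) * (2 * Cw) ^ n)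
      (fun y => gW Pa ρ (fc (gc F n f)) * ∏ j, w (f j) y) := by
    intro f
    have := (Nc.const (s := sg) (norm_gW_le (Pa := Pa) hρ (hc n f)) (sg_gWF hρ hc n f)).mul sg_mul
      (Nc.prod sg_mul sg_one Finset.univ (fun j : Fin n => w (f j)) (fun j => hw (f j)))
    simpa using this
  have h2 := Nc.sum Finset.univ (fun (f : Fin n → Fin 3) y => gW Pa ρ (fc (gc F n f)) * ∏ j, w (f j) y) h1
  refine h2.mono (le_of_eq ?_)
  simp only [Finset.card_univ, Fintype.card_pi, Fintype.card_fin, Finset.prod_const]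
  push_cast
  rw [show 6 * K * Cw = 3 * K * (2 * Cw) by ring, mul_pow, mul_pow]; ring


lemma ev_Hn (hρ : (ρ : ℝ) < ρ')
    (hc : ∀ n f k, ‖fc (gc F n f) k‖ ≤ C * K ^ n * Real.exp (-(ρ' * nrm k)))
    (hh : ∀ n f φ, HasSum (fun k => fc (gc F n f) k * Complex.exp (Complex.I * (dotp k φ : ℝ))) ((gc F n f φ : ℝ) : ℂ)) (a : Pt Pa) (φ : Fin d → ℝ) (n : ℕ) (w : Fin 3 → Wal d ρ (Bf Pa)) :
    ev (chi a) φ (Hn F n w) = ∑ f : Fin n → Fin 3, (gc F n f φ : ℂ) * ∏ j, ev (chi a) φ (w (f j)) := by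
  unfold Hn
  rw [map_sum]
  refine Finset.sum_congr rfl fun f _ => ?_
  rw [ev_mul _ (chi_mul a), ev_gW hρ (hc n f) a φ (hh n f φ), ev_prod]

lemma ev_TH (hρ : (ρ : ℝ) < ρ')
    (hc : ∀ n f k, ‖fc (gc F n f) k‖ ≤ C * K ^ n * Real.exp (-(ρ' * nrm k)))
    (hh : ∀ n f φ, HasSum (fun k => fc (gc F n f) k * Complex.exp (Complex.I * (dotp k φ : ℝ))) ((gc F n f φ : ℝ) : ℂ)) {r : ℝ} (hsum : ∀ φ z, ‖z‖ < r → HasSum (fun n => ∑ f : Fin n → Fin 3, gc F n f φ * ∏ j, zc z (f j)) (F (φ, z)))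
    (a : Pt Pa) (φ : Fin d → ℝ) (w : Fin 3 → Wal d ρ (Bf Pa)) (e : Fin 3 → ℝ) (he : ∀ j, ev (chi a) φ (w j) = (e j : ℂ))
    {μ : ℝ} (hr : ‖(μ * e 0, μ * e 1, μ * e 2)‖ < r) (hS : Summable fun n => μ ^ n • Hn F n w) :
    ev (chi a) φ (∑' n, μ ^ n • Hn F n w) = (F (φ, (μ * e 0, μ * e 1, μ * e 2)) : ℂ) := by
  have h1 := hS.hasSum.mapL (ev (chi a) φ)
  refine h1.unique ?_
  have h2 := (Complex.hasSum_ofReal).2 (hsum φ _ hr)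
  refine h2.congr_fun fun n => ?_
  rw [map_smul, ev_Hn hρ hc hh, Complex.real_smul, Finset.mul_sum]
  push_cast
  refine Finset.sum_congr rfl fun f _ => ?_
  have hz : ∀ j : Fin 3, zc (μ * e 0, μ * e 1, μ * e 2) j = μ * e j := by
    intro j; fin_cases j <;> simp [zc]
  simp only [hz, he, Complex.ofReal_mul, Finset.prod_mul_distrib, Finset.prod_const, Finset.card_univ, Fintype.card_fin]
  ring
end hn

section fs
variable {f : ℝ → ℝ}

/-- Taylor coefficients of `f`. -/
def fco (f : ℝ → ℝ) (n : ℕ) : ℝ := iteratedDeriv n f 0 / n.factorial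

lemma f_expansion (hf : AnalyticAt ℝ f 0) : ∃ r C K : ℝ, 0 < r ∧ 0 < C ∧ 0 < K ∧ (∀ n, |fco f n| ≤ C * K ^ n) ∧
    ∀ x, |x| < r → HasSum (fun n => fco f n * x ^ n) (f x) := by
  have h1 := hf.hasFPowerSeriesAt
  obtain ⟨R, hR⟩ := h1
  obtain ⟨r, hr0, hrR⟩ := ENNReal.lt_iff_exists_nnreal_btwn.1 hR.r_pos
  have hr0' : 0 < r := by exact_mod_cast hr0
  have hball := hR.mono hr0 hrR.le
  obtain ⟨C, hC, hCb⟩ := (FormalMultilinearSeries.ofScalars ℝ fun n => iteratedDeriv n f 0 / n.factorial).norm_mul_pow_le_of_lt_radius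
    (lt_of_lt_of_le hrR hR.r_le)
  refine ⟨r, C, (r : ℝ)⁻¹, hr0', hC, by positivity, fun n => ?_, fun x hx => ?_⟩
  · have := hCb n
    rw [FormalMultilinearSeries.ofScalars_norm] at this
    rw [inv_pow, ← div_eq_mul_inv, le_div_iff₀ (by positivity)]
    exact this
  · have hx' : x ∈ Metric.eball (0:ℝ) r := by
      simpa using hx
    have := hball.hasSum hx'
    simp only [zero_add] at this
    refine this.congr_fun fun n => ?_
    rw [FormalMultilinearSeries.ofScalars_apply_eq]
    simp [fco]

lemma fn_Nc [Nonempty (Pt Pa)] {C K Cw : ℝ} (hC : ∀ n, |fco f n| ≤ C * K ^ n) (w : Wal d ρ (Bf Pa) → Wal d ρ (Bf Pa)) (hw : Nc sg Cw w) (n : ℕ) :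
    Nc sg (C * (K * (2 * Cw)) ^ n) (fun y => fco f n • (w y) ^ n) := by
  have h1 := (Nc.prod sg_mul sg_one (Finset.univ : Finset (Fin n)) (fun _ => w) (fun _ => hw))
  simp only [Finset.prod_const, Finset.card_univ, Fintype.card_fin] at h1
  have h0 := hw.nonneg
  refine (h1.smul (fco f n)).mono ?_
  calc _ ≤ C * K ^ n * (2 * Cw) ^ n := by gcongr; exact hC n
    _ = _ := by rw [mul_pow K]; ring

lemma ev_pow (a : Pt Pa) (φ : Fin d → ℝ) (w : Wal d ρ (Bf Pa)) (n : ℕ) : ev (chi a) φ (w ^ n) = (ev (chi a) φ w) ^ n := by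
  induction n with
  | zero => simpa using ev_one (chi a) (chi_one a) φ
  | succ n ih => rw [pow_succ, ev_mul _ (chi_mul a), ih, pow_succ]

lemma ev_Tf {r : ℝ} (hsum : ∀ x, |x| < r → HasSum (fun n => fco f n * x ^ n) (f x))
    (a : Pt Pa) (φ : Fin d → ℝ) (w : Wal d ρ (Bf Pa)) (e : ℝ) (he : ev (chi a) φ w = (e : ℂ))
    {μ : ℝ} (hr : |μ * e| < r) (hS : Summable fun n => μ ^ n • (fco f n • w ^ n)) :
    ev (chi a) φ (∑' n, μ ^ n • (fco f n • w ^ n)) = (f (μ * e) : ℂ) := by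
  have h1 := hS.hasSum.mapL (ev (chi a) φ)
  refine h1.unique ?_
  have h2 := (Complex.hasSum_ofReal).2 (hsum _ hr)
  refine h2.congr_fun fun n => ?_
  rw [map_smul, map_smul, ev_pow, he, Complex.real_smul, Complex.real_smul]
  push_cast; ring
end fs

end bf
end
end VdP

set_option linter.unusedSectionVars false
set_option linter.style.longLine false

namespace VdP
open scoped NNReal ENNReal
noncomputable section
open Filter Topology

section sys
variable {Pa : Set ℝ} {d : ℕ} {ρ : ℝ≥0} {ω : Fin d → ℝ}

/-- Symbol as a family of bounded functions. -/
def sy (Pa : Set ℝ) (ω : Fin d → ℝ) (M : ℝ → ℝ → ℂ) (k : Idx d) : Bf Pa := mkB Pa (fun a => M a (dotp k ω))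

lemma dotp_neg (k : Idx d) : dotp (-k) ω = - dotp k ω := by simp [dotp]
lemma dotp_add (k l : Idx d) : dotp (k + l) ω = dotp k ω + dotp l ω := by
  simp [dotp, add_mul, Finset.sum_add_distrib]
lemma dotp_zero : dotp (0 : Idx d) ω = 0 := by simp [dotp]

variable {M : ℝ → ℝ → ℂ} {C : ℝ}

lemma chi_sy (h : ∀ a ∈ Pa, ∀ Ω, ‖M a Ω‖ ≤ C) (a : Pt Pa) (k : Idx d) : chi a (sy Pa ω M k) = M a.1 (dotp k ω) :=
  mkB_apply (fun a ha => h a ha _) a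

lemma norm_sy_le (hC : 0 ≤ C) (h : ∀ a ∈ Pa, ∀ Ω, ‖M a Ω‖ ≤ C) (k : Idx d) : ‖sy Pa ω M k‖ ≤ C :=
  norm_mkB_le hC (fun a ha => h a ha _)

lemma sy_neg (h : ∀ a ∈ Pa, ∀ Ω, ‖M a Ω‖ ≤ C) (hM : ∀ a ∈ Pa, ∀ Ω, M a (-Ω) = (starRingEnd ℂ) (M a Ω)) (k : Idx d) :
    sy Pa ω M (-k) = star (sy Pa ω M k) := bf_ext fun a => by
  rw [chi_star, chi_sy h, chi_sy h, dotp_neg, hM _ a.2]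

lemma chi_mult (hC : 0 ≤ C) (h : ∀ a ∈ Pa, ∀ Ω, ‖M a Ω‖ ≤ C) (u : Wal d ρ (Bf Pa)) (a : Pt Pa) (k : Idx d) :
    chi a (cf (mult (sy Pa ω M) u) k) = M a.1 (dotp k ω) * chi a (cf u k) := by
  rw [cf_mult (norm_sy_le hC h), chi_mul, chi_sy h]

/-- Smoothing symbol. -/
def sJ (_a Ω : ℝ) : ℂ := (((1 + Ω ^ 2)⁻¹ : ℝ) : ℂ)
/-- First derivative of the smoothing symbol. -/
def sJ1 (_a Ω : ℝ) : ℂ := Complex.I * (Ω : ℂ) * (((1 + Ω ^ 2)⁻¹ : ℝ) : ℂ)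
/-- Second derivative of the smoothing symbol. -/
def sJ2 (_a Ω : ℝ) : ℂ := -((Ω ^ 2 : ℝ) : ℂ) * (((1 + Ω ^ 2)⁻¹ : ℝ) : ℂ)
/-- Delayed smoothing symbol. -/
def sS (a Ω : ℝ) : ℂ := Complex.exp (-(Complex.I * (Ω * tau0 a : ℝ))) * (((1 + Ω ^ 2)⁻¹ : ℝ) : ℂ)

lemma inv_aux (Ω : ℝ) : ‖(((1 + Ω ^ 2)⁻¹ : ℝ) : ℂ)‖ = (1 + Ω ^ 2)⁻¹ := by
  rw [Complex.norm_real, Real.norm_of_nonneg (by positivity)]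

lemma sJ_le (a Ω : ℝ) : ‖sJ a Ω‖ ≤ 1 := by
  rw [sJ, inv_aux]; exact inv_le_one_of_one_le₀ (by nlinarith [sq_nonneg Ω])
lemma sJ1_le (a Ω : ℝ) : ‖sJ1 a Ω‖ ≤ 1 := by
  rw [sJ1, norm_mul, inv_aux, norm_mul, Complex.norm_I, one_mul, Complex.norm_real, Real.norm_eq_abs, ← div_eq_mul_inv,
    div_le_one (by positivity)]
  nlinarith [sq_abs Ω, sq_nonneg (|Ω| - 1)]
lemma sJ2_le (a Ω : ℝ) : ‖sJ2 a Ω‖ ≤ 1 := by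
  rw [sJ2, norm_mul, inv_aux, norm_neg, Complex.norm_real, Real.norm_of_nonneg (by positivity), ← div_eq_mul_inv,
    div_le_one (by positivity)]
  linarith
lemma sS_le (a Ω : ℝ) : ‖sS a Ω‖ ≤ 1 := by
  rw [sS, norm_mul, inv_aux, norm_expI, one_mul]; exact inv_le_one_of_one_le₀ (by nlinarith [sq_nonneg Ω])

lemma sJ_neg (a Ω : ℝ) : sJ a (-Ω) = (starRingEnd ℂ) (sJ a Ω) := by simp [sJ]
lemma sJ1_neg (a Ω : ℝ) : sJ1 a (-Ω) = (starRingEnd ℂ) (sJ1 a Ω) := by simp [sJ1]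
lemma sJ2_neg (a Ω : ℝ) : sJ2 a (-Ω) = (starRingEnd ℂ) (sJ2 a Ω) := by simp [sJ2]
lemma sS_neg (a Ω : ℝ) : sS a (-Ω) = (starRingEnd ℂ) (sS a Ω) := by
  unfold sS; rw [map_mul, ← Complex.exp_conj]; simp

lemma sym_rel (a Ω : ℝ) : sJ2 a Ω - a * sJ1 a Ω + sJ a Ω - sS a Ω = Lsym a (tau0 a) Ω * (((1 + Ω ^ 2)⁻¹ : ℝ) : ℂ) := by
  unfold sJ2 sJ1 sJ sS Lsym; push_cast; ring

lemma sym_relq (α β ζ a Ω : ℝ) : α * sJ a Ω + β * sS a Ω - ζ * (a * sJ1 a Ω) = qsym α β ζ a (tau0 a) Ω * (((1 + Ω ^ 2)⁻¹ : ℝ) : ℂ) := by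
  unfold sJ1 sJ sS qsym; push_cast; ring

/-- The parameter as an element of the algebra. -/
def aW (Pa : Set ℝ) : Wal d ρ (Bf Pa) := cst (mkB Pa fun a => (a : ℂ))

/-- The operators. -/
def JW (Pa : Set ℝ) (ω : Fin d → ℝ) : Wal d ρ (Bf Pa) →L[ℝ] Wal d ρ (Bf Pa) := mult (sy Pa ω sJ)
/-- First derivative. -/
def J1W (Pa : Set ℝ) (ω : Fin d → ℝ) : Wal d ρ (Bf Pa) →L[ℝ] Wal d ρ (Bf Pa) := mult (sy Pa ω sJ1)
/-- Second derivative. -/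
def J2W (Pa : Set ℝ) (ω : Fin d → ℝ) : Wal d ρ (Bf Pa) →L[ℝ] Wal d ρ (Bf Pa) := mult (sy Pa ω sJ2)
/-- Delay. -/
def SW (Pa : Set ℝ) (ω : Fin d → ℝ) : Wal d ρ (Bf Pa) →L[ℝ] Wal d ρ (Bf Pa) := mult (sy Pa ω sS)

lemma chi_JW (u : Wal d ρ (Bf Pa)) (a : Pt Pa) (k : Idx d) : chi a (cf (JW Pa ω u) k) = sJ a.1 (dotp k ω) * chi a (cf u k) :=
  chi_mult zero_le_one (fun a _ Ω => sJ_le a Ω) u a k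
lemma chi_J1W (u : Wal d ρ (Bf Pa)) (a : Pt Pa) (k : Idx d) : chi a (cf (J1W Pa ω u) k) = sJ1 a.1 (dotp k ω) * chi a (cf u k) :=
  chi_mult zero_le_one (fun a _ Ω => sJ1_le a Ω) u a k
lemma chi_J2W (u : Wal d ρ (Bf Pa)) (a : Pt Pa) (k : Idx d) : chi a (cf (J2W Pa ω u) k) = sJ2 a.1 (dotp k ω) * chi a (cf u k) :=
  chi_mult zero_le_one (fun a _ Ω => sJ2_le a Ω) u a k
lemma chi_SW (u : Wal d ρ (Bf Pa)) (a : Pt Pa) (k : Idx d) : chi a (cf (SW Pa ω u) k) = sS a.1 (dotp k ω) * chi a (cf u k) :=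
  chi_mult zero_le_one (fun a _ Ω => sS_le a Ω) u a k

lemma norm_JW (u : Wal d ρ (Bf Pa)) : ‖JW Pa ω u‖ ≤ 1 * ‖u‖ :=
  norm_mult_apply_le zero_le_one (norm_sy_le zero_le_one fun a _ Ω => sJ_le a Ω) u
lemma norm_J1W (u : Wal d ρ (Bf Pa)) : ‖J1W Pa ω u‖ ≤ 1 * ‖u‖ :=
  norm_mult_apply_le zero_le_one (norm_sy_le zero_le_one fun a _ Ω => sJ1_le a Ω) u
lemma norm_SW (u : Wal d ρ (Bf Pa)) : ‖SW Pa ω u‖ ≤ 1 * ‖u‖ :=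
  norm_mult_apply_le zero_le_one (norm_sy_le zero_le_one fun a _ Ω => sS_le a Ω) u

lemma sg_JW (u : Wal d ρ (Bf Pa)) : sg (JW Pa ω u) = JW Pa ω (sg u) :=
  sg_mult (norm_sy_le zero_le_one fun a _ Ω => sJ_le a Ω) (sy_neg (fun a _ Ω => sJ_le a Ω) fun a _ Ω => sJ_neg a Ω) u
lemma sg_J1W (u : Wal d ρ (Bf Pa)) : sg (J1W Pa ω u) = J1W Pa ω (sg u) :=
  sg_mult (norm_sy_le zero_le_one fun a _ Ω => sJ1_le a Ω) (sy_neg (fun a _ Ω => sJ1_le a Ω) fun a _ Ω => sJ1_neg a Ω) u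
lemma sg_SW (u : Wal d ρ (Bf Pa)) : sg (SW Pa ω u) = SW Pa ω (sg u) :=
  sg_mult (norm_sy_le zero_le_one fun a _ Ω => sS_le a Ω) (sy_neg (fun a _ Ω => sS_le a Ω) fun a _ Ω => sS_neg a Ω) u

lemma cst_mul_cf (z : Bf Pa) (u : Wal d ρ (Bf Pa)) (k : Idx d) : cf (cst z * u) k = z * cf u k := by
  have : (cfL k).comp (mulL (cst z)) = (ContinuousLinearMap.mul ℝ (Bf Pa) z).comp (cfL k : Wal d ρ (Bf Pa) →L[ℝ] Bf Pa) := by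
    refine clm_ext fun l w => ?_
    simp only [ContinuousLinearMap.comp_apply, cfL_apply, ContinuousLinearMap.mul_apply', ← mul_def, cst_mul_bs]
    by_cases hl : k = l
    · subst hl; rw [cf_bs_self, cf_bs_self]
    · rw [cf_bs_ne hl, cf_bs_ne hl, mul_zero]
  exact DFunLike.congr_fun this u

lemma chi_aW (hPa : Pa ⊆ Set.Icc (1/4 : ℝ) (5/4)) (u : Wal d ρ (Bf Pa)) (a : Pt Pa) (k : Idx d) :
    chi a (cf (aW Pa * u) k) = (a.1 : ℂ) * chi a (cf u k) := by
  rw [aW, cst_mul_cf, chi_mul]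
  congr 1
  exact mkB_apply (C := 5/4) (fun a ha => by
    have := hPa ha
    rw [Complex.norm_real, Real.norm_eq_abs, abs_le]; constructor <;> linarith [this.1, this.2]) a

lemma norm_aW (hPa : Pa ⊆ Set.Icc (1/4 : ℝ) (5/4)) : ‖(aW Pa : Wal d ρ (Bf Pa))‖ ≤ 2 := by
  rw [aW, cst, norm_bs]
  exact norm_mkB_le (by norm_num) (fun a ha => by
    have := hPa ha
    rw [Complex.norm_real, Real.norm_eq_abs, abs_le]; constructor <;> linarith [this.1, this.2])

lemma ev_aW (hPa : Pa ⊆ Set.Icc (1/4 : ℝ) (5/4)) (a : Pt Pa) (φ : Fin d → ℝ) :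
    ev (chi a) φ (aW Pa : Wal d ρ (Bf Pa)) = (a.1 : ℂ) := by
  rw [aW, ev_cst]
  exact mkB_apply (C := 5/4) (fun a ha => by
    have := hPa ha
    rw [Complex.norm_real, Real.norm_eq_abs, abs_le]; constructor <;> linarith [this.1, this.2]) a

lemma sg_aW (hPa : Pa ⊆ Set.Icc (1/4 : ℝ) (5/4)) : sg (aW Pa : Wal d ρ (Bf Pa)) = aW Pa := by
  rw [aW, sg_cst]
  congr 1
  refine bf_ext fun a => ?_
  have : chi a (mkB Pa fun a => (a : ℂ)) = (a.1 : ℂ) := mkB_apply (C := 5/4) (fun a ha => by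
    have := hPa ha
    rw [Complex.norm_real, Real.norm_eq_abs, abs_le]; constructor <;> linarith [this.1, this.2]) a
  rw [chi_star, this, Complex.conj_ofReal]

/-- The linear operator. -/
def LW (Pa : Set ℝ) (ω : Fin d → ℝ) (y : Wal d ρ (Bf Pa)) : Wal d ρ (Bf Pa) :=
  J2W Pa ω y - aW Pa * J1W Pa ω y + JW Pa ω y - SW Pa ω y

lemma chi_LW (hPa : Pa ⊆ Set.Icc (1/4 : ℝ) (5/4)) (y : Wal d ρ (Bf Pa)) (a : Pt Pa) (k : Idx d) :
    chi a (cf (LW Pa ω y) k) = Lsym a.1 (tau0 a.1) (dotp k ω) * (((1 + (dotp k ω) ^ 2)⁻¹ : ℝ) : ℂ) * chi a (cf y k) := by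
  rw [LW]
  simp only [cf_sub, cf_add, map_sub, map_add, chi_JW, chi_J2W, chi_SW, chi_aW hPa, chi_J1W]
  rw [← sym_rel]; ring
end sys
end
end VdP

set_option linter.unusedSectionVars false
set_option linter.style.longLine false

namespace VdP
open scoped NNReal ENNReal
noncomputable section
open Filter Topology

section master
variable {Pa : Set ℝ} {d : ℕ} {ρ : ℝ≥0} {ω : Fin d → ℝ}

/-- Symbol of the regularised inverse. -/
def sE (α β ζ s a Ω : ℝ) : ℂ := (s * (1 + Ω ^ 2) : ℝ) / (Lsym a (tau0 a) Ω - s * qsym α β ζ a (tau0 a) Ω)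

lemma sE_neg (α β ζ s a Ω : ℝ) : sE α β ζ s a (-Ω) = (starRingEnd ℂ) (sE α β ζ s a Ω) := by
  unfold sE
  rw [Lsym_neg, qsym_neg, map_div₀, map_sub, map_mul, Complex.conj_ofReal, Complex.conj_ofReal, neg_sq]

lemma sE_le {α β ζ s a Ω c D : ℝ} (hc : 0 < c) (hs : 0 < s) (hD : 0 ≤ D)
    (h : c * (1 + Ω ^ 2) * (s + D) ≤ ‖Lsym a (tau0 a) Ω - s * qsym α β ζ a (tau0 a) Ω‖) :
    ‖sE α β ζ s a Ω‖ ≤ c⁻¹ * (s / (s + D)) := by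
  unfold sE
  rw [norm_div, Complex.norm_real, Real.norm_of_nonneg (by positivity)]
  calc _ ≤ s * (1 + Ω ^ 2) / (c * (1 + Ω ^ 2) * (s + D)) := by gcongr
    _ = _ := by field_simp

lemma norm_sy_bound {M : ℝ → ℝ → ℂ} {C : ℝ} {k : Idx d} (hC : 0 ≤ C) (h : ∀ a ∈ Pa, ‖M a (dotp k ω)‖ ≤ C) : ‖sy Pa ω M k‖ ≤ C :=
  norm_mkB_le hC h

set_option maxHeartbeats 1000000 in
theorem master [Nonempty (Pt Pa)] (hPa : Pa ⊆ Set.Icc (1/4 : ℝ) (5/4)) {α β ζ κ γ δ : ℝ} (hκ : 0 < κ) (hγ : 0 < γ)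
    (hP : ∀ a ∈ Pa, κ ≤ |hfun α β ζ a| ∧ κ ≤ |(tau0 a - a) * (α + β)| ∧
        ∀ l : Idx d, γ * Real.exp (-(δ * nrm l)) ≤ |dotp l ω - omega0 a| ∧ γ * Real.exp (-(δ * nrm l)) ≤ |dotp l ω + omega0 a| ∧
          γ * Real.exp (-(δ * nrm l)) ≤ |dotp l ω - 2 * omega0 a| ∧ γ * Real.exp (-(δ * nrm l)) ≤ |dotp l ω + 2 * omega0 a|)
    (hΩ : ∀ l : Idx d, l ≠ 0 → dotp l ω ≠ 0)
    (σ : ℝ → ℝ) (hσ : ∀ μ, 0 < μ → μ ≤ 1 → 0 < σ μ ∧ σ μ ≤ μ)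
    (h1 h2 r : Wal d ρ (Bf Pa)) (h10 : cf h1 0 = 0) (h20 : cf h2 0 = 0) (r0 : cf r 0 = 0)
    (h1s : sg h1 = h1) (h2s : sg h2 = h2) (rs : sg r = r)
    (Rest : ℝ → Wal d ρ (Bf Pa) → Wal d ρ (Bf Pa)) {CR μR : ℝ} (hCR : 0 < CR) (hμR : 0 < μR)
    (hR0 : ∀ μ, 0 < μ → μ ≤ μR → ‖Rest μ 0‖ ≤ CR * μ)
    (hRL : ∀ μ, 0 < μ → μ ≤ μR → ∀ δ, 0 < δ → δ ≤ 1 → ∀ y y', ‖y‖ ≤ δ → ‖y'‖ ≤ δ →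
      ‖Rest μ y - Rest μ y'‖ ≤ CR * (μ + δ) * ‖y - y'‖)
    (hRs : ∀ μ, 0 < μ → μ ≤ μR → ∀ y, ‖y‖ ≤ 1 → sg y = y → sg (Rest μ y) = Rest μ y) :
    ∃ μ0 : ℝ, 0 < μ0 ∧ μ0 ≤ μR ∧ ∀ μ, 0 < μ → μ ≤ μ0 → ∃ y : Wal d ρ (Bf Pa), ‖y‖ ≤ 1 ∧ sg y = y ∧
      LW Pa ω y = σ μ • (r + Rest μ y + (h1 * JW Pa ω y + h2 * SW Pa ω y)
        + (α • JW Pa ω y + β • SW Pa ω y - ζ • (aW Pa * J1W Pa ω y))) := by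
  obtain ⟨c, s0, hc, hs0, hs01, hh⟩ := hyp α β ζ κ hκ
  have hh' : ∀ a ∈ Pa, ∀ s, 0 ≤ s → s ≤ s0 → ∀ Ω,
      c * (1 + Ω ^ 2) * (s + Dres (omega0 a) Ω) ≤ ‖Lsym a (tau0 a) Ω - s * qsym α β ζ a (tau0 a) Ω‖ :=
    fun a ha s h0 h1 Ω => hh a (hPa ha).1 (hPa ha).2 (hP a ha).1 (hP a ha).2.1 s h0 h1 Ω
  have hσ' : ∀ μ, 0 < μ → μ ≤ s0 → 0 < σ μ ∧ σ μ ≤ μ ∧ σ μ ≤ s0 := fun μ h0 h1 =>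
    ⟨(hσ μ h0 (h1.trans hs01)).1, (hσ μ h0 (h1.trans hs01)).2, (hσ μ h0 (h1.trans hs01)).2.trans h1⟩
  have hE1 : ∀ μ, 0 < μ → μ ≤ s0 → ∀ a ∈ Pa, ∀ Ω, ‖sE α β ζ (σ μ) a Ω‖ ≤ c⁻¹ * (σ μ / (σ μ + Dres (omega0 a) Ω)) :=
    fun μ h0 h1 a ha Ω => sE_le hc (hσ' μ h0 h1).1 (Dres_nonneg _ _) (hh' a ha _ (hσ' μ h0 h1).1.le (hσ' μ h0 h1).2.2 Ω)
  have hE2 : ∀ μ, 0 < μ → μ ≤ s0 → ∀ a ∈ Pa, ∀ Ω, ‖sE α β ζ (σ μ) a Ω‖ ≤ c⁻¹ := by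
    intro μ h0 h1 a ha Ω
    refine (hE1 μ h0 h1 a ha Ω).trans (mul_le_of_le_one_right (by positivity) ?_)
    have := Dres_nonneg (omega0 a) Ω
    have := (hσ' μ h0 h1).1
    rw [div_le_one (by positivity)]; linarith
  set m : Idx d → ℝ := fun l => min (min 1 (γ * Real.exp (-(δ * nrm l)))) |dotp l ω| with hm
  have hm0 : ∀ l, l ≠ 0 → 0 < m l := fun l hl => lt_min (lt_min one_pos (by positivity)) (abs_pos.2 (hΩ l hl))
  have hm0' : ∀ l, 0 ≤ m l := fun l => le_min (le_min zero_le_one (by positivity)) (abs_nonneg _)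
  set Ce := c⁻¹ + c⁻¹ * c⁻¹ with hCe
  have hCe0 : 0 < Ce := by positivity
  have hcc : 0 < c⁻¹ * c⁻¹ := by positivity
  have hci : 0 < c⁻¹ := by positivity
  set e : Idx d → ℝ → ℝ := fun l μ => Ce * min 1 (μ / m l) with he
  have hle : ∀ l, l ≠ 0 → ∀ s μ, 0 < s → s ≤ μ → s / m l ≤ μ / m l := fun l hl s μ _ h =>
    div_le_div_of_nonneg_right h (hm0' l)
  obtain ⟨C, hC, hlin⟩ := lin_inv h1 h2 r h10 h20 r0 h1s h2s
    (B1 := sy Pa ω sJ) (B2 := sy Pa ω sS)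
    (norm_sy_le zero_le_one fun a _ Ω => sJ_le a Ω) (norm_sy_le zero_le_one fun a _ Ω => sS_le a Ω)
    (sy_neg (fun a _ Ω => sJ_le a Ω) fun a _ Ω => sJ_neg a Ω) (sy_neg (fun a _ Ω => sS_le a Ω) fun a _ Ω => sS_neg a Ω)
    (fun μ => sy Pa ω (sE α β ζ (σ μ))) (C0 := c⁻¹) (μ1 := s0) (by positivity) hs0
    (fun μ h0 h1 => norm_sy_le (by positivity) (hE2 μ h0 h1))
    (fun μ h0 h1 => sy_neg (hE2 μ h0 h1) (fun a _ Ω => sE_neg _ _ _ _ _ _))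
    e (Ce := Ce)
    (fun l μ h0 _ => mul_nonneg hCe0.le (le_min zero_le_one (div_nonneg h0.le (hm0' l))))
    (fun l μ h0 _ => mul_le_of_le_one_right hCe0.le (min_le_left _ _))
    (by
      intro l hl
      have h1 : Tendsto (fun μ : ℝ => Ce * min 1 (μ / m l)) (𝓝 0) (𝓝 (Ce * min 1 (0 / m l))) := by
        apply Continuous.tendsto
        fun_prop
      rw [zero_div, min_eq_right zero_le_one, mul_zero] at h1
      exact h1.mono_left nhdsWithin_le_nhds)
    (by
      intro l hl μ h0 h1
      obtain ⟨s1, s2, s3⟩ := hσ' μ h0 h1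
      have hml := hm0 l hl
      refine norm_sy_bound ?_ ?_
      · exact mul_nonneg hCe0.le (le_min zero_le_one (div_nonneg h0.le (hm0' l)))
      · intro a ha
        have hD : m l ≤ Dres (omega0 a) (dotp l ω) :=
          Dres_ge ((min_le_left _ _).trans (min_le_left _ _)) (min_le_right _ _)
            (((min_le_left _ _).trans (min_le_right _ _)).trans ((hP a ha).2.2 l).1)
            (((min_le_left _ _).trans (min_le_right _ _)).trans ((hP a ha).2.2 l).2.1)
        refine (hE1 μ h0 h1 a ha _).trans ?_
        refine mul_le_mul (by linarith) (le_min ?_ ?_) (by have := Dres_nonneg (omega0 a) (dotp l ω); positivity) hCe0.le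
        · rw [div_le_one (by linarith)]; linarith
        · refine le_trans ?_ (hle l hl _ _ s1 s2)
          exact div_le_div_of_nonneg_left s1.le hml (by linarith))
    (by
      intro l hl μ h0 h1 k
      obtain ⟨s1, s2, s3⟩ := hσ' μ h0 h1
      have hml := hm0 l hl
      refine (BoundedContinuousFunction.norm_le (mul_nonneg hCe0.le (le_min zero_le_one (div_nonneg h0.le (hm0' l))))).2 fun a => ?_
      change ‖chi a (sy Pa ω (sE α β ζ (σ μ)) (l + k) * sy Pa ω (sE α β ζ (σ μ)) k)‖ ≤ _
      rw [chi_mul, chi_sy (hE2 μ h0 h1), chi_sy (hE2 μ h0 h1), norm_mul]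
      have ha := a.2
      set D1 := Dres (omega0 a.1) (dotp (l + k) ω) with hD1
      set D2 := Dres (omega0 a.1) (dotp k ω) with hD2
      have hD10 : 0 ≤ D1 := Dres_nonneg _ _
      have hD20 : 0 ≤ D2 := Dres_nonneg _ _
      have hdd : dotp (l + k) ω - dotp k ω = dotp l ω := by rw [dotp_add]; ring
      have hγl : m l ≤ γ * Real.exp (-(δ * nrm l)) := (min_le_left _ _).trans (min_le_right _ _)
      obtain ⟨q1, q2, q3, q4⟩ := (hP a.1 ha).2.2 l
      have hDs : m l ≤ D1 + D2 := by
        refine Dres_sum ((min_le_left _ _).trans (min_le_left _ _)) ?_ ?_ ?_ ?_ ?_ <;> rw [hdd]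
        · exact min_le_right _ _
        · exact hγl.trans q1
        · exact hγl.trans q2
        · exact hγl.trans q3
        · exact hγl.trans q4
      have b1 := hE1 μ h0 h1 a.1 ha (dotp (l + k) ω)
      have b2 := hE1 μ h0 h1 a.1 ha (dotp k ω)
      calc _ ≤ (c⁻¹ * (σ μ / (σ μ + D1))) * (c⁻¹ * (σ μ / (σ μ + D2))) :=
            mul_le_mul b1 b2 (norm_nonneg _) (by positivity)
        _ = (c⁻¹ * c⁻¹) * ((σ μ / (σ μ + D1)) * (σ μ / (σ μ + D2))) := by ring
        _ ≤ Ce * min 1 (μ / m l) := by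
            refine mul_le_mul (by linarith) (le_min ?_ ?_) (by positivity) hCe0.le
            · refine mul_le_one₀ ?_ (by positivity) ?_ <;> rw [div_le_one (by positivity)] <;> linarith
            · refine le_trans ?_ (hle l hl _ _ s1 s2)
              rw [div_mul_div_comm, div_le_div_iff₀ (by positivity) hml]
              have : σ μ * σ μ * m l ≤ σ μ * σ μ * (D1 + D2) := by gcongr
              nlinarith [mul_nonneg s1.le (mul_nonneg hD10 hD20), mul_pos s1 (mul_pos s1 s1)])
  obtain ⟨μ0, p0, p1, p2, p3⟩ := fixed_point r rs hC hs0 (fun μ W => ∀ R, ∃ z, W R = mult (sy Pa ω (sE α β ζ (σ μ))) z ∧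
      z = R + Gt h1 h2 (sy Pa ω sJ) (sy Pa ω sS) (W R)) hlin Rest hCR hμR hR0 hRL hRs
  refine ⟨μ0, p0, p2, fun μ hμ hμ0 => ?_⟩
  obtain ⟨W, y, hQ, hy1, hys, hy⟩ := p3 μ hμ hμ0
  refine ⟨y, hy1, hys, ?_⟩
  obtain ⟨z, hz1, hz2⟩ := hQ (r + Rest μ y)
  rw [← hy] at hz1 hz2
  rw [Gt_apply] at hz2
  change z = r + Rest μ y + (h1 * JW Pa ω y + h2 * SW Pa ω y) at hz2
  rw [← hz2]
  obtain ⟨s1, s2, s3⟩ := hσ' μ hμ (hμ0.trans p1)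
  refine wal_ext fun k a => ?_
  rw [chi_LW hPa, cf_smul, map_smul]
  simp only [cf_add, cf_sub, cf_smul, map_add, map_sub, map_smul, chi_JW, chi_SW, chi_aW hPa, chi_J1W, Complex.real_smul]
  have hyk : chi a (cf y k) = sE α β ζ (σ μ) a.1 (dotp k ω) * chi a (cf z k) := by
    conv_lhs => rw [hz1]
    exact chi_mult (by positivity) (hE2 μ hμ (hμ0.trans p1)) z a k
  have hq := sym_relq α β ζ a.1 (dotp k ω)
  set Ω := dotp k ω
  have hden : Lsym a.1 (tau0 a.1) Ω - σ μ * qsym α β ζ a.1 (tau0 a.1) Ω ≠ 0 := by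
    have := hh' a.1 a.2 (σ μ) s1.le s3 Ω
    have h4 : 0 < c * (1 + Ω ^ 2) * (σ μ + Dres (omega0 a.1) Ω) := by
      have := Dres_nonneg (omega0 a.1) Ω
      positivity
    exact norm_pos_iff.1 (h4.trans_le this)
  have hEd : (Lsym a.1 (tau0 a.1) Ω - σ μ * qsym α β ζ a.1 (tau0 a.1) Ω) * chi a (cf y k) = (σ μ * (1 + Ω ^ 2) : ℝ) * chi a (cf z k) := by
    rw [hyk, sE]; field_simp
  have hinv : ((1 + Ω ^ 2 : ℝ) : ℂ) * (((1 + Ω ^ 2)⁻¹ : ℝ) : ℂ) = 1 := by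
    rw [← Complex.ofReal_mul, mul_inv_cancel₀ (by positivity), Complex.ofReal_one]
  rw [Complex.ofReal_mul] at hEd
  linear_combination (((1 + Ω ^ 2)⁻¹ : ℝ) : ℂ) * hEd + (σ μ : ℂ) * chi a (cf z k) * hinv - (σ μ : ℂ) * chi a (cf y k) * hq

end master
end
end VdP

set_option linter.unusedSectionVars false
set_option linter.style.longLine false

namespace VdP
open scoped NNReal ENNReal
noncomputable section
open Filter Topology

section restb
variable {A : Type} [NormedCommRing A] [NormedAlgebra ℝ A] [CompleteSpace A] [NormOneClass A]

lemma rest_bd {s : A →L[ℝ] A} {CQ CN μ : ℝ} {Q N : A → A} (hQ : Qc s CQ Q) (hN : Nc s CN N)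
    (hμ : 0 < μ) (hCQ : 0 ≤ CQ) :
    ‖Q 0 + μ • N 0‖ ≤ (CQ + CN + 1) * μ ∧
    (∀ δ, 0 < δ → δ ≤ 1 → ∀ y y', ‖y‖ ≤ δ → ‖y'‖ ≤ δ →
      ‖(Q y + μ • N y) - (Q y' + μ • N y')‖ ≤ (CQ + CN + 1) * (μ + δ) * ‖y - y'‖) ∧
    (∀ y, ‖y‖ ≤ 1 → s y = y → s (Q y + μ • N y) = Q y + μ • N y) := by
  have hCN := hN.nonneg
  refine ⟨?_, fun δ h0 h1 y y' hy hy' => ?_, fun y hy hs => ?_⟩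
  · rw [hQ.zero, zero_add, norm_smul, Real.norm_of_nonneg hμ.le, mul_comm]
    have := hN.bd 0 (by simp)
    gcongr; linarith
  · have e : (Q y + μ • N y) - (Q y' + μ • N y') = (Q y - Q y') + μ • (N y - N y') := by rw [smul_sub]; abel
    rw [e]
    have a1 := hQ.lip δ h0 h1 y y' hy hy'
    have a2 := hN.lip y y' (hy.trans h1) (hy'.trans h1)
    have a3 : ‖μ • (N y - N y')‖ ≤ μ * (CN * ‖y - y'‖) := by
      rw [norm_smul, Real.norm_of_nonneg hμ.le]; gcongr
    refine (norm_add_le _ _).trans ((add_le_add a1 a3).trans ?_)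
    have hn := norm_nonneg (y - y')
    have e2 : (CQ + CN + 1) * (μ + δ) * ‖y - y'‖ - (CQ * δ * ‖y - y'‖ + μ * (CN * ‖y - y'‖)) =
       (CQ * μ + CN * δ + μ + δ) * ‖y - y'‖ := by ring
    have : 0 ≤ (CQ * μ + CN * δ + μ + δ) * ‖y - y'‖ := by positivity
    linarith
  · rw [map_add, map_smul, hQ.inv y hy hs, hN.inv y hy hs]
end restb

/-- `X` yields a quasi-periodic solution. -/
def Good {d : ℕ} (ω : Fin d → ℝ) (f : ℝ → ℝ) (F : EE d → ℝ) (a ε B : ℝ) (X : (Fin d → ℝ) → ℝ) : Prop :=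
  AnalyticOnNhd ℝ X Set.univ ∧
  (∀ (φ : Fin d → ℝ) (m : Fin d → ℤ), X (fun i => φ i + 2 * Real.pi * m i) = X φ) ∧
  (∀ φ : Fin d → ℝ, |X φ| ≤ B) ∧
  (∀ t : ℝ, DifferentiableAt ℝ (fun t : ℝ => X (fun i => t * ω i)) t) ∧
  (∀ t : ℝ, HasDerivAt (deriv (fun t : ℝ => X (fun i => t * ω i)))
    (-(a * ((X (fun i => t * ω i)) ^ 2 - 1) * deriv (fun t : ℝ => X (fun i => t * ω i)) t)
      - X (fun i => t * ω i) + f (X (fun i => (t - tau0 a) * ω i))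
      + ε * F ((fun i => t * ω i), (X (fun i => t * ω i), X (fun i => (t - tau0 a) * ω i), ε))) t)

section sol
variable {Pa : Set ℝ} {d : ℕ} {ρ : ℝ≥0} {ω : Fin d → ℝ}

/-- the substitution. -/
def wv (Pa : Set ℝ) (ω : Fin d → ℝ) (v : Wal d ρ (Bf Pa)) (e : ℝ) : Fin 3 → Wal d ρ (Bf Pa) :=
  ![JW Pa ω v, SW Pa ω v, e • 1]

set_option maxHeartbeats 1000000 in
theorem sol (hρ0 : 0 < ρ) (hPa : Pa ⊆ Set.Icc (1/4 : ℝ) (5/4)) {F : EE d → ℝ} {C K ρ' r rf : ℝ} {f : ℝ → ℝ} (hρ : (ρ : ℝ) < ρ')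
    (hc : ∀ n f k, ‖fc (gc F n f) k‖ ≤ C * K ^ n * Real.exp (-(ρ' * nrm k)))
    (hh : ∀ n f φ, HasSum (fun k => fc (gc F n f) k * Complex.exp (Complex.I * (dotp k φ : ℝ))) ((gc F n f φ : ℝ) : ℂ))
    (hsum : ∀ φ z, ‖z‖ < r → HasSum (fun n => ∑ f : Fin n → Fin 3, gc F n f φ * ∏ j, zc z (f j)) (F (φ, z)))
    (hsumf : ∀ x, |x| < rf → HasSum (fun n => fco f n * x ^ n) (f x))
    (a : Pt Pa) (v : Wal d ρ (Bf Pa)) (hv : sg v = v) {μ ε : ℝ} (hμ : 0 < μ) (hb : μ * ‖v‖ < r) (hbf : μ * ‖v‖ < rf) (hε : |ε| < r)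
    (hSf : Summable fun n => μ ^ n • (fco f n • (SW Pa ω v) ^ n))
    (hSH : Summable fun n => μ ^ n • Hn F n (wv Pa ω v (ε / μ)))
    (hEq : μ • LW Pa ω v = -(μ ^ 3 • (aW Pa * ((JW Pa ω v) ^ 2 * J1W Pa ω v)))
      + ((∑' n, μ ^ n • (fco f n • (SW Pa ω v) ^ n)) - μ • SW Pa ω v) + ε • ∑' n, μ ^ n • Hn F n (wv Pa ω v (ε / μ))) :
    Good ω f F a.1 ε (μ * ‖v‖) (fun φ => μ * (ev (chi a) φ (JW Pa ω v)).re) := by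
  set x0 : (Fin d → ℝ) → ℝ := fun φ => (ev (chi a) φ (JW Pa ω v)).re with hx0
  set x1 : (Fin d → ℝ) → ℝ := fun φ => (ev (chi a) φ (J1W Pa ω v)).re with hx1
  set x2 : (Fin d → ℝ) → ℝ := fun φ => (ev (chi a) φ (J2W Pa ω v)).re with hx2
  set xs : (Fin d → ℝ) → ℝ := fun φ => (ev (chi a) φ (SW Pa ω v)).re with hxs
  have e0 : ∀ φ, ev (chi a) φ (JW Pa ω v) = x0 φ := fun φ => (ev_real a φ (by rw [sg_JW, hv])).symm
  have e1 : ∀ φ, ev (chi a) φ (J1W Pa ω v) = x1 φ := fun φ => (ev_real a φ (by rw [sg_J1W, hv])).symm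
  have es : ∀ φ, ev (chi a) φ (SW Pa ω v) = xs φ := fun φ => (ev_real a φ (by rw [sg_SW, hv])).symm
  have b0 : ∀ φ, |x0 φ| ≤ ‖v‖ := fun φ => by
    have := (ev_norm_le_one a φ (JW Pa ω v)).trans (norm_JW v)
    rwa [e0, Complex.norm_real, Real.norm_eq_abs, one_mul] at this
  have bs : ∀ φ, |xs φ| ≤ ‖v‖ := fun φ => by
    have := (ev_norm_le_one a φ (SW Pa ω v)).trans (norm_SW v)
    rwa [es, Complex.norm_real, Real.norm_eq_abs, one_mul] at this
  have m0 : ∀ φ, |μ * x0 φ| ≤ μ * ‖v‖ := fun φ => by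
    rw [abs_mul, abs_of_pos hμ]; exact mul_le_mul_of_nonneg_left (b0 φ) hμ.le
  have ms : ∀ φ, |μ * xs φ| ≤ μ * ‖v‖ := fun φ => by
    rw [abs_mul, abs_of_pos hμ]; exact mul_le_mul_of_nonneg_left (bs φ) hμ.le
  have d0 : ∀ t : ℝ, HasDerivAt (fun t : ℝ => x0 (fun i => t * ω i)) (x1 (fun i => t * ω i)) t := fun t => by
    have := ev_deriv (chi a) ω (JW Pa ω v) (J1W Pa ω v) (fun k => by
      rw [chi_JW, chi_J1W, sJ1, sJ]; ring) t
    exact Complex.reCLM.hasFDerivAt.comp_hasDerivAt t this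
  have d1 : ∀ t : ℝ, HasDerivAt (fun t : ℝ => x1 (fun i => t * ω i)) (x2 (fun i => t * ω i)) t := fun t => by
    have := ev_deriv (chi a) ω (J1W Pa ω v) (J2W Pa ω v) (fun k => by
      rw [chi_J2W, chi_J1W, sJ1, sJ2]; push_cast; linear_combination (-(dotp k ω : ℂ) ^ 2 * (1 + (dotp k ω : ℂ) ^ 2)⁻¹ * chi a (cf v k)) * Complex.I_sq) t
    exact Complex.reCLM.hasFDerivAt.comp_hasDerivAt t this
  have sh : ∀ t : ℝ, x0 (fun i => (t - tau0 a.1) * ω i) = xs (fun i => t * ω i) := fun t => by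
    have := ev_shift (chi a) ω (JW Pa ω v) (SW Pa ω v) (tau0 a.1) (fun k => by
      rw [chi_JW, chi_SW, sJ, sS]; ring) t
    simp only [hx0, hxs, this]
  have main : ∀ φ, μ * x2 φ = μ * (a.1 * x1 φ - x0 φ + xs φ) - μ ^ 3 * (a.1 * (x0 φ ^ 2 * x1 φ)) + (f (μ * xs φ) - μ * xs φ)
      + ε * F (φ, (μ * x0 φ, μ * xs φ, ε)) := by
    intro φ
    have h := congrArg (ev (chi a) φ) hEq
    have hwe : ∀ j, ev (chi a) φ (wv Pa ω v (ε / μ) j) = ((![x0 φ, xs φ, ε / μ] : Fin 3 → ℝ) j : ℂ) := by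
      intro j; fin_cases j
      · simpa [wv] using e0 φ
      · simpa [wv] using es φ
      · simp [wv, map_smul, ev_one (chi a) (chi_one a)]
    have hμε : μ * (ε / μ) = ε := by field_simp
    have hTH := ev_TH hρ hc hh hsum a φ (wv Pa ω v (ε / μ)) ![x0 φ, xs φ, ε / μ] hwe (μ := μ) (by
      simp only [Matrix.cons_val_zero, Matrix.cons_val_one, Matrix.cons_val, hμε, Prod.norm_mk, Real.norm_eq_abs]
      exact max_lt ((m0 φ).trans_lt hb) (max_lt ((ms φ).trans_lt hb) hε)) hSH
    have hTf := ev_Tf hsumf a φ (SW Pa ω v) (xs φ) (es φ) (μ := μ) ((ms φ).trans_lt hbf) hSf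
    simp only [Matrix.cons_val_zero, Matrix.cons_val_one, Matrix.cons_val, hμε] at hTH
    rw [map_smul, map_add, map_add, map_neg, map_sub, map_smul, map_smul, map_smul, hTH, hTf, LW, map_sub, map_add, map_sub,
      ev_mul _ (chi_mul a), ev_mul _ (chi_mul a), ev_mul _ (chi_mul a), ev_pow, ev_aW hPa, e0, e1, es] at h
    have h' := congrArg Complex.re h
    simp only [Complex.real_smul, ← Complex.ofReal_mul, ← Complex.ofReal_pow, ← Complex.ofReal_neg, ← Complex.ofReal_sub,
      ← Complex.ofReal_add, Complex.ofReal_re, Complex.re_ofReal_mul, Complex.sub_re, Complex.add_re] at h'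
    rw [show (ev (chi a) φ (J2W Pa ω v)).re = x2 φ from rfl] at h'
    linear_combination h'
  have dd : deriv (fun t : ℝ => μ * x0 (fun i => t * ω i)) = fun t => μ * x1 (fun i => t * ω i) :=
    funext fun t => ((d0 t).const_mul μ).deriv
  refine ⟨?_, fun φ m => ?_, m0, fun t => ((d0 t).const_mul μ).differentiableAt, fun t => ?_⟩
  · intro φ hφ
    have := (Complex.reCLM.analyticAt _).fun_comp ((ev_analytic hρ0 (chi a) (JW Pa ω v)) φ hφ)
    exact analyticAt_const.mul this
  · show μ * x0 _ = μ * x0 φ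
    simp only [hx0]; rw [ev_per]
  · show HasDerivAt (deriv (fun t : ℝ => μ * x0 (fun i => t * ω i))) (-(a.1 * ((μ * x0 (fun i => t * ω i)) ^ 2 - 1) *
      deriv (fun t : ℝ => μ * x0 (fun i => t * ω i)) t) - μ * x0 (fun i => t * ω i) + f (μ * x0 (fun i => (t - tau0 a.1) * ω i))
      + ε * F ((fun i => t * ω i), (μ * x0 (fun i => t * ω i), μ * x0 (fun i => (t - tau0 a.1) * ω i), ε))) t
    rw [dd, sh]
    have hd := (d1 t).const_mul μ
    rw [main] at hd
    refine hd.congr_deriv ?_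
    ring
end sol
end
end VdP

set_option linter.unusedSectionVars false
set_option linter.style.longLine false

namespace VdP
open scoped NNReal ENNReal
noncomputable section
open Filter Topology

lemma small {A1 A2 A3 r rf : ℝ} (h1 : 0 ≤ A1) (h2 : 0 ≤ A2) (h3 : 0 ≤ A3) (hr : 0 < r) (hrf : 0 < rf) :
    ∃ μR : ℝ, 0 < μR ∧ ∀ μ, 0 < μ → μ ≤ μR → μ ≤ 1 ∧ μ * A1 ≤ 1 / 2 ∧ μ * A2 ≤ 1 / 2 ∧ μ * A3 < r ∧ μ * A3 < rf ∧ μ < r := by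
  set q := min (min r rf) 1 with hq
  have q0 : 0 < q := lt_min (lt_min hr hrf) one_pos
  have q1 : q ≤ 1 := min_le_right _ _
  have q2 : q ≤ r := (min_le_left _ _).trans (min_le_left _ _)
  have q3 : q ≤ rf := (min_le_left _ _).trans (min_le_right _ _)
  have hM : 0 < A1 + A2 + A3 + 1 := by positivity
  refine ⟨q / (2 * (A1 + A2 + A3 + 1)), by positivity, fun μ h0 h => ?_⟩
  rw [le_div_iff₀ (by positivity)] at h
  have a1 : 0 ≤ μ * A1 := by positivity
  have a2 : 0 ≤ μ * A2 := by positivity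
  have a3 : 0 ≤ μ * A3 := by positivity
  have e : μ * (2 * (A1 + A2 + A3 + 1)) = 2 * (μ * A1) + 2 * (μ * A2) + 2 * (μ * A3) + 2 * μ := by ring
  rw [e] at h
  refine ⟨?_, ?_, ?_, ?_, ?_, ?_⟩ <;> linarith

section split
variable {A : Type} [NormedCommRing A] [NormedAlgebra ℝ A] [CompleteSpace A]
lemma split_sum (M : ℕ → A) (μ : ℝ) (m : ℕ) (h : Summable fun n => μ ^ n • M n) :
    ∑' n, μ ^ n • M n = ∑ i ∈ Finset.range m, μ ^ i • M i + μ ^ m • ∑' n, μ ^ n • M (n + m) := by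
  rw [← h.sum_add_tsum_nat_add m]
  congr 1
  by_cases hμ : μ ^ m = 0
  · rw [hμ, zero_smul]
    have : ∀ n, μ ^ (n + m) • M (n + m) = 0 := fun n => by rw [pow_add, hμ, mul_zero, zero_smul]
    simp [this]
  · rw [← tsum_const_smul'' (μ ^ m)]
    refine tsum_congr fun n => ?_
    rw [smul_smul, pow_add, mul_comm]

lemma alg1 (μ c0 b1 m : ℝ) (hc0 : b1 * c0 ^ 3 + m = 0) (aw J S D H0 Tf TH L r : A) (hr : r = H0 - m • (1 : A))
    (h : L = μ ^ 2 • (r + ((-aw * ((2 * c0) • J + J * J) * D + (b1 • ((3 * c0) • S + S * S)) * S) + μ • (Tf + TH))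
      + (0 * J + 0 * S) + ((0 : ℝ) • J + (3 * b1 * c0 ^ 2) • S - (c0 ^ 2) • (aw * D)))) :
    μ • L = -(μ ^ 3 • (aw * ((c0 • (1 : A) + J) ^ 2 * D))) + ((μ • (c0 • (1 : A) + S) + μ ^ 3 • b1 • (c0 • (1 : A) + S) ^ 3 + μ ^ 4 • Tf)
      - μ • (c0 • (1 : A) + S)) + μ ^ 3 • (H0 + μ • TH) := by
  have hm : m = -(b1 * c0 ^ 3) := by linarith
  rw [h, hr, hm]
  simp only [Algebra.smul_def, map_mul, map_pow, map_neg, map_zero, map_ofNat]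
  ring

lemma alg2 (μ α β : ℝ) (aw J S D J0 S0 D0 H0 h1 h2 G3 Tf TH L L0 r : A)
   (hL0 : L0 = H0)
   (hr : r = (h1 + α • (1 : A)) * J0 + (h2 + β • (1 : A)) * S0 + G3)
   (h : L = μ • (r + (0 + μ • (-(aw * ((J0 + J) ^ 2 * (D0 + D))) + (Tf + TH)))
      + (h1 * J + h2 * S) + (α • J + β • S - (0 : ℝ) • (aw * D)))) :
    μ • (L0 + L) = -(μ ^ 3 • (aw * ((J0 + J) ^ 2 * (D0 + D)))) + ((μ • (S0 + S) + μ ^ 3 • Tf)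
      - μ • (S0 + S)) + μ • (H0 + μ • ((h1 + α • (1 : A)) * (J0 + J) + (h2 + β • (1 : A)) * (S0 + S) + G3) + μ ^ 2 • TH) := by
  rw [h, hr, hL0]
  simp only [Algebra.smul_def, map_mul, map_pow, map_neg, map_zero, map_ofNat]
  ring
end split

section tl
variable {Pa : Set ℝ} {d : ℕ} {ρ : ℝ≥0} {ω : Fin d → ℝ}

lemma chi_cst_ne (z : Bf Pa) {k : Idx d} (hk : k ≠ 0) : cf (cst z : Wal d ρ (Bf Pa)) k = 0 := by
  rw [cst, cf_bs_ne hk]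

lemma JW_cst (z : Bf Pa) : JW Pa ω (cst z : Wal d ρ (Bf Pa)) = cst z := wal_ext fun k a => by
  rw [chi_JW]
  by_cases hk : k = 0
  · subst hk; simp [dotp_zero, sJ]
  · rw [chi_cst_ne z hk, map_zero, mul_zero]
lemma SW_cst (z : Bf Pa) : SW Pa ω (cst z : Wal d ρ (Bf Pa)) = cst z := wal_ext fun k a => by
  rw [chi_SW]
  by_cases hk : k = 0
  · subst hk; simp [dotp_zero, sS]
  · rw [chi_cst_ne z hk, map_zero, mul_zero]
lemma J1W_cst (z : Bf Pa) : J1W Pa ω (cst z : Wal d ρ (Bf Pa)) = 0 := wal_ext fun k a => by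
  rw [chi_J1W]
  by_cases hk : k = 0
  · subst hk; simp [dotp_zero, sJ1, cf_zero]
  · rw [chi_cst_ne z hk, map_zero, mul_zero, cf_zero, map_zero]
lemma J2W_cst (z : Bf Pa) : J2W Pa ω (cst z : Wal d ρ (Bf Pa)) = 0 := wal_ext fun k a => by
  rw [chi_J2W]
  by_cases hk : k = 0
  · subst hk; simp [dotp_zero, sJ2, cf_zero]
  · rw [chi_cst_ne z hk, map_zero, mul_zero, cf_zero, map_zero]
lemma LW_add (x y : Wal d ρ (Bf Pa)) : LW Pa ω (x + y) = LW Pa ω x + LW Pa ω y := by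
  simp only [LW, map_add, mul_add]; abel
lemma LW_cst (z : Bf Pa) : LW Pa ω (cst z : Wal d ρ (Bf Pa)) = 0 := by
  rw [LW, J2W_cst, J1W_cst, JW_cst, SW_cst, mul_zero]; abel

variable [Nonempty (Pt Pa)]

lemma nc_wv (x : Wal d ρ (Bf Pa)) (hx : sg x = x) (e : ℝ) (he : |e| ≤ 1) (j : Fin 3) :
    Nc sg (‖x‖ + 1) (fun y => wv Pa ω (x + y) e j) := by
  fin_cases j
  · have h1 := (Nc.const (s := sg) (c := JW Pa ω x) ((norm_JW x).trans_eq (one_mul _)) (by rw [sg_JW, hx])).add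
      (Nc.lin (T := JW Pa ω) norm_JW zero_le_one sg_JW)
    simpa [wv, map_add] using h1
  · have h1 := (Nc.const (s := sg) (c := SW Pa ω x) ((norm_SW x).trans_eq (one_mul _)) (by rw [sg_SW, hx])).add
      (Nc.lin (T := SW Pa ω) norm_SW zero_le_one sg_SW)
    simpa [wv, map_add] using h1
  · refine Nc.const ?_ ?_
    · show ‖e • (1 : Wal d ρ (Bf Pa))‖ ≤ _
      rw [norm_smul, Real.norm_eq_abs, norm_one, mul_one]; have := norm_nonneg x; linarith
    · show sg (e • (1 : Wal d ρ (Bf Pa))) = e • 1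
      rw [map_smul, sg_one]

lemma nc_D (x : Wal d ρ (Bf Pa)) (hx : sg x = x) : Nc sg (‖x‖ + 1) (fun y => J1W Pa ω (x + y)) := by
  have h1 := (Nc.const (s := sg) (c := J1W Pa ω x) ((norm_J1W x).trans_eq (one_mul _)) (by rw [sg_J1W, hx])).add
      (Nc.lin (T := J1W Pa ω) norm_J1W zero_le_one sg_J1W)
  simpa [map_add] using h1

lemma nc_tH {F : EE d → ℝ} {C K ρ' : ℝ} (hρ : (ρ : ℝ) < ρ')
    (hc : ∀ n f k, ‖fc (gc F n f) k‖ ≤ C * K ^ n * Real.exp (-(ρ' * nrm k)))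
    (x : Wal d ρ (Bf Pa)) (hx : sg x = x) (e : ℝ) (he : |e| ≤ 1) (hK : 0 ≤ K) {μ : ℝ} (hμ : 0 < μ)
    (hμK : μ * (6 * K * (‖x‖ + 1)) ≤ 1 / 2) (m : ℕ) :
    Nc sg (2 * (2 * (C * Sd d (ρ' - ρ)) * (6 * K * (‖x‖ + 1)) ^ m)) (fun y => ∑' n, μ ^ n • Hn F (n + m) (wv Pa ω (x + y) e)) ∧
    ∀ y, ‖y‖ ≤ 1 → Summable (fun n => μ ^ n • Hn F (n + m) (wv Pa ω (x + y) e)) := by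
  have h : ∀ n, Nc sg (2 * (C * Sd d (ρ' - ρ)) * (6 * K * (‖x‖ + 1)) ^ m * (6 * K * (‖x‖ + 1)) ^ n)
      (fun y => Hn F (n + m) (wv Pa ω (x + y) e)) := fun n =>
    (Hn_Nc hρ hc (fun j y => wv Pa ω (x + y) e j) (nc_wv x hx e he) (n + m)).mono (le_of_eq (by rw [pow_add]; ring))
  exact ⟨Nc.tsum h (by positivity) hμ hμK, fun y hy => Nc.summable h (by positivity) hμ hμK y hy⟩

lemma nc_tf {f : ℝ → ℝ} {C K : ℝ} (hC : ∀ n, |fco f n| ≤ C * K ^ n)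
    (x : Wal d ρ (Bf Pa)) (hx : sg x = x) (hK : 0 ≤ K) {μ : ℝ} (hμ : 0 < μ)
    (hμK : μ * (K * (2 * (‖x‖ + 1))) ≤ 1 / 2) (m : ℕ) :
    Nc sg (2 * (C * (K * (2 * (‖x‖ + 1))) ^ m)) (fun y => ∑' n, μ ^ n • (fco f (n + m) • (SW Pa ω (x + y)) ^ (n + m))) ∧
    ∀ y, ‖y‖ ≤ 1 → Summable (fun n => μ ^ n • (fco f (n + m) • (SW Pa ω (x + y)) ^ (n + m))) := by
  have h : ∀ n, Nc sg (C * (K * (2 * (‖x‖ + 1))) ^ m * (K * (2 * (‖x‖ + 1))) ^ n)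
      (fun y => fco f (n + m) • (SW Pa ω (x + y)) ^ (n + m)) := fun n =>
    (fn_Nc hC (fun y => SW Pa ω (x + y)) (nc_wv x hx 0 (by simp) 1) (n + m)).mono (le_of_eq (by rw [pow_add]; ring))
  exact ⟨Nc.tsum h (by positivity) hμ hμK, fun y hy => Nc.summable h (by positivity) hμ hμK y hy⟩
end tl
end
end VdP

set_option linter.unusedSectionVars false
set_option linter.style.longLine false

namespace VdP
open scoped NNReal ENNReal
noncomputable section
open Filter Topology

section c1
variable {Pa : Set ℝ} {d : ℕ} {ρ : ℝ≥0} {ω : Fin d → ℝ}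

lemma JW_one : JW Pa ω (1 : Wal d ρ (Bf Pa)) = 1 := by rw [one_def]; exact JW_cst _
lemma SW_one : SW Pa ω (1 : Wal d ρ (Bf Pa)) = 1 := by rw [one_def]; exact SW_cst _
lemma J1W_one : J1W Pa ω (1 : Wal d ρ (Bf Pa)) = 0 := by rw [one_def]; exact J1W_cst _
lemma cf_one : cf (1 : Wal d ρ (Bf Pa)) 0 = 1 := by rw [one_def]; exact cf_bs_self _ _
lemma LW_smul (c : ℝ) (y : Wal d ρ (Bf Pa)) : LW Pa ω (c • y) = c • LW Pa ω y := by
  simp only [LW, map_smul, smul_sub, smul_add, mul_smul_comm]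
lemma LW_one : LW Pa ω (1 : Wal d ρ (Bf Pa)) = 0 := by rw [one_def]; exact LW_cst _

lemma Hn_zero (F : EE d → ℝ) (w : Fin 3 → Wal d ρ (Bf Pa)) : Hn F 0 w = gW Pa ρ (fc fun φ => F (φ, 0)) := by
  unfold Hn
  rw [Fintype.sum_unique]
  simp only [Finset.univ_eq_empty, Finset.prod_empty, mul_one]
  congr 2
  funext φ; exact gc_zero F _ φ

lemma cB_eq (x : ℝ) : cB Pa (x : ℂ) = x • (1 : Bf Pa) := bf_ext fun a => by
  rw [chi_cB, map_smul, chi_one]; simp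

set_option maxHeartbeats 1000000 in
theorem case1 [Nonempty (Pt Pa)] (hPa : Pa ⊆ Set.Icc (1/4 : ℝ) (5/4)) {κ γ δ b1 c0 : ℝ} (hκ : 0 < κ) (hγ : 0 < γ)
    (hP : ∀ a ∈ Pa, κ ≤ |hfun 0 (3 * b1 * c0 ^ 2) (c0 ^ 2) a| ∧ κ ≤ |(tau0 a - a) * (0 + 3 * b1 * c0 ^ 2)| ∧
        ∀ l : Idx d, γ * Real.exp (-(δ * nrm l)) ≤ |dotp l ω - omega0 a| ∧ γ * Real.exp (-(δ * nrm l)) ≤ |dotp l ω + omega0 a| ∧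
          γ * Real.exp (-(δ * nrm l)) ≤ |dotp l ω - 2 * omega0 a| ∧ γ * Real.exp (-(δ * nrm l)) ≤ |dotp l ω + 2 * omega0 a|)
    (hΩ : ∀ l : Idx d, l ≠ 0 → dotp l ω ≠ 0)
    (hρ0 : 0 < ρ) {F : EE d → ℝ} {C K ρ' r rf : ℝ} {f : ℝ → ℝ} (hρ : (ρ : ℝ) < ρ') (hr : 0 < r) (hrf : 0 < rf) (hC : 0 < C) (hK : 0 < K)
    (hc : ∀ n f k, ‖fc (gc F n f) k‖ ≤ C * K ^ n * Real.exp (-(ρ' * nrm k)))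
    (hh : ∀ n f φ, HasSum (fun k => fc (gc F n f) k * Complex.exp (Complex.I * (dotp k φ : ℝ))) ((gc F n f φ : ℝ) : ℂ))
    (hsum : ∀ φ z, ‖z‖ < r → HasSum (fun n => ∑ f : Fin n → Fin 3, gc F n f φ * ∏ j, zc z (f j)) (F (φ, z)))
    {Cf Kf : ℝ} (hCf0 : 0 < Cf) (hKf : 0 < Kf) (hCf : ∀ n, |fco f n| ≤ Cf * Kf ^ n)
    (hsumf : ∀ x, |x| < rf → HasSum (fun n => fco f n * x ^ n) (f x))
    (f0 : fco f 0 = 0) (f1 : fco f 1 = 1) (f2 : fco f 2 = 0) (f3 : fco f 3 = b1)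
    (hc0 : b1 * c0 ^ 3 + torusAvg d (fun φ => F (φ, 0)) = 0) :
    ∃ μ0 B : ℝ, 0 < μ0 ∧ 0 < B ∧ ∀ μ, 0 < μ → μ ≤ μ0 → ∀ a : Pt Pa, ∃ X, Good ω f F a.1 (μ ^ 3) (B * μ) X := by
  set m := torusAvg d (fun φ => F (φ, 0)) with hm
  set x : Wal d ρ (Bf Pa) := c0 • (1 : Wal d ρ (Bf Pa)) with hx
  have hxs : sg x = x := by rw [hx, map_smul, sg_one]
  have hx0 := norm_nonneg x
  obtain ⟨μR, hμR, hsm⟩ := small (A1 := 6 * K * (‖x‖ + 1)) (A2 := Kf * (2 * (‖x‖ + 1))) (A3 := ‖x‖ + 1) (r := r) (rf := rf)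
    (by positivity) (by positivity) (by positivity) hr hrf
  set H0 : Wal d ρ (Bf Pa) := gW Pa ρ (fc fun φ => F (φ, 0)) with hH0
  have hg0 : gc F 0 (fun i => i.elim0) = fun φ => F (φ, 0) := funext fun φ => gc_zero F _ φ
  have hc00 : ∀ k, ‖fc (fun φ => F (φ, 0)) k‖ ≤ C * Real.exp (-(ρ' * nrm k)) := fun k => by
    have := hc 0 (fun i => i.elim0) k
    rwa [hg0, pow_zero, mul_one] at this
  have hH0s : sg H0 = H0 := sg_gW hρ hc00 (fun k => fc_neg _ k)
  have hH00 : cf H0 0 = m • (1 : Bf Pa) := by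
    rw [hH0, cf_gW hρ hc00, fc_zero, ← hm, ← cB_eq]
    congr 1; simp [nrm]
  set rr : Wal d ρ (Bf Pa) := H0 - m • (1 : Wal d ρ (Bf Pa)) with hrr
  have rr0 : cf rr 0 = 0 := by rw [hrr, cf_sub, cf_smul, cf_one, hH00, sub_self]
  have rrs : sg rr = rr := by rw [hrr, map_sub, map_smul, sg_one, hH0s]
  have nJ : Nc sg 1 (fun y => JW Pa ω y) := Nc.lin (A := Wal d ρ (Bf Pa)) norm_JW zero_le_one sg_JW
  have nS : Nc sg 1 (fun y => SW Pa ω y) := Nc.lin (A := Wal d ρ (Bf Pa)) norm_SW zero_le_one sg_SW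
  have nD : Nc sg 1 (fun y => J1W Pa ω y) := Nc.lin (A := Wal d ρ (Bf Pa)) norm_J1W zero_le_one sg_J1W
  have nA : Nc (A := Wal d ρ (Bf Pa)) sg 2 (fun y => -aW Pa) :=
    Nc.const (by rw [norm_neg]; exact norm_aW hPa) (by rw [map_neg, sg_aW hPa])
  have q1 := Qc.of_mul sg_mul (nA.mul sg_mul ((nJ.smul (2 * c0)).add (nJ.mul sg_mul nJ))) nD (by simp) (by simp)
  have q2 := Qc.of_mul sg_mul (((nS.smul (3 * c0)).add (nS.mul sg_mul nS)).smul b1) nS (by simp) (by simp)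
  have q := q1.add q2
  set Q : Wal d ρ (Bf Pa) → Wal d ρ (Bf Pa) := fun y => -aW Pa * ((2 * c0) • JW Pa ω y + JW Pa ω y * JW Pa ω y) * J1W Pa ω y
    + (b1 • ((3 * c0) • SW Pa ω y + SW Pa ω y * SW Pa ω y)) * SW Pa ω y with hQ
  set N : ℝ → Wal d ρ (Bf Pa) → Wal d ρ (Bf Pa) := fun μ y =>
    (∑' n, μ ^ n • (fco f (n + 4) • (SW Pa ω (x + y)) ^ (n + 4))) + ∑' n, μ ^ n • Hn F (n + 1) (wv Pa ω (x + y) (μ ^ 3 / μ)) with hN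
  have he : ∀ μ, 0 < μ → μ ≤ μR → |μ ^ 3 / μ| ≤ 1 := fun μ h0 h1 => by
    have e : μ ^ 3 / μ = μ ^ 2 := by field_simp
    rw [e, abs_of_pos (by positivity)]
    exact pow_le_one₀ h0.le (hsm μ h0 h1).1
  have nN : ∀ μ, 0 < μ → μ ≤ μR → Nc sg _ (N μ) := fun μ h0 h1 =>
    (nc_tf hCf x hxs hKf.le h0 (hsm μ h0 h1).2.2.1 4).1.add (nc_tH hρ hc x hxs _ (he μ h0 h1) hK.le h0 (hsm μ h0 h1).2.1 1).1
  have hS0 := Sd_nonneg d (ρ' - ρ)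
  have hR := fun μ (h0 : 0 < μ) (h1 : μ ≤ μR) => rest_bd q (nN μ h0 h1) h0 (by positivity)
  obtain ⟨μ0, hμ0, hμ0R, hy⟩ := master hPa hκ hγ hP hΩ (fun μ => μ ^ 2)
    (fun μ h0 h1 => ⟨by positivity, by nlinarith⟩) 0 0 rr (cf_zero 0) (cf_zero 0) rr0 (map_zero _) (map_zero _) rrs
    (fun μ y => Q y + μ • N μ y) (by positivity) hμR (fun μ h0 h1 => (hR μ h0 h1).1) (fun μ h0 h1 => (hR μ h0 h1).2.1)
    (fun μ h0 h1 => (hR μ h0 h1).2.2)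
  refine ⟨μ0, ‖x‖ + 1, hμ0, by positivity, fun μ h0 h1 a => ?_⟩
  obtain ⟨y, hy1, hys, hyL⟩ := hy μ h0 h1
  have h1' := h1.trans hμ0R
  obtain ⟨s1, s2, s3, s4, s5, s6⟩ := hsm μ h0 h1'
  have hv : ‖x + y‖ ≤ ‖x‖ + 1 := (norm_add_le _ _).trans (by gcongr)
  have hSf := (nc_tf (ω := ω) hCf x hxs hKf.le h0 s3 0).2 y hy1
  have hSH := (nc_tH (ω := ω) hρ hc x hxs _ (he μ h0 h1') hK.le h0 s2 0).2 y hy1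
  simp only [add_zero] at hSf hSH
  have hgood := sol (ω := ω) hρ0 hPa hρ hc hh hsum hsumf a (x + y) (by rw [map_add, hxs, hys]) (ε := μ ^ 3) h0
    ((mul_le_mul_of_nonneg_left hv h0.le).trans_lt s4) ((mul_le_mul_of_nonneg_left hv h0.le).trans_lt s5)
    (by
      rw [abs_of_pos (by positivity)]
      refine lt_of_le_of_lt ?_ s6
      calc μ ^ 3 = μ * μ ^ 2 := by ring
        _ ≤ μ * 1 := by gcongr; exact pow_le_one₀ h0.le s1
        _ = μ := mul_one μ) hSf hSH ?_
  · obtain ⟨g1, g2, g3, g4, g5⟩ := hgood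
    refine ⟨_, g1, g2, fun φ => (g3 φ).trans ?_, g4, g5⟩
    rw [mul_comm]; gcongr
  · rw [split_sum _ μ 4 hSf, split_sum _ μ 1 hSH]
    simp only [Finset.sum_range_succ, Finset.sum_range_zero, f0, f1, f2, f3, Hn_zero]
    have := alg1 μ c0 b1 m hc0 (aW Pa) (JW Pa ω y) (SW Pa ω y) (J1W Pa ω y) H0
      (∑' n, μ ^ n • (fco f (n + 4) • (SW Pa ω (x + y)) ^ (n + 4))) (∑' n, μ ^ n • Hn F (n + 1) (wv Pa ω (x + y) (μ ^ 3 / μ)))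
      (LW Pa ω y) rr hrr hyL
    have eJ : JW Pa ω (x + y) = c0 • 1 + JW Pa ω y := by rw [map_add, hx, map_smul, JW_one]
    have eS : SW Pa ω (x + y) = c0 • 1 + SW Pa ω y := by rw [map_add, hx, map_smul, SW_one]
    have eD : J1W Pa ω (x + y) = J1W Pa ω y := by rw [map_add, hx, map_smul, J1W_one, smul_zero, zero_add]
    have eL : LW Pa ω (x + y) = LW Pa ω y := by rw [LW_add, hx, LW_smul, LW_one, smul_zero, zero_add]
    rw [eL, eD, this]
    simp only [eJ, eS, zero_smul, smul_zero, zero_add, add_zero, one_smul, pow_one, pow_zero, ← hH0]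
end c1
end
end VdP

set_option linter.unusedSectionVars false
set_option linter.style.longLine false

namespace VdP
open scoped NNReal ENNReal
noncomputable section
open Filter Topology

lemma dioph_exp {d : ℕ} {ω : Fin d → ℝ} {γ0 δ : ℝ} (hγ0 : 0 < γ0) (hδ : 0 < δ) (p : ℕ)
    (h : ∀ k : Idx d, k ≠ 0 → γ0 * ((nrm k) ^ p)⁻¹ ≤ |dotp k ω|) :
    ∃ γ1 : ℝ, 0 < γ1 ∧ ∀ k : Idx d, k ≠ 0 → γ1 * Real.exp (-(δ * nrm k)) ≤ |dotp k ω| := by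
  refine ⟨γ0 * (δ ^ p / p.factorial), by positivity, fun k hk => le_trans ?_ (h k hk)⟩
  rw [mul_assoc]
  refine mul_le_mul_of_nonneg_left ?_ hγ0.le
  have hn := nrm_nonneg k
  have h1 := Real.pow_div_factorial_le_exp (δ * nrm k) (by positivity) p
  rcases hn.eq_or_lt with h0 | h0
  · exfalso
    apply hk
    funext i
    have : |(k i : ℝ)| ≤ 0 := by
      rw [h0]; exact Finset.single_le_sum (f := fun i => |(k i : ℝ)|) (fun i _ => abs_nonneg _) (Finset.mem_univ i)
    simpa using abs_nonpos_iff.1 this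
  · rw [Real.exp_neg, ← div_eq_mul_inv, div_le_iff₀ (Real.exp_pos _), ← div_eq_inv_mul, le_div_iff₀ (by positivity)]
    calc _ = (δ * nrm k) ^ p / p.factorial := by rw [mul_pow]; ring
      _ ≤ _ := h1

section c2
variable {Pa : Set ℝ} {d : ℕ} {ρ : ℝ≥0} {ω : Fin d → ℝ}

/-- Symbol of the inverse. -/
def sV (a Ω : ℝ) : ℂ := ((1 + Ω ^ 2 : ℝ) : ℂ) / Lsym a (tau0 a) Ω

lemma sV_neg (a Ω : ℝ) : sV a (-Ω) = (starRingEnd ℂ) (sV a Ω) := by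
  unfold sV
  rw [Lsym_neg, map_div₀, Complex.conj_ofReal, neg_sq]

set_option maxHeartbeats 1000000 in
theorem exists_x1 (hPa : Pa ⊆ Set.Icc (1/4 : ℝ) (5/4)) {α β ζ κ γ γ1 δ δ2 C : ℝ} (hκ : 0 < κ) (hγ : 0 < γ) (hγ1 : 0 < γ1)
    (hγle : γ ≤ 1) (hδ0 : 0 < δ)
    (hP : ∀ a ∈ Pa, κ ≤ |hfun α β ζ a| ∧ κ ≤ |(tau0 a - a) * (α + β)| ∧
        ∀ l : Idx d, γ * Real.exp (-(δ * nrm l)) ≤ |dotp l ω - omega0 a| ∧ γ * Real.exp (-(δ * nrm l)) ≤ |dotp l ω + omega0 a| ∧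
          γ * Real.exp (-(δ * nrm l)) ≤ |dotp l ω - 2 * omega0 a| ∧ γ * Real.exp (-(δ * nrm l)) ≤ |dotp l ω + 2 * omega0 a|)
    (hΩ : ∀ l : Idx d, l ≠ 0 → γ1 * Real.exp (-(δ * nrm l)) ≤ |dotp l ω|)
    (hδ : δ < δ2) (hC : 0 ≤ C) (G : Wal d ρ (Bf Pa)) (hG : ∀ k, ‖cf G k‖ ≤ C * Real.exp (-(δ2 * nrm k))) (G0 : cf G 0 = 0) (Gs : sg G = G) :
    ∃ x1 : Wal d ρ (Bf Pa), sg x1 = x1 ∧ LW Pa ω x1 = G := by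
  obtain ⟨c, s0, hc, hs0, hs01, hh⟩ := hyp α β ζ κ hκ
  set γm := min γ γ1 with hγm
  have hγm0 : 0 < γm := lt_min hγ hγ1
  have hL : ∀ l : Idx d, l ≠ 0 → ∀ a ∈ Pa, c * (1 + dotp l ω ^ 2) * (γm * Real.exp (-(δ * nrm l))) ≤ ‖Lsym a (tau0 a) (dotp l ω)‖ := by
    intro l hl a ha
    have h1 := hh a (hPa ha).1 (hPa ha).2 (hP a ha).1 (hP a ha).2.1 0 le_rfl hs0.le (dotp l ω)
    rw [Complex.ofReal_zero, zero_mul, sub_zero, zero_add] at h1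
    refine le_trans ?_ h1
    refine mul_le_mul_of_nonneg_left ?_ (by positivity)
    have e0 := Real.exp_pos (-(δ * nrm l))
    have e1 : Real.exp (-(δ * nrm l)) ≤ 1 := Real.exp_le_one_iff.2 (by have := nrm_nonneg l; nlinarith)
    have m1 : γm * Real.exp (-(δ * nrm l)) ≤ γ * Real.exp (-(δ * nrm l)) := by gcongr; exact min_le_left _ _
    have m2 : γm * Real.exp (-(δ * nrm l)) ≤ γ1 * Real.exp (-(δ * nrm l)) := by gcongr; exact min_le_right _ _
    refine Dres_ge (m1.trans (by nlinarith)) (m2.trans (hΩ l hl)) (m1.trans ((hP a ha).2.2 l).1) (m1.trans ((hP a ha).2.2 l).2.1)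
  have hV : ∀ l : Idx d, l ≠ 0 → ∀ a ∈ Pa, ‖sV a (dotp l ω)‖ ≤ (c * γm)⁻¹ * Real.exp (δ * nrm l) := by
    intro l hl a ha
    have h1 := hL l hl a ha
    unfold sV
    rw [norm_div, Complex.norm_real, Real.norm_of_nonneg (by positivity)]
    calc _ ≤ (1 + dotp l ω ^ 2) / (c * (1 + dotp l ω ^ 2) * (γm * Real.exp (-(δ * nrm l)))) := by gcongr
      _ = _ := by rw [Real.exp_neg]; field_simp
  have hX : ∀ k : Idx d, ‖sy Pa ω sV k * cf G k‖ ≤ (c * γm)⁻¹ * C * Real.exp (-((δ2 - δ) * nrm k)) := by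
    intro k
    by_cases hk : k = 0
    · subst hk; rw [G0, mul_zero, norm_zero]; positivity
    · refine (norm_mul_le _ _).trans ?_
      calc _ ≤ ((c * γm)⁻¹ * Real.exp (δ * nrm k)) * (C * Real.exp (-(δ2 * nrm k))) := by
            gcongr
            · exact norm_mkB_le (by positivity) (hV k hk)
            · exact hG k
        _ = (c * γm)⁻¹ * C * (Real.exp (δ * nrm k) * Real.exp (-(δ2 * nrm k))) := by ring
        _ = _ := by rw [← Real.exp_add]; congr 2; ring
  have hS : Summable fun k : Idx d => ‖sy Pa ω sV k * cf G k‖ :=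
    Summable.of_nonneg_of_le (fun _ => norm_nonneg _) hX ((summable_exp_nrm (sub_pos.2 hδ) d).mul_left _)
  refine ⟨mkW (fun k => sy Pa ω sV k * cf G k) hS, ?_, ?_⟩
  · refine cf_ext fun k => ?_
    rw [cf_sg, cf_mkW, cf_mkW]
    by_cases hk : k = 0
    · subst hk; rw [neg_zero, G0, mul_zero, star_zero]
    · have hk' : -k ≠ 0 := neg_ne_zero.2 hk
      have hGk : star (cf G (-k)) = cf G k := by rw [← cf_sg, Gs]
      rw [star_mul, hGk, mul_comm]
      congr 1
      refine bf_ext fun a => ?_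
      rw [chi_star]
      have e1 : chi a (sy Pa ω sV k) = sV a.1 (dotp k ω) := mkB_apply (hV k hk) a
      have e2 : chi a (sy Pa ω sV (-k)) = sV a.1 (dotp (-k) ω) := mkB_apply (hV (-k) hk') a
      rw [e1, e2, dotp_neg, sV_neg, Complex.conj_conj]
  · refine wal_ext fun k a => ?_
    rw [chi_LW hPa, cf_mkW, chi_mul]
    by_cases hk : k = 0
    · subst hk; rw [G0, map_zero, mul_zero, mul_zero]
    · have e1 : chi a (sy Pa ω sV k) = sV a.1 (dotp k ω) := mkB_apply (hV k hk) a
      rw [e1, sV]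
      have hL0 : Lsym a.1 (tau0 a.1) (dotp k ω) ≠ 0 := by
        rw [← norm_pos_iff]
        exact lt_of_lt_of_le (by positivity) (hL k hk a.1 a.2)
      have h2 : ((1 + dotp k ω ^ 2 : ℝ) : ℂ) ≠ 0 := by
        rw [Ne, Complex.ofReal_eq_zero]; positivity
      rw [Complex.ofReal_inv]
      field_simp

lemma Hn_one (F : EE d → ℝ) (w : Fin 3 → Wal d ρ (Bf Pa)) : Hn F 1 w =
    gW Pa ρ (fc (gc F 1 fun _ => 0)) * w 0 + gW Pa ρ (fc (gc F 1 fun _ => 1)) * w 1 + gW Pa ρ (fc (gc F 1 fun _ => 2)) * w 2 := by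
  unfold Hn
  rw [← (Equiv.funUnique (Fin 1) (Fin 3)).symm.sum_comp, Fin.sum_univ_three]
  simp only [Fin.prod_univ_one]
  rfl

end c2
end
end VdP

set_option linter.unusedSectionVars false
set_option linter.style.longLine false

namespace VdP
open scoped NNReal ENNReal
noncomputable section
open Filter Topology

section c2b
variable {Pa : Set ℝ} {d : ℕ} {ρ : ℝ≥0} {ω : Fin d → ℝ}

set_option maxHeartbeats 2000000 in
theorem case2 [Nonempty (Pt Pa)] (hPa : Pa ⊆ Set.Icc (1/4 : ℝ) (5/4)) {κ γ γ1 δ α β : ℝ} (hκ : 0 < κ) (hγ : 0 < γ) (hγle : γ ≤ 1)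
    (hγ1 : 0 < γ1) (hδ0 : 0 < δ)
    (hP : ∀ a ∈ Pa, κ ≤ |hfun α β 0 a| ∧ κ ≤ |(tau0 a - a) * (α + β)| ∧
        ∀ l : Idx d, γ * Real.exp (-(δ * nrm l)) ≤ |dotp l ω - omega0 a| ∧ γ * Real.exp (-(δ * nrm l)) ≤ |dotp l ω + omega0 a| ∧
          γ * Real.exp (-(δ * nrm l)) ≤ |dotp l ω - 2 * omega0 a| ∧ γ * Real.exp (-(δ * nrm l)) ≤ |dotp l ω + 2 * omega0 a|)
    (hΩ1 : ∀ l : Idx d, l ≠ 0 → γ1 * Real.exp (-(δ * nrm l)) ≤ |dotp l ω|)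
    (hρ0 : 0 < ρ) {F : EE d → ℝ} {C K ρ' r rf : ℝ} {f : ℝ → ℝ} (hρ : (ρ : ℝ) < ρ') (hρδ : δ < ρ' - ρ) (hr : 0 < r) (hrf : 0 < rf) (hC : 0 < C) (hK : 0 < K)
    (hc : ∀ n f k, ‖fc (gc F n f) k‖ ≤ C * K ^ n * Real.exp (-(ρ' * nrm k)))
    (hh : ∀ n f φ, HasSum (fun k => fc (gc F n f) k * Complex.exp (Complex.I * (dotp k φ : ℝ))) ((gc F n f φ : ℝ) : ℂ))
    (hsum : ∀ φ z, ‖z‖ < r → HasSum (fun n => ∑ f : Fin n → Fin 3, gc F n f φ * ∏ j, zc z (f j)) (F (φ, z)))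
    {Cf Kf : ℝ} (hCf0 : 0 < Cf) (hKf : 0 < Kf) (hCf : ∀ n, |fco f n| ≤ Cf * Kf ^ n)
    (hsumf : ∀ x, |x| < rf → HasSum (fun n => fco f n * x ^ n) (f x))
    (f0 : fco f 0 = 0) (f1 : fco f 1 = 1) (f2 : fco f 2 = 0)
    (hm0 : torusAvg d (fun φ => F (φ, 0)) = 0)
    (hα : torusAvg d (gc F 1 fun _ => 0) = α) (hβ : torusAvg d (gc F 1 fun _ => 1) = β) (hαβ : α + β ≠ 0) :
    ∃ μ0 B : ℝ, 0 < μ0 ∧ 0 < B ∧ ∀ μ, 0 < μ → μ ≤ μ0 → ∀ a : Pt Pa, ∃ X, Good ω f F a.1 μ (B * μ) X := by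
  have hΩ : ∀ l : Idx d, l ≠ 0 → dotp l ω ≠ 0 := fun l hl => abs_pos.1 (lt_of_lt_of_le (by positivity) (hΩ1 l hl))
  set H0 : Wal d ρ (Bf Pa) := gW Pa ρ (fc fun φ => F (φ, 0)) with hH0
  have hg0 : gc F 0 (fun i => i.elim0) = fun φ => F (φ, 0) := funext fun φ => gc_zero F _ φ
  have hc00 : ∀ k, ‖fc (fun φ => F (φ, 0)) k‖ ≤ C * Real.exp (-(ρ' * nrm k)) := fun k => by
    have := hc 0 (fun i => i.elim0) k
    rwa [hg0, pow_zero, mul_one] at this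
  have hH0s : sg H0 = H0 := sg_gW hρ hc00 (fun k => fc_neg _ k)
  have hH00 : cf H0 0 = 0 := by
    rw [hH0, cf_gW hρ hc00, fc_zero, hm0]
    exact bf_ext fun a => by rw [chi_cB]; simp
  obtain ⟨x1, hx1s, hx1L⟩ := exists_x1 (ω := ω) hPa hκ hγ hγ1 hγle hδ0 hP hΩ1 hρδ hC.le H0
    (fun k => by rw [hH0, cf_gW hρ hc00]; exact gW_term hρ hc00 k) hH00 hH0s
  set G1 : Wal d ρ (Bf Pa) := gW Pa ρ (fc (gc F 1 fun _ => 0)) with hG1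
  set G2 : Wal d ρ (Bf Pa) := gW Pa ρ (fc (gc F 1 fun _ => 1)) with hG2
  set G3 : Wal d ρ (Bf Pa) := gW Pa ρ (fc (gc F 1 fun _ => 2)) with hG3
  have hG1s : sg G1 = G1 := sg_gWF hρ hc 1 _
  have hG2s : sg G2 = G2 := sg_gWF hρ hc 1 _
  have hG3s : sg G3 = G3 := sg_gWF hρ hc 1 _
  have hG10 : cf G1 0 = α • (1 : Bf Pa) := by
    rw [hG1, cf_gW hρ (hc 1 _), fc_zero, hα, ← cB_eq]
    congr 1; simp [nrm]
  have hG20 : cf G2 0 = β • (1 : Bf Pa) := by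
    rw [hG2, cf_gW hρ (hc 1 _), fc_zero, hβ, ← cB_eq]
    congr 1; simp [nrm]
  set h1 : Wal d ρ (Bf Pa) := G1 - α • (1 : Wal d ρ (Bf Pa)) with hh1
  set h2 : Wal d ρ (Bf Pa) := G2 - β • (1 : Wal d ρ (Bf Pa)) with hh2
  have h10 : cf h1 0 = 0 := by rw [hh1, cf_sub, cf_smul, cf_one, hG10, sub_self]
  have h20 : cf h2 0 = 0 := by rw [hh2, cf_sub, cf_smul, cf_one, hG20, sub_self]
  have h1s : sg h1 = h1 := by rw [hh1, map_sub, map_smul, sg_one, hG1s]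
  have h2s : sg h2 = h2 := by rw [hh2, map_sub, map_smul, sg_one, hG2s]
  have eG1 : h1 + α • (1 : Wal d ρ (Bf Pa)) = G1 := by rw [hh1]; abel
  have eG2 : h2 + β • (1 : Wal d ρ (Bf Pa)) = G2 := by rw [hh2]; abel
  set P : Wal d ρ (Bf Pa) := G1 * JW Pa ω x1 + G2 * SW Pa ω x1 + G3 with hPdef
  have hPs : sg P = P := by
    rw [hPdef, map_add, map_add, sg_mul, sg_mul, sg_JW, sg_SW, hx1s, hG1s, hG2s, hG3s]
  set z : Bf Pa := (-(α + β)⁻¹) • cf P 0 with hz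
  have hP0 : star (cf P 0) = cf P 0 := by
    have := cf_sg P 0
    rw [hPs, neg_zero] at this
    exact this.symm
  have hzs : star z = z := by rw [hz, star_smul, hP0]; simp
  set x : Wal d ρ (Bf Pa) := x1 + cst z with hx
  have hxs : sg x = x := by rw [hx, map_add, hx1s, sg_cst, hzs]
  have hx0 := norm_nonneg x
  have xJ : JW Pa ω x = JW Pa ω x1 + cst z := by rw [hx, map_add, JW_cst]
  have xS : SW Pa ω x = SW Pa ω x1 + cst z := by rw [hx, map_add, SW_cst]
  have xL : LW Pa ω x = H0 := by rw [hx, LW_add, LW_cst, add_zero, hx1L]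
  obtain ⟨μR, hμR, hsm⟩ := small (A1 := 6 * K * (‖x‖ + 1)) (A2 := Kf * (2 * (‖x‖ + 1))) (A3 := ‖x‖ + 1) (r := r) (rf := rf)
    (by positivity) (by positivity) (by positivity) hr hrf
  set rr : Wal d ρ (Bf Pa) := (h1 + α • (1 : Wal d ρ (Bf Pa))) * JW Pa ω x + (h2 + β • (1 : Wal d ρ (Bf Pa))) * SW Pa ω x + G3 with hrr
  have rrP : rr = P + (cst z * G1 + cst z * G2) := by
    rw [hrr, eG1, eG2, xJ, xS, hPdef, mul_add, mul_add, mul_comm G1 (cst z), mul_comm G2 (cst z)]; abel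
  have rr0 : cf rr 0 = 0 := by
    rw [rrP, cf_add P, cf_add (cst z * G1) (cst z * G2), cst_mul_cf, cst_mul_cf, hG10, hG20, mul_smul_comm, mul_smul_comm, mul_one, ← add_smul, hz, smul_smul,
      mul_neg, mul_inv_cancel₀ hαβ, neg_one_smul, add_neg_cancel]
  have rrs : sg rr = rr := by
    rw [hrr, eG1, eG2, map_add, map_add, sg_mul, sg_mul, sg_JW, sg_SW, hxs, hG1s, hG2s, hG3s]
  have q : Qc (A := Wal d ρ (Bf Pa)) sg 0 (fun _ => 0) := ⟨rfl, fun δ _ _ y y' _ _ => by simp, fun _ _ _ => map_zero _⟩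
  set N : ℝ → Wal d ρ (Bf Pa) → Wal d ρ (Bf Pa) := fun μ y =>
    -(aW Pa * ((JW Pa ω x + JW Pa ω y) ^ 2 * (J1W Pa ω x + J1W Pa ω y))) +
    ((∑' n, μ ^ n • (fco f (n + 3) • (SW Pa ω (x + y)) ^ (n + 3))) + ∑' n, μ ^ n • Hn F (n + 2) (wv Pa ω (x + y) (μ / μ))) with hN
  have he : ∀ μ : ℝ, 0 < μ → |μ / μ| ≤ 1 := fun μ h0 => by rw [div_self h0.ne']; simp
  have nJ : Nc sg (‖x‖ + 1) (fun y => JW Pa ω x + JW Pa ω y) := by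
    have := nc_wv (ω := ω) x hxs 0 (by simp) 0
    simpa [wv, map_add] using this
  have nD : Nc sg (‖x‖ + 1) (fun y => J1W Pa ω x + J1W Pa ω y) := by
    have := nc_D (ω := ω) x hxs
    simpa [map_add] using this
  have nA : Nc (A := Wal d ρ (Bf Pa)) sg 2 (fun y => -aW Pa) :=
    Nc.const (by rw [norm_neg]; exact norm_aW hPa) (by rw [map_neg, sg_aW hPa])
  have n1 := nA.mul sg_mul ((nJ.mul sg_mul nJ).mul sg_mul nD)
  have e1 : (fun y => -aW Pa * ((JW Pa ω x + JW Pa ω y) * (JW Pa ω x + JW Pa ω y) * (J1W Pa ω x + J1W Pa ω y))) =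
      fun y => -(aW Pa * ((JW Pa ω x + JW Pa ω y) ^ 2 * (J1W Pa ω x + J1W Pa ω y))) := by
    funext y; rw [neg_mul, pow_two]
  rw [e1] at n1
  have nN : ∀ μ, 0 < μ → μ ≤ μR → Nc sg _ (N μ) := fun μ h0 h1 =>
    n1.add ((nc_tf hCf x hxs hKf.le h0 (hsm μ h0 h1).2.2.1 3).1.add (nc_tH hρ hc x hxs _ (he μ h0) hK.le h0 (hsm μ h0 h1).2.1 2).1)
  have hS0 := Sd_nonneg d (ρ' - ρ)
  have hR := fun μ (h0 : 0 < μ) (h1 : μ ≤ μR) => rest_bd q (nN μ h0 h1) h0 le_rfl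
  obtain ⟨μ0, hμ0, hμ0R, hy⟩ := master hPa hκ hγ hP hΩ (fun μ => μ)
    (fun μ h0 h1 => ⟨h0, le_rfl⟩) h1 h2 rr h10 h20 rr0 h1s h2s rrs
    (fun μ y => 0 + μ • N μ y) (by positivity) hμR (fun μ h0 h1 => (hR μ h0 h1).1) (fun μ h0 h1 => (hR μ h0 h1).2.1)
    (fun μ h0 h1 => (hR μ h0 h1).2.2)
  refine ⟨μ0, ‖x‖ + 1, hμ0, by positivity, fun μ h0 hle a => ?_⟩
  obtain ⟨y, hy1, hys, hyL⟩ := hy μ h0 hle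
  have hle' := hle.trans hμ0R
  obtain ⟨s1, s2, s3, s4, s5, s6⟩ := hsm μ h0 hle'
  have hv : ‖x + y‖ ≤ ‖x‖ + 1 := (norm_add_le _ _).trans (by gcongr)
  have hSf := (nc_tf (ω := ω) hCf x hxs hKf.le h0 s3 0).2 y hy1
  have hSH := (nc_tH (ω := ω) hρ hc x hxs _ (he μ h0) hK.le h0 s2 0).2 y hy1
  simp only [add_zero] at hSf hSH
  have hgood := sol (ω := ω) hρ0 hPa hρ hc hh hsum hsumf a (x + y) (by rw [map_add, hxs, hys]) (ε := μ) h0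
    ((mul_le_mul_of_nonneg_left hv h0.le).trans_lt s4) ((mul_le_mul_of_nonneg_left hv h0.le).trans_lt s5)
    (by rwa [abs_of_pos h0]) hSf hSH ?_
  · obtain ⟨g1, g2, g3, g4, g5⟩ := hgood
    refine ⟨_, g1, g2, fun φ => (g3 φ).trans ?_, g4, g5⟩
    rw [mul_comm]; gcongr
  · rw [split_sum _ μ 3 hSf, split_sum _ μ 2 hSH]
    have hw : Hn F 1 (wv Pa ω (x + y) (μ / μ)) = G1 * (JW Pa ω x + JW Pa ω y) + G2 * (SW Pa ω x + SW Pa ω y) + G3 := by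
      rw [Hn_one]
      simp only [wv, Matrix.cons_val_zero, Matrix.cons_val_one, Matrix.cons_val, map_add, div_self h0.ne', one_smul, mul_one, ← hG1, ← hG2, ← hG3]
    simp only [Finset.sum_range_succ, Finset.sum_range_zero, f0, f1, f2, Hn_zero, hw]
    have := alg2 μ α β (aW Pa) (JW Pa ω y) (SW Pa ω y) (J1W Pa ω y) (JW Pa ω x) (SW Pa ω x) (J1W Pa ω x) H0 h1 h2 G3
      (∑' n, μ ^ n • (fco f (n + 3) • (SW Pa ω (x + y)) ^ (n + 3))) (∑' n, μ ^ n • Hn F (n + 2) (wv Pa ω (x + y) (μ / μ)))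
      (LW Pa ω y) (LW Pa ω x) rr xL hrr hyL
    rw [eG1, eG2] at this
    rw [LW_add, this]
    simp only [map_add, zero_smul, smul_zero, zero_add, add_zero, one_smul, pow_one, pow_zero, ← hH0]
end c2b
end
end VdP

set_option linter.unusedSectionVars false
set_option linter.style.longLine false

namespace VdP
open scoped NNReal ENNReal
noncomputable section
open Filter Topology

lemma exists_cube (b1 m : ℝ) (hb : b1 ≠ 0) (hm : m ≠ 0) : ∃ c : ℝ, c ≠ 0 ∧ b1 * c ^ 3 + m = 0 := by
  have key : ∀ s : ℝ, ∃ c : ℝ, c ^ 3 = s := by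
    have hpos : ∀ s : ℝ, 0 ≤ s → ∃ c : ℝ, c ^ 3 = s := fun s hs => by
      refine ⟨s ^ ((1:ℝ) / 3), ?_⟩
      rw [← Real.rpow_natCast, ← Real.rpow_mul hs]; norm_num
    intro s
    rcases le_total 0 s with h | h
    · exact hpos s h
    · obtain ⟨c, hc⟩ := hpos (-s) (by linarith)
      exact ⟨-c, by rw [Odd.neg_pow (by decide), hc]; ring⟩
  obtain ⟨c, hc⟩ := key (-m / b1)
  refine ⟨c, ?_, by rw [hc]; field_simp; ring⟩
  rintro rfl
  have : -m / b1 ≠ 0 := div_ne_zero (neg_ne_zero.2 hm) hb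
  exact this (by rw [← hc]; norm_num)

lemma gc_cont {d : ℕ} (F : EE d → ℝ) (hF : AnalyticOnNhd ℝ F Set.univ) (n : ℕ) (f : Fin n → Fin 3) : Continuous (gc F n f) := by
  have hcd : ContDiff ℝ ⊤ F := hF.contDiff
  have h1 : Continuous (iteratedFDeriv ℝ n F) := hcd.continuous_iteratedFDeriv (mod_cast le_top)
  unfold gc
  refine continuous_const.mul ?_
  have h2 : Continuous fun φ : Fin d → ℝ => iteratedFDeriv ℝ n F (φ, 0) := h1.comp (by fun_prop)
  exact (ContinuousMultilinearMap.apply ℝ _ _ _).continuous.comp h2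

lemma torusAvg_add {d : ℕ} {u v : (Fin d → ℝ) → ℝ} (hu : Continuous u) (hv : Continuous v) :
    torusAvg d (fun φ => u φ + v φ) = torusAvg d u + torusAvg d v := by
  have hK : IsCompact (Set.pi Set.univ (fun _ : Fin d => Set.Icc (0 : ℝ) (2 * Real.pi))) := isCompact_univ_pi fun _ => isCompact_Icc
  unfold torusAvg
  rw [integral_add (hu.continuousOn.integrableOn_compact hK) (hv.continuousOn.integrableOn_compact hK), mul_add]

theorem main (n0 : ℕ) (ω : Fin n0 → ℝ) (γ0 : ℝ) (hγ0 : 0 < γ0)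
    (hDioph : ∀ k : Idx n0, k ≠ 0 → γ0 * ((nrm k) ^ (n0 + 1))⁻¹ ≤ |dotp k ω|)
    (f : ℝ → ℝ) (b1 : ℝ) (F : EE n0 → ℝ) (hfanal : AnalyticOnNhd ℝ f Set.univ) (hF : AnalyticOnNhd ℝ F Set.univ) (hp : PerE F)
    (hf0 : f 0 = 0) (hf1 : deriv f 0 = 1) (hf2 : iteratedDeriv 2 f 0 = 0) (hf3 : iteratedDeriv 3 f 0 = 6 * b1) (hb1 : b1 ≠ 0)
    (hH4 : torusAvg n0 (fun φ => F (φ, 0)) ≠ 0 ∨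
      torusAvg n0 (fun φ => gc F 1 (fun _ => 0) φ + gc F 1 (fun _ => 1) φ) ≠ 0) (η : ℝ) (hη : 0 < η) :
    ∃ εstar : ℝ, 0 < εstar ∧ ∃ C : ℝ, 0 < C ∧
    ∃ Pa : Set ℝ, MeasurableSet Pa ∧ Pa ⊆ Set.Icc (1 / 4 : ℝ) (5 / 4) ∧
      volume (Set.Icc (1 / 4 : ℝ) (5 / 4)) ≤ volume Pa + ENNReal.ofReal η ∧
      ∀ a ∈ Pa, ∀ ε : ℝ, 0 < ε → ε ≤ εstar → ∃ X, Good ω f F a ε (C * ε ^ ((1:ℝ) / 3)) X := by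
  obtain ⟨r, C, K, ρ', hr, hC, hK, hρ', hc, -, hsum, hh⟩ := g_expansion F hF hp
  obtain ⟨rf, Cf, Kf, hrf, hCf0, hKf, hCf, hsumf⟩ := f_expansion (hfanal 0 trivial)
  have f0 : fco f 0 = 0 := by simp [fco, hf0]
  have f1 : fco f 1 = 1 := by simp [fco, hf1]
  have f2 : fco f 2 = 0 := by simp [fco, hf2]
  have f3 : fco f 3 = b1 := by rw [fco, hf3]; norm_num [Nat.factorial]
  set δ : ℝ := ρ' / 4 with hδ
  have hδ0 : 0 < δ := by positivity
  set ρ : ℝ≥0 := ⟨ρ' / 4, by positivity⟩ with hρdef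
  have hρe : (ρ : ℝ) = ρ' / 4 := rfl
  have hρ0 : 0 < ρ := by rw [← NNReal.coe_pos, hρe]; positivity
  have hρ : (ρ : ℝ) < ρ' := by rw [hρe]; linarith
  have hρδ : δ < ρ' - ρ := by rw [hρe, hδ]; linarith
  obtain ⟨γ1, hγ1, hΩ1⟩ := dioph_exp hγ0 hδ0 (n0 + 1) hDioph
  by_cases hm : torusAvg n0 (fun φ => F (φ, 0)) = 0
  · have h4 := hH4.resolve_left (fun h => h hm)
    rw [torusAvg_add (gc_cont F hF 1 _) (gc_cont F hF 1 _)] at h4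
    obtain ⟨κ, γ, hκ, hγ, hγle, Pa, hPm, hPa, hPv, hP⟩ := good_set (fun l : Idx n0 => dotp l ω) _ _ 0 h4 (Or.inr rfl) hδ0 hη
    by_cases hne : Nonempty (Pt Pa)
    · obtain ⟨μ0, B, hμ0, hB, h⟩ := case2 (ρ := ρ) hPa hκ hγ hγle hγ1 hδ0 hP hΩ1 hρ0 hρ hρδ hr hrf hC hK hc hh hsum hCf0 hKf hCf hsumf
        f0 f1 f2 hm rfl rfl h4
      refine ⟨min μ0 1, by positivity, B, hB, Pa, hPm, hPa, hPv, fun a ha ε h0 hε => ?_⟩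
      obtain ⟨X, g1, g2, g3, g4, g5⟩ := h ε h0 (hε.trans (min_le_left _ _)) ⟨a, ha⟩
      refine ⟨X, g1, g2, fun φ => (g3 φ).trans ?_, g4, g5⟩
      have h1 : ε ≤ 1 := hε.trans (min_le_right _ _)
      have := Real.rpow_le_rpow_of_exponent_ge h0 h1 (show (1:ℝ)/3 ≤ 1 by norm_num)
      rw [Real.rpow_one] at this
      gcongr
    · exact ⟨1, one_pos, 1, one_pos, Pa, hPm, hPa, hPv, fun a ha => absurd ⟨(⟨a, ha⟩ : Pa)⟩ hne⟩
  · obtain ⟨c0, hc0, hc0e⟩ := exists_cube b1 _ hb1 hm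
    have hβ : 3 * b1 * c0 ^ 2 ≠ 0 := by positivity
    obtain ⟨κ, γ, hκ, hγ, hγle, Pa, hPm, hPa, hPv, hP⟩ := good_set (fun l : Idx n0 => dotp l ω) 0 (3 * b1 * c0 ^ 2) (c0 ^ 2)
      (by rwa [zero_add]) (Or.inl hβ.symm) hδ0 hη
    by_cases hne : Nonempty (Pt Pa)
    · obtain ⟨μ0, B, hμ0, hB, h⟩ := case1 (ρ := ρ) hPa hκ hγ hP (fun l hl => abs_pos.1 (lt_of_lt_of_le (by positivity) (hΩ1 l hl)))
        hρ0 hρ hr hrf hC hK hc hh hsum hCf0 hKf hCf hsumf f0 f1 f2 f3 hc0e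
      refine ⟨μ0 ^ 3, by positivity, B, hB, Pa, hPm, hPa, hPv, fun a ha ε h0 hε => ?_⟩
      have e3 : (ε ^ ((1:ℝ) / 3)) ^ 3 = ε := by
        rw [← Real.rpow_natCast, ← Real.rpow_mul h0.le]; norm_num
      have hpos : 0 < ε ^ ((1:ℝ) / 3) := by positivity
      have := h (ε ^ ((1:ℝ) / 3)) hpos (le_of_pow_le_pow_left₀ (by norm_num : (3:ℕ) ≠ 0) hμ0.le (by rwa [e3])) ⟨a, ha⟩
      rwa [e3] at this
    · exact ⟨1, one_pos, 1, one_pos, Pa, hPm, hPa, hPv, fun a ha => absurd ⟨(⟨a, ha⟩ : Pa)⟩ hne⟩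

end

end VdP

/-- Theorem 3: the delayed van der Pol oscillator
`ẍ + a(x²−1)ẋ + x = f(x(t−τ0)) + ε g(ω't, x(t), x(t−τ0), ε)` with
`f(0) = f''(0) = 0`, `f'(0) = 1`, `f'''(0) = 6 b1 ≠ 0`, with `ω'` Diophantine and
hypothesis (H4)'', possesses for most parameters `a ∈ [1/4, 5/4]` and all small
`ε > 0` a quasi-periodic solution `x(t) = X(ω' t)` with `sup |X| ≤ C ε^{1/3}`. -/
theorem quasiperiodic_response_van_der_Pol
    (n0 : ℕ) (hn0 : 1 ≤ n0) (ω' : Fin n0 → ℝ) (γ0 : ℝ) (hγ0 : 0 < γ0) (hγ0' : γ0 < 1)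
    -- Diophantine condition on ω'
    (hDioph : ∀ k : Fin n0 → ℤ, k ≠ 0 →
      γ0 * ((∑ i, |(k i : ℝ)|) ^ (n0 + 1))⁻¹ ≤ |∑ i, (k i : ℝ) * ω' i|)
    (f : ℝ → ℝ) (b1 : ℝ) (g : (Fin n0 → ℝ) → ℝ → ℝ → ℝ → ℝ)
    -- analyticity of f and g in all variables, 2π-periodicity of g in the angles
    (hfanal : AnalyticOnNhd ℝ f Set.univ)
    (hganal : AnalyticOnNhd ℝ
      (fun p : (Fin n0 → ℝ) × ℝ × ℝ × ℝ => g p.1 p.2.1 p.2.2.1 p.2.2.2) Set.univ)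
    (hper : ∀ (φ : Fin n0 → ℝ) (m : Fin n0 → ℤ) (x y ε : ℝ),
      g (fun i => φ i + 2 * Real.pi * m i) x y ε = g φ x y ε)
    -- normalization of f at the origin: f(0) = f''(0) = 0, f'(0) = 1, f'''(0) = 6 b1 ≠ 0
    (hf0 : f 0 = 0) (hf1 : deriv f 0 = 1) (hf2 : iteratedDeriv 2 f 0 = 0)
    (hf3 : iteratedDeriv 3 f 0 = 6 * b1) (hb1 : b1 ≠ 0)
    -- (H4)'': at least one of ĝ00 and ĝ10 + ĝ01 has nonvanishing torus average at ε = 0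
    (hH4 : torusAvg n0 (fun φ => g φ 0 0 0) ≠ 0 ∨
      torusAvg n0 (fun φ =>
        deriv (fun x => g φ x 0 0) 0 + deriv (fun y => g φ 0 y 0) 0) ≠ 0) :
    ∀ η : ℝ, 0 < η →
    ∃ εstar : ℝ, 0 < εstar ∧ ∃ C : ℝ, 0 < C ∧
    ∃ Pa : Set ℝ, MeasurableSet Pa ∧ Pa ⊆ Set.Icc (1 / 4 : ℝ) (5 / 4) ∧
      volume (Set.Icc (1 / 4 : ℝ) (5 / 4)) ≤ volume Pa + ENNReal.ofReal η ∧
      ∀ a ∈ Pa, ∀ ε : ℝ, 0 < ε → ε ≤ εstar →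
      ∃ X : (Fin n0 → ℝ) → ℝ,
        -- X is real analytic and 2π-periodic on the torus
        AnalyticOnNhd ℝ X Set.univ ∧
        (∀ (φ : Fin n0 → ℝ) (m : Fin n0 → ℤ),
          X (fun i => φ i + 2 * Real.pi * m i) = X φ) ∧
        -- x = O(ε^{1/3})
        (∀ φ : Fin n0 → ℝ, |X φ| ≤ C * ε ^ ((1 : ℝ) / 3)) ∧
        -- x(t) = X(ω' t) is a (twice differentiable) solution of the equation
        (∀ t : ℝ, DifferentiableAt ℝ (fun t : ℝ => X (fun i => t * ω' i)) t) ∧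
        (∀ t : ℝ,
          HasDerivAt (deriv (fun t : ℝ => X (fun i => t * ω' i)))
            (-(a * ((X (fun i => t * ω' i)) ^ 2 - 1) *
                deriv (fun t : ℝ => X (fun i => t * ω' i)) t)
              - X (fun i => t * ω' i)
              + f (X (fun i => (t - tau0 a) * ω' i))
              + ε * g (fun i => t * ω' i) (X (fun i => t * ω' i))
                  (X (fun i => (t - tau0 a) * ω' i)) ε) t) := by
  intro η hη
  have hF1 : ∀ φ : Fin n0 → ℝ, VdP.gc (fun p : (Fin n0 → ℝ) × ℝ × ℝ × ℝ => g p.1 p.2.1 p.2.2.1 p.2.2.2) 1 (fun _ => 0) φ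
      = deriv (fun x => g φ x 0 0) 0 := fun φ => by
    rw [VdP.gc_one _ hganal]; simp [VdP.eb]
  have hF2 : ∀ φ : Fin n0 → ℝ, VdP.gc (fun p : (Fin n0 → ℝ) × ℝ × ℝ × ℝ => g p.1 p.2.1 p.2.2.1 p.2.2.2) 1 (fun _ => 1) φ
      = deriv (fun y => g φ 0 y 0) 0 := fun φ => by
    rw [VdP.gc_one _ hganal]; simp [VdP.eb]
  exact VdP.main n0 ω' γ0 hγ0 hDioph f b1 (fun p : (Fin n0 → ℝ) × ℝ × ℝ × ℝ => g p.1 p.2.1 p.2.2.1 p.2.2.2) hfanal hganal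
    (fun p m => hper p.1 m p.2.1 p.2.2.1 p.2.2.2) hf0 hf1 hf2 hf3 hb1
    (by simp only [hF1, hF2]; exact hH4) η hη
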